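/- arXiv:1707.03896 — 10 statements merged into one kernel-verified Lean document; each statement's English description precedes it below -/
import Mathlib

section
/- Let G be a finite group, let U and L be subgroups of G such that L normalizes U and U ∩ L = {1}, and let g ∈ L be an element with C_G(g) ≤ L. Then for every finite-dimensional complex representation of G with character φ one has φ(g) = (1/|U|) · ∑_{u ∈ U} φ(g·u); equivalently, φ(g) equals the trace of g acting on the subspace of U-fixed vectors of the representation. -/
/-- If `g` normalizes a finite subgroup `U` and no nontrivial element of `U` commutes with `g`,
then every element of the coset `gU` is conjugate to `g` under `U`. -/
theorem exists_conj_eq_mul_of_disjoint_centralizer {G : Type*} [Group G] (U : Subgroup G)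
    [Finite U] {g : G} (hg : ∀ u ∈ U, g⁻¹ * u * g ∈ U)
    (hU : Disjoint U (Subgroup.centralizer {g})) {v : G} (hv : v ∈ U) :
    ∃ u ∈ U, u * g * u⁻¹ = g * v := by
  let f : U → U := fun u => ⟨g⁻¹ * u * g * (u : G)⁻¹, mul_mem (hg u u.2) (inv_mem u.2)⟩
  have hf : Function.Injective f := by
    intro a b hab
    have h : g⁻¹ * a * g * (a : G)⁻¹ = g⁻¹ * b * g * (b : G)⁻¹ := congrArg Subtype.val hab
    have hconj : (a : G) * g * (a : G)⁻¹ = b * g * (b : G)⁻¹ := by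
      simpa [mul_assoc] using h
    have hmem : (b : G)⁻¹ * a ∈ Subgroup.centralizer {g} := by
      rw [Subgroup.mem_centralizer_singleton_iff, mul_assoc, inv_mul_eq_iff_eq_mul,
        mul_inv_eq_iff_eq_mul.mp hconj]
      group
    exact Subtype.ext (inv_mul_eq_one.mp
      (Subgroup.disjoint_def.mp hU (mul_mem (inv_mem b.2) a.2) hmem)).symm
  obtain ⟨u, hu⟩ := Finite.injective_iff_surjective.mp hf ⟨v, hv⟩
  have h : g⁻¹ * u * g * (u : G)⁻¹ = v := congrArg Subtype.val hu
  exact ⟨u, u.2, by rw [← h]; group⟩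

/-- The character of a representation is invariant under conjugation. -/
theorem Representation.trace_conj {k G V : Type*} [CommSemiring k] [Group G] [AddCommMonoid V]
    [Module k V] (ρ : Representation k G V) (g u : G) :
    LinearMap.trace k V (ρ (u * g * u⁻¹)) = LinearMap.trace k V (ρ g) := by
  rw [map_mul, LinearMap.trace_mul_comm, ← map_mul]
  group

/-- complex-character case of Proposition 2.1.
Let `G` be a finite group, `U, L` subgroups with `L` normalizing `U` and `U ∩ L = 1`,
and `g ∈ L` with `C_G(g) ≤ L`. Then for every finite-dimensional complex representation
of `G` with character `φ`, one has `φ(g) = (1/|U|) · ∑_{u ∈ U} φ(g·u)`. -/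
theorem character_average_over_unipotent_radical
    {G : Type*} [Group G] [Fintype G] (U L : Subgroup G) [Fintype U]
    (hnorm : ∀ l ∈ L, ∀ u ∈ U, l * u * l⁻¹ ∈ U)
    (hint : U ⊓ L = ⊥)
    (g : G) (hg : g ∈ L)
    (hcent : Subgroup.centralizer {g} ≤ L)
    {V : Type*} [AddCommGroup V] [Module ℂ V] [FiniteDimensional ℂ V]
    (ρ : Representation ℂ G V) :
    LinearMap.trace ℂ V (ρ g) =
      (1 / (Fintype.card U : ℂ)) * ∑ u : U, LinearMap.trace ℂ V (ρ (g * (u : G))) := by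
  have hnorm' : ∀ u ∈ U, g⁻¹ * u * g ∈ U := fun u hu => by
    simpa using hnorm g⁻¹ (inv_mem hg) u hu
  have hdisj : Disjoint U (Subgroup.centralizer {g}) :=
    (disjoint_iff.mpr hint).mono_right hcent
  have htrace (v : U) : LinearMap.trace ℂ V (ρ (g * (v : G))) = LinearMap.trace ℂ V (ρ g) := by
    obtain ⟨u, -, hu⟩ := exists_conj_eq_mul_of_disjoint_centralizer U hnorm' hdisj v.2
    rw [← hu, ρ.trace_conj]
  simp only [htrace]
  simp
end

section
/- Let m, k ≥ 1 and let x_{c,i} ≥ 0 (1 ≤ c ≤ m, 1 ≤ i ≤ k) be non-negative real numbers. Set R_c = ∑_{i=1}^k x_{c,i}, C_i = ∑_{c=1}^m x_{c,i}, and n = ∑_{c,i} x_{c,i}. Then (∑_{1≤c<c'≤m} R_c·R_{c'}) · (∑_{1≤i<j≤k} C_i·C_j) ≤ n² · ∑_{i≠j} ∑_{1≤c<c'≤m} x_{c,i}·x_{c',j}. -/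
/-- The indicator, as a real number, that two elements differ. -/
def neInd {β : Type*} [DecidableEq β] (a b : β) : ℝ := if a ≠ b then 1 else 0

theorem neInd_eq_zero_or_one {β : Type*} [DecidableEq β] (a b : β) :
    a = b ∧ neInd a b = 0 ∨ a ≠ b ∧ neInd a b = 1 := by
  by_cases h : a = b <;> simp [neInd, h]

/-- Among four points with labels `r` and `s`, the splittings into an `r`-separated pair and an
`s`-separated complementary pair number at most twice the pairs separated by both labels. -/
theorem neInd_four_points {β γ : Type*} [DecidableEq β] [DecidableEq γ]
    (r₁ r₂ r₃ r₄ : β) (s₁ s₂ s₃ s₄ : γ) :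
    neInd r₁ r₂ * neInd s₃ s₄ + neInd r₁ r₃ * neInd s₂ s₄ + neInd r₁ r₄ * neInd s₂ s₃ +
      neInd r₂ r₃ * neInd s₁ s₄ + neInd r₂ r₄ * neInd s₁ s₃ + neInd r₃ r₄ * neInd s₁ s₂ ≤
    2 * (neInd r₁ r₂ * neInd s₁ s₂ + neInd r₁ r₃ * neInd s₁ s₃ + neInd r₁ r₄ * neInd s₁ s₄ +
      neInd r₂ r₃ * neInd s₂ s₃ + neInd r₂ r₄ * neInd s₂ s₄ + neInd r₃ r₄ * neInd s₃ s₄) := by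
  have hr := fun a b : β => neInd_eq_zero_or_one a b
  have hs := fun a b : γ => neInd_eq_zero_or_one a b
  rcases hr r₁ r₂ with ⟨h12, e12⟩ | ⟨h12, e12⟩ <;> rcases hr r₁ r₃ with ⟨h13, e13⟩ | ⟨h13, e13⟩ <;>
  rcases hr r₁ r₄ with ⟨h14, e14⟩ | ⟨h14, e14⟩ <;> rcases hr r₂ r₃ with ⟨h23, e23⟩ | ⟨h23, e23⟩ <;>
  rcases hr r₂ r₄ with ⟨h24, e24⟩ | ⟨h24, e24⟩ <;> rcases hr r₃ r₄ with ⟨h34, e34⟩ | ⟨h34, e34⟩ <;>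
  first
  | (exfalso; clear hr hs; grind)
  | (rw [e12, e13, e14, e23, e24, e34]
     simp only [zero_mul, one_mul, zero_add, add_zero, mul_zero, le_refl] <;>
     (clear * -
      unfold neInd
      grind))

theorem sum_quadruple_product {α : Type*} (t : Finset α) (w : α → ℝ) (g h : α → α → ℝ) :
    ∑ a ∈ t, ∑ b ∈ t, ∑ c ∈ t, ∑ d ∈ t, w a * w b * w c * w d * (g a b * h c d) =
      (∑ a ∈ t, ∑ b ∈ t, w a * w b * g a b) * ∑ c ∈ t, ∑ d ∈ t, w c * w d * h c d := by
  simp only [Finset.sum_mul]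
  simp only [Finset.mul_sum]
  refine Finset.sum_congr rfl fun a _ => Finset.sum_congr rfl fun b _ =>
    Finset.sum_congr rfl fun c _ => Finset.sum_congr rfl fun d _ => ?_
  ring

/-- For two independent samples from a finite measure `w`, the events of differing in `r` and of
differing in `s` have product of masses at most twice the normalised mass of both. -/
theorem sum_neInd_mul_sum_neInd_le {α β γ : Type*} [DecidableEq β] [DecidableEq γ]
    (t : Finset α) (w : α → ℝ) (hw : ∀ a ∈ t, 0 ≤ w a) (r : α → β) (s : α → γ) :
    (∑ a ∈ t, ∑ b ∈ t, w a * w b * neInd (r a) (r b)) *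
      (∑ a ∈ t, ∑ b ∈ t, w a * w b * neInd (s a) (s b)) ≤
    2 * (∑ a ∈ t, w a) ^ 2 *
      ∑ a ∈ t, ∑ b ∈ t, w a * w b * (neInd (r a) (r b) * neInd (s a) (s b)) := by
  let S : (α → α → α → α → ℝ) → ℝ := fun F =>
    ∑ a ∈ t, ∑ b ∈ t, ∑ c ∈ t, ∑ d ∈ t, w a * w b * w c * w d * F a b c d
  have S_swap₁ : ∀ F, S (fun a b c d => F b a c d) = S F := by
    intro F
    simp only [S]
    rw [Finset.sum_comm]
    refine Finset.sum_congr rfl fun a _ => Finset.sum_congr rfl fun b _ =>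
      Finset.sum_congr rfl fun c _ => Finset.sum_congr rfl fun d _ => ?_
    ring
  have S_swap₂ : ∀ F, S (fun a b c d => F a c b d) = S F := by
    intro F
    simp only [S]
    refine Finset.sum_congr rfl fun a _ => ?_
    rw [Finset.sum_comm]
    refine Finset.sum_congr rfl fun b _ =>
      Finset.sum_congr rfl fun c _ => Finset.sum_congr rfl fun d _ => ?_
    ring
  have S_swap₃ : ∀ F, S (fun a b c d => F a b d c) = S F := by
    intro F
    simp only [S]
    refine Finset.sum_congr rfl fun a _ => Finset.sum_congr rfl fun b _ => ?_
    rw [Finset.sum_comm]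
    refine Finset.sum_congr rfl fun c _ => Finset.sum_congr rfl fun d _ => ?_
    ring
  have S_add : ∀ F G, S (fun a b c d => F a b c d + G a b c d) = S F + S G := by
    intro F G
    simp only [S, mul_add, Finset.sum_add_distrib]
  have S_mono : ∀ F G, (∀ a b c d, F a b c d ≤ G a b c d) → S F ≤ S G := by
    intro F G hFG
    refine Finset.sum_le_sum fun a ha => Finset.sum_le_sum fun b hb =>
      Finset.sum_le_sum fun c hc => Finset.sum_le_sum fun d hd => ?_
    have := hw a ha
    have := hw b hb
    have := hw c hc
    have := hw d hd
    exact mul_le_mul_of_nonneg_left (hFG a b c d) (by positivity)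
  -- the six ways of choosing the first pair contribute equally
  have S_six : ∀ F : α → α → α → α → ℝ, S (fun a b c d => F a b c d + F a c b d + F a d b c +
      F b c a d + F b d a c + F c d a b) = 6 * S F := by
    intro F
    have h₂ : S (fun a b c d => F a c b d) = S F := S_swap₂ F
    have h₃ : S (fun a b c d => F a d b c) = S F :=
      (S_swap₃ fun a b c d => F a c b d).trans h₂
    have h₄ : S (fun a b c d => F b c a d) = S F :=
      (S_swap₁ fun a b c d => F a c b d).trans h₂
    have h₅ : S (fun a b c d => F b d a c) = S F :=
      (S_swap₁ fun a b c d => F a d b c).trans h₃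
    have h₆ : S (fun a b c d => F c d a b) = S F :=
      (S_swap₂ fun a b c d => F b d a c).trans h₅
    simp only [S_add, h₂, h₃, h₄, h₅, h₆]
    ring
  have key := S_mono _ _ fun a b c d =>
    neInd_four_points (r a) (r b) (r c) (r d) (s a) (s b) (s c) (s d)
  have hleft := S_six fun a b c d => neInd (r a) (r b) * neInd (s c) (s d)
  have hright := S_six fun a b _ _ => 2 * (neInd (r a) (r b) * neInd (s a) (s b))
  simp only [← mul_add] at hright
  rw [hleft, hright] at key
  have eleft := sum_quadruple_product t w (fun a b => neInd (r a) (r b))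
    (fun a b => neInd (s a) (s b))
  have eright := sum_quadruple_product t w
    (fun a b => 2 * (neInd (r a) (r b) * neInd (s a) (s b))) (fun _ _ => 1)
  have hsq : ∑ c ∈ t, ∑ d ∈ t, w c * w d * 1 = (∑ a ∈ t, w a) ^ 2 := by
    simp only [mul_one, sq, Finset.sum_mul_sum]
  have htwo : ∑ a ∈ t, ∑ b ∈ t, w a * w b * (2 * (neInd (r a) (r b) * neInd (s a) (s b))) =
      2 * ∑ a ∈ t, ∑ b ∈ t, w a * w b * (neInd (r a) (r b) * neInd (s a) (s b)) := by
    simp only [Finset.mul_sum]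
    refine Finset.sum_congr rfl fun a _ => Finset.sum_congr rfl fun b _ => ?_
    ring
  rw [hsq, htwo] at eright
  simp only [mul_one] at eright
  simp only [S] at key
  rw [eleft, eright] at key
  linarith

/-- A symmetric sum over ordered pairs of distinct indices is twice the sum over `c < c'`. -/
theorem two_mul_sum_Icc_sum_Ioc (m : ℕ) (F : ℕ → ℕ → ℝ) (hF : ∀ c c', F c c' = F c' c) :
    2 * ∑ c ∈ Finset.Icc 1 m, ∑ c' ∈ Finset.Ioc c m, F c c' =
      ∑ c ∈ Finset.Icc 1 m, ∑ c' ∈ Finset.Icc 1 m, F c c' * neInd c c' := by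
  have hlt : ∑ c ∈ Finset.Icc 1 m, ∑ c' ∈ Finset.Ioc c m, F c c' =
      ∑ c ∈ Finset.Icc 1 m, ∑ c' ∈ Finset.Icc 1 m, if c < c' then F c c' else 0 := by
    refine Finset.sum_congr rfl fun c _ => ?_
    rw [← Finset.sum_filter]
    refine Finset.sum_congr ?_ fun _ _ => rfl
    grind
  have hgt : ∑ c ∈ Finset.Icc 1 m, ∑ c' ∈ Finset.Ioc c m, F c c' =
      ∑ c ∈ Finset.Icc 1 m, ∑ c' ∈ Finset.Icc 1 m, if c' < c then F c c' else 0 := by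
    rw [hlt, Finset.sum_comm]
    simp only [hF]
  rw [two_mul]
  nth_rewrite 1 [hlt]
  rw [hgt]
  simp only [← Finset.sum_add_distrib]
  refine Finset.sum_congr rfl fun c _ => Finset.sum_congr rfl fun c' _ => ?_
  rcases lt_trichotomy c c' with h | h | h
  · simp [neInd, h, h.ne, h.not_gt]
  · simp [neInd, h]
  · simp [neInd, h, h.ne', h.not_gt]


/-- the key combinatorial inequality (ineqb) of the paper.
For non-negative reals `x_{c,i}` (`1 ≤ c ≤ m`, `1 ≤ i ≤ k`), with row sums `R_c`,
column sums `C_i` and total sum `n`: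
`(∑_{c<c'} R_c R_{c'}) · (∑_{i<j} C_i C_j) ≤ n² · ∑_{i≠j} ∑_{c<c'} x_{c,i} x_{c',j}`. -/
theorem levi_ratio_inequality (m k : ℕ) (hm : 1 ≤ m) (hk : 1 ≤ k)
    (x : ℕ → ℕ → ℝ) (hx : ∀ c ∈ Finset.Icc 1 m, ∀ i ∈ Finset.Icc 1 k, 0 ≤ x c i) :
    (∑ c ∈ Finset.Icc 1 m, ∑ c' ∈ Finset.Ioc c m,
        (∑ i ∈ Finset.Icc 1 k, x c i) * (∑ i ∈ Finset.Icc 1 k, x c' i)) *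
      (∑ i ∈ Finset.Icc 1 k, ∑ j ∈ Finset.Ioc i k,
        (∑ c ∈ Finset.Icc 1 m, x c i) * (∑ c ∈ Finset.Icc 1 m, x c j)) ≤
    (∑ c ∈ Finset.Icc 1 m, ∑ i ∈ Finset.Icc 1 k, x c i) ^ 2 *
      ∑ i ∈ Finset.Icc 1 k, ∑ j ∈ (Finset.Icc 1 k).erase i,
        ∑ c ∈ Finset.Icc 1 m, ∑ c' ∈ Finset.Ioc c m, x c i * x c' j := by
  have hw : ∀ p ∈ Finset.Icc 1 m ×ˢ Finset.Icc 1 k, 0 ≤ x p.1 p.2 := fun p hp =>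
    hx _ (Finset.mem_product.1 hp).1 _ (Finset.mem_product.1 hp).2
  have key := sum_neInd_mul_sum_neInd_le _ (fun p : ℕ × ℕ => x p.1 p.2) hw Prod.fst Prod.snd
  simp only [Finset.sum_product] at key
  have hrow := two_mul_sum_Icc_sum_Ioc m
    (fun c c' => (∑ i ∈ Finset.Icc 1 k, x c i) * (∑ i ∈ Finset.Icc 1 k, x c' i))
    (fun _ _ => mul_comm _ _)
  have hcol := two_mul_sum_Icc_sum_Ioc k
    (fun i j => (∑ c ∈ Finset.Icc 1 m, x c i) * (∑ c ∈ Finset.Icc 1 m, x c j))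
    (fun _ _ => mul_comm _ _)
  have hboth := two_mul_sum_Icc_sum_Ioc m
    (fun c c' => ∑ i ∈ Finset.Icc 1 k, ∑ j ∈ Finset.Icc 1 k, x c i * x c' j * neInd i j)
    (fun c c' => by
      rw [Finset.sum_comm]
      refine Finset.sum_congr rfl fun i _ => Finset.sum_congr rfl fun j _ => ?_
      simp only [neInd, ne_comm, mul_comm (x c j)])
  have erow : ∑ c ∈ Finset.Icc 1 m, ∑ i ∈ Finset.Icc 1 k, ∑ c' ∈ Finset.Icc 1 m,
      ∑ j ∈ Finset.Icc 1 k, x c i * x c' j * neInd c c' =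
      ∑ c ∈ Finset.Icc 1 m, ∑ c' ∈ Finset.Icc 1 m,
        (∑ i ∈ Finset.Icc 1 k, x c i) * (∑ i ∈ Finset.Icc 1 k, x c' i) * neInd c c' := by
    refine Finset.sum_congr rfl fun c _ => ?_
    rw [Finset.sum_comm]
    simp only [Finset.sum_mul_sum]
    simp only [Finset.sum_mul]
  have ecol : ∑ c ∈ Finset.Icc 1 m, ∑ i ∈ Finset.Icc 1 k, ∑ c' ∈ Finset.Icc 1 m,
      ∑ j ∈ Finset.Icc 1 k, x c i * x c' j * neInd i j =
      ∑ i ∈ Finset.Icc 1 k, ∑ j ∈ Finset.Icc 1 k,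
        (∑ c ∈ Finset.Icc 1 m, x c i) * (∑ c ∈ Finset.Icc 1 m, x c j) * neInd i j := by
    rw [Finset.sum_comm]
    refine Finset.sum_congr rfl fun i _ => ?_
    simp only [Finset.sum_mul_sum]
    simp only [Finset.sum_mul]
    rw [Finset.sum_comm (s := Finset.Icc 1 k)]
    refine Finset.sum_congr rfl fun c _ => ?_
    rw [Finset.sum_comm]
  have eboth : ∑ c ∈ Finset.Icc 1 m, ∑ i ∈ Finset.Icc 1 k, ∑ c' ∈ Finset.Icc 1 m,
      ∑ j ∈ Finset.Icc 1 k, x c i * x c' j * (neInd c c' * neInd i j) =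
      ∑ c ∈ Finset.Icc 1 m, ∑ c' ∈ Finset.Icc 1 m,
        (∑ i ∈ Finset.Icc 1 k, ∑ j ∈ Finset.Icc 1 k, x c i * x c' j * neInd i j) *
          neInd c c' := by
    refine Finset.sum_congr rfl fun c _ => ?_
    rw [Finset.sum_comm]
    simp only [Finset.sum_mul]
    refine Finset.sum_congr rfl fun c' _ => Finset.sum_congr rfl fun i _ =>
      Finset.sum_congr rfl fun j _ => ?_
    ring
  have herase : ∑ i ∈ Finset.Icc 1 k, ∑ j ∈ (Finset.Icc 1 k).erase i,
      ∑ c ∈ Finset.Icc 1 m, ∑ c' ∈ Finset.Ioc c m, x c i * x c' j =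
      ∑ c ∈ Finset.Icc 1 m, ∑ c' ∈ Finset.Ioc c m,
        ∑ i ∈ Finset.Icc 1 k, ∑ j ∈ Finset.Icc 1 k, x c i * x c' j * neInd i j := by
    have hj : ∀ c c' i, ∑ j ∈ Finset.Icc 1 k, x c i * x c' j * neInd i j =
        ∑ j ∈ (Finset.Icc 1 k).erase i, x c i * x c' j := by
      intro c c' i
      simp only [neInd, mul_ite, mul_one, mul_zero, ← Finset.sum_filter, Finset.filter_ne]
    simp only [hj]
    calc _ = ∑ i ∈ Finset.Icc 1 k, ∑ c ∈ Finset.Icc 1 m, ∑ c' ∈ Finset.Ioc c m,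
          ∑ j ∈ (Finset.Icc 1 k).erase i, x c i * x c' j := by
          refine Finset.sum_congr rfl fun i _ => ?_
          rw [Finset.sum_comm]
          exact Finset.sum_congr rfl fun c _ => Finset.sum_comm
      _ = _ := by
          rw [Finset.sum_comm]
          exact Finset.sum_congr rfl fun c _ => Finset.sum_comm
  rw [erow, ecol, eboth, ← hrow, ← hcol, ← hboth, ← herase] at key
  linarith
end

section
/- Let n_1, …, n_m be positive integers with n = n_1 + ⋯ + n_m. Then β(n_1, …, n_m) ≤ ½ · (1 + (n_1² + ⋯ + n_m²)/n²). -/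
/-- For a real matrix and positive weights `p i`, the sum of the squared column sums is
at most `(∑ p i) * ∑ i, (∑ j, x i j ^ 2) / p i`. -/
theorem sum_sq_column_sum_le {ι κ : Type*} [Fintype ι] (J : Finset κ) (x : ι → κ → ℝ)
    (p : ι → ℝ) (hp : ∀ i, 0 < p i) :
    ∑ j ∈ J, (∑ i, x i j) ^ 2 ≤ (∑ i, p i) * ∑ i, (∑ j ∈ J, x i j ^ 2) / p i := by
  calc ∑ j ∈ J, (∑ i, x i j) ^ 2
      ≤ ∑ j ∈ J, (∑ i, p i) * ∑ i, x i j ^ 2 / p i := by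
        refine Finset.sum_le_sum fun j _ => ?_
        refine Finset.sum_sq_le_sum_mul_sum_of_sq_le_mul _ (fun i _ => (hp i).le)
          (fun i _ => div_nonneg (sq_nonneg _) (hp i).le) fun i _ => ?_
        rw [mul_div_cancel₀ _ (hp i).ne']
    _ = (∑ i, p i) * ∑ i, (∑ j ∈ J, x i j ^ 2) / p i := by
        rw [← Finset.mul_sum, Finset.sum_comm]
        simp_rw [Finset.sum_div]

/-- With `N = ∑ p i`, each entry satisfies `2 * N * p i ≤ N ^ 2 + ∑ p i ^ 2`, in divided form. -/
theorem le_half_one_add_mul_sum {ι : Type*} [Fintype ι] (p : ι → ℝ) (hp : ∀ i, 0 < p i) (i : ι) :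
    p i ≤ (1 / 2) * (1 + (∑ i, p i ^ 2) / (∑ i, p i) ^ 2) * ∑ i, p i := by
  have hN : 0 < ∑ i, p i := Finset.sum_pos (fun i _ => hp i) ⟨i, Finset.mem_univ i⟩
  have hQ : p i ^ 2 ≤ ∑ i, p i ^ 2 :=
    Finset.single_le_sum (f := fun i => p i ^ 2) (fun k _ => sq_nonneg (p k)) (Finset.mem_univ i)
  have h : (1 / 2) * (1 + (∑ i, p i ^ 2) / (∑ i, p i) ^ 2) * ∑ i, p i =
      ((∑ i, p i) ^ 2 + ∑ i, p i ^ 2) / (2 * ∑ i, p i) := by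
    field_simp
  rw [h, le_div_iff₀ (by positivity)]
  nlinarith [sq_nonneg ((∑ k, p k) - p i)]

/-- The ratio bound for an arbitrary nonnegative matrix with positive row sums `p i`. -/
theorem sum_sq_sub_div_le {ι κ : Type*} [Fintype ι] (J : Finset κ) (x : ι → κ → ℝ)
    (p : ι → ℝ) (hp : ∀ i, 0 < p i) (hx : ∀ i j, 0 ≤ x i j) (hsum : ∀ i, ∑ j ∈ J, x i j = p i) :
    (∑ i, (p i ^ 2 - ∑ j ∈ J, x i j ^ 2)) / ((∑ i, p i) ^ 2 - ∑ j ∈ J, (∑ i, x i j) ^ 2) ≤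
      (1 / 2) * (1 + (∑ i, p i ^ 2) / (∑ i, p i) ^ 2) := by
  set C := (1 / 2) * (1 + (∑ i, p i ^ 2) / (∑ i, p i) ^ 2) with hC
  have hC0 : 0 ≤ C := by positivity
  have hw : ∀ i, 0 ≤ p i - (∑ j ∈ J, x i j ^ 2) / p i := fun i => by
    rw [sub_nonneg, div_le_iff₀ (hp i), ← sq, ← hsum i]
    exact Finset.sum_sq_le_sq_sum_of_nonneg fun j _ => hx i j
  have hden : (∑ i, p i) * ∑ i, (p i - (∑ j ∈ J, x i j ^ 2) / p i) ≤
      (∑ i, p i) ^ 2 - ∑ j ∈ J, (∑ i, x i j) ^ 2 := by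
    rw [Finset.sum_sub_distrib, mul_sub, ← sq]
    exact sub_le_sub_left (sum_sq_column_sum_le J x p hp) _
  have hden0 : 0 ≤ (∑ i, p i) * ∑ i, (p i - (∑ j ∈ J, x i j ^ 2) / p i) :=
    mul_nonneg (Finset.sum_nonneg fun i _ => (hp i).le) (Finset.sum_nonneg fun i _ => hw i)
  refine div_le_of_le_mul₀ (hden0.trans hden) hC0 ?_
  refine le_trans ?_ (mul_le_mul_of_nonneg_left hden hC0)
  rw [← mul_assoc, Finset.mul_sum]
  refine Finset.sum_le_sum fun i _ => ?_
  refine le_trans (le_of_eq ?_)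
    (mul_le_mul_of_nonneg_right (le_half_one_add_mul_sum p hp i) (hw i))
  rw [mul_sub, mul_div_cancel₀ _ (hp i).ne', sq]

/-- The set of ratios `(∑_i (n_i² − ∑_j a_{ij}²)) / (n² − ∑_j (∑_i a_{ij})²)` over all
matrices `(a_{ij})` of non-negative integers with `j`-th column indexed by `0 ≤ j < n`,
each row `i` summing to `ν i` and non-increasing, and with some second entry `a i 1`
positive. -/
def betaRatioSet (m : ℕ) (ν : Fin m → ℕ) : Set ℝ :=
  {r : ℝ | ∃ a : Fin m → ℕ → ℕ,
    (∀ i, ∑ j ∈ Finset.range (∑ i, ν i), a i j = ν i) ∧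
    (∀ i j, a i (j + 1) ≤ a i j) ∧
    (∃ i, 0 < a i 1) ∧
    r = (∑ i, ((ν i : ℝ) ^ 2 - ∑ j ∈ Finset.range (∑ i, ν i), (a i j : ℝ) ^ 2)) /
        ((∑ i, (ν i : ℝ)) ^ 2 -
          ∑ j ∈ Finset.range (∑ i, ν i), (∑ i, (a i j : ℝ)) ^ 2)}

/-- The quantity `β(n_1, …, n_m)` of the paper: `0` if all `n_i ≤ 1`, and otherwise the
supremum (in fact maximum) of the finite nonempty set of ratios above. -/
noncomputable def betaGL (m : ℕ) (ν : Fin m → ℕ) : ℝ :=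
  if ∀ i, ν i ≤ 1 then 0 else sSup (betaRatioSet m ν)

/-- type-A case of Theorem 1.5. For positive integers
`n_1, …, n_m` with `n = n_1 + ⋯ + n_m`:
`β(n_1, …, n_m) ≤ ½·(1 + (n_1² + ⋯ + n_m²)/n²)`. -/
theorem betaGL_le_half_one_add (m : ℕ) (hm : 1 ≤ m) (ν : Fin m → ℕ)
    (hν : ∀ i, 1 ≤ ν i) :
    betaGL m ν ≤ (1 / 2) * (1 + (∑ i, (ν i : ℝ) ^ 2) / (∑ i, (ν i : ℝ)) ^ 2) := by
  have hbound : 0 ≤ (1 / 2) * (1 + (∑ i, (ν i : ℝ) ^ 2) / (∑ i, (ν i : ℝ)) ^ 2) := by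
    positivity
  unfold betaGL
  split_ifs
  · exact hbound
  · refine Real.sSup_le ?_ hbound
    rintro r ⟨a, hsum, -, -, rfl⟩
    exact sum_sq_sub_div_le _ (fun i j => (a i j : ℝ)) (fun i => (ν i : ℝ))
      (fun i => Nat.cast_pos.2 (hν i)) (fun i j => Nat.cast_nonneg _)
      (fun i => by exact_mod_cast hsum i)
end

section
/- Let n ≥ 1 and let a_1 ≥ a_2 ≥ ⋯ ≥ a_n ≥ 0 and b_1 ≥ b_2 ≥ ⋯ ≥ b_n ≥ 0 be non-negative integers with A := ∑_i a_i ≥ 1 and B := ∑_i b_i ≥ 1. Then (A² − ∑_{i=1}^n a_i²)/A + (B² − ∑_{i=1}^n b_i²)/B ≤ ((A+B)² − ∑_{i=1}^n (a_i+b_i)²)/(A+B). -/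
theorem add_sq_div_add_le {A B : ℝ} (hA : 0 < A) (hB : 0 < B) (x y : ℝ) :
    (x + y) ^ 2 / (A + B) ≤ x ^ 2 / A + y ^ 2 / B := by
  rw [div_add_div _ _ hA.ne' hB.ne', div_le_div_iff₀ (by positivity) (by positivity)]
  linarith [sq_nonneg (B * x - A * y)]

theorem sum_add_sq_div_add_le {ι : Type*} (s : Finset ι) {A B : ℝ} (hA : 0 < A) (hB : 0 < B)
    (x y : ι → ℝ) :
    (∑ i ∈ s, (x i + y i) ^ 2) / (A + B) ≤ (∑ i ∈ s, x i ^ 2) / A + (∑ i ∈ s, y i ^ 2) / B := by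
  simp only [Finset.sum_div, ← Finset.sum_add_distrib]
  exact Finset.sum_le_sum fun i _ => add_sq_div_add_le hA hB (x i) (y i)

/-- Lemma 4.10: superadditivity of `h(α) = (A² − ∑ a_i²)/A`.
For partitions `a_1 ≥ ⋯ ≥ a_n ≥ 0` of `A ≥ 1` and `b_1 ≥ ⋯ ≥ b_n ≥ 0` of `B ≥ 1`:
`(A² − ∑ a_i²)/A + (B² − ∑ b_i²)/B ≤ ((A+B)² − ∑ (a_i+b_i)²)/(A+B)`. -/
theorem partition_h_superadditive (n : ℕ) (hn : 1 ≤ n) (a b : Fin n → ℕ)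
    (ha : ∀ i j : Fin n, i ≤ j → a j ≤ a i) (hb : ∀ i j : Fin n, i ≤ j → b j ≤ b i)
    (hA : 1 ≤ ∑ i, a i) (hB : 1 ≤ ∑ i, b i) :
    ((∑ i, (a i : ℝ)) ^ 2 - ∑ i, (a i : ℝ) ^ 2) / (∑ i, (a i : ℝ)) +
      ((∑ i, (b i : ℝ)) ^ 2 - ∑ i, (b i : ℝ) ^ 2) / (∑ i, (b i : ℝ)) ≤
    (((∑ i, (a i : ℝ)) + (∑ i, (b i : ℝ))) ^ 2 - ∑ i, ((a i : ℝ) + (b i : ℝ)) ^ 2) /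
      ((∑ i, (a i : ℝ)) + (∑ i, (b i : ℝ))) := by
  have hA' : (0 : ℝ) < ∑ i, (a i : ℝ) := by exact_mod_cast hA
  have hB' : (0 : ℝ) < ∑ i, (b i : ℝ) := by exact_mod_cast hB
  have h := sum_add_sq_div_add_le Finset.univ hA' hB' (fun i => (a i : ℝ)) (fun i => (b i : ℝ))
  have sq_sub_div {C : ℝ} (hC : 0 < C) (S : ℝ) : (C ^ 2 - S) / C = C - S / C := by
    field_simp
  rw [sq_sub_div hA', sq_sub_div hB', sq_sub_div (add_pos hA' hB')]
  linarith
end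

section
/- Let n_1 ≥ n_2 ≥ ⋯ ≥ n_m ≥ 1 be positive integers with n = n_1 + ⋯ + n_m, suppose n_1 ≥ 2, and let t be the number of indices i with n_i = n_1. Then (n_1 − 1)/(n − t) ≤ β(n_1, …, n_m) ≤ n_1/n. -/
theorem sum_range_eq_zero_add_one {M : Type*} [AddCommMonoid M] {n : ℕ} (hn : 2 ≤ n) (f : ℕ → M)
    (hf : ∀ j, 2 ≤ j → f j = 0) : ∑ j ∈ Finset.range n, f j = f 0 + f 1 := by
  rw [← Finset.sum_subset (Finset.range_subset_range.2 hn)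
    fun j _ hj => hf j (by simpa [Nat.succ_le_iff] using hj)]
  simp [Finset.sum_range_succ]

theorem mem_betaRatioSet_le {m : ℕ} {ν : Fin m → ℕ} {N : ℕ} (hν : ∀ i, 1 ≤ ν i)
    (hN : ∀ i, ν i ≤ N) {r : ℝ} (hr : r ∈ betaRatioSet m ν) :
    r ≤ (N : ℝ) / (∑ i, ν i : ℕ) := by
  obtain ⟨a, ha, -, ⟨i₀, -⟩, rfl⟩ := hr
  push_cast
  set s := Finset.range (∑ i, ν i)
  have hpos : ∀ i, (0 : ℝ) < ν i := fun i => by exact_mod_cast hν i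
  have hn : (0 : ℝ) < ∑ i, (ν i : ℝ) := Finset.sum_pos (fun i _ => hpos i) ⟨i₀, Finset.mem_univ _⟩
  have hrow : ∀ i, ∑ j ∈ s, (a i j : ℝ) ^ 2 ≤ (ν i : ℝ) ^ 2 := fun i => by
    rw [← ha i]
    push_cast
    exact Finset.sum_sq_le_sq_sum_of_nonneg fun j _ => Nat.cast_nonneg _
  have hcol : ∀ j, (∑ i, (a i j : ℝ)) ^ 2 ≤ (∑ i, (ν i : ℝ)) * ∑ i, (a i j : ℝ) ^ 2 / ν i :=
    fun j => by
      have := Finset.sq_sum_div_le_sum_sq_div Finset.univ (fun i => (a i j : ℝ))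
        (g := fun i => (ν i : ℝ)) fun i _ => hpos i
      rwa [div_le_iff₀' hn] at this
  have hden : (∑ i, (ν i : ℝ)) * ∑ i, ((ν i : ℝ) ^ 2 - ∑ j ∈ s, (a i j : ℝ) ^ 2) / ν i ≤
      (∑ i, (ν i : ℝ)) ^ 2 - ∑ j ∈ s, (∑ i, (a i j : ℝ)) ^ 2 := by
    have hsum := Finset.sum_le_sum fun j (_ : j ∈ s) => hcol j
    rw [← Finset.mul_sum, Finset.sum_comm] at hsum
    have hsplit : ∑ i, ((ν i : ℝ) ^ 2 - ∑ j ∈ s, (a i j : ℝ) ^ 2) / ν i =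
        ∑ i, (ν i : ℝ) - ∑ i, ∑ j ∈ s, (a i j : ℝ) ^ 2 / ν i := by
      rw [← Finset.sum_sub_distrib]
      refine Finset.sum_congr rfl fun i _ => ?_
      rw [sub_div, Finset.sum_div, sq, mul_div_cancel_right₀ _ (hpos i).ne']
    rw [hsplit, mul_sub, ← sq]
    exact sub_le_sub_left hsum _
  have hnum : ∑ i, ((ν i : ℝ) ^ 2 - ∑ j ∈ s, (a i j : ℝ) ^ 2) ≤
      N * ∑ i, ((ν i : ℝ) ^ 2 - ∑ j ∈ s, (a i j : ℝ) ^ 2) / ν i := by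
    rw [Finset.mul_sum]
    refine Finset.sum_le_sum fun i _ => ?_
    rw [mul_div_assoc', le_div_iff₀ (hpos i), mul_comm]
    exact mul_le_mul_of_nonneg_right (by exact_mod_cast hN i) (sub_nonneg.2 (hrow i))
  have hnonneg : 0 ≤ ∑ i, ((ν i : ℝ) ^ 2 - ∑ j ∈ s, (a i j : ℝ) ^ 2) / ν i :=
    Finset.sum_nonneg fun i _ => div_nonneg (sub_nonneg.2 (hrow i)) (hpos i).le
  refine div_le_of_le_mul₀ ((mul_nonneg hn.le hnonneg).trans hden) (by positivity)
    (hnum.trans ?_)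
  rw [div_mul_eq_mul_div, le_div_iff₀ hn, mul_assoc, mul_comm (Finset.sum _ _) (Finset.sum _ _)]
  exact mul_le_mul_of_nonneg_left hden (Nat.cast_nonneg _)

theorem div_mem_betaRatioSet {m : ℕ} {ν : Fin m → ℕ} {i₀ : Fin m} (h2 : 2 ≤ ν i₀) :
    ((ν i₀ : ℝ) - 1) / ((∑ i, ν i : ℕ) -
      ((Finset.univ.filter fun i : Fin m => ν i = ν i₀).card : ℝ)) ∈ betaRatioSet m ν := by
  have hn : 2 ≤ ∑ i, ν i :=
    h2.trans (Finset.single_le_sum (fun _ _ => Nat.zero_le _) (Finset.mem_univ i₀))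
  set t := (Finset.univ.filter fun i : Fin m => ν i = ν i₀).card
  have ht0 : (0 : ℝ) < t := by
    exact_mod_cast Finset.card_pos.2 ⟨i₀, by simp⟩
  have hind : ∑ i, (if ν i = ν i₀ then (1 : ℝ) else 0) = t := by
    rw [Finset.sum_boole]
  let a : Fin m → ℕ → ℕ := fun i j =>
    if j = 0 then ν i - (if ν i = ν i₀ then 1 else 0)
    else if j = 1 then (if ν i = ν i₀ then 1 else 0) else 0
  have ha : ∀ i j, 2 ≤ j → a i j = 0 := fun i j hj => by
    simp only [a]
    grind
  have ha0 : ∀ i, (a i 0 : ℝ) = ν i - if ν i = ν i₀ then 1 else 0 := fun i => by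
    by_cases h : ν i = ν i₀
    · simp [a, h, Nat.cast_sub (show 1 ≤ ν i₀ by lia)]
    · simp [a, h]
  have ha1 : ∀ i, (a i 1 : ℝ) = if ν i = ν i₀ then 1 else 0 := fun i => by simp [a]
  refine ⟨a, fun i => ?_, fun i j => ?_, ⟨i₀, by simp [a]⟩, ?_⟩
  · rw [sum_range_eq_zero_add_one hn _ (ha i)]
    simp only [a]
    grind
  · simp only [a]
    grind
  · have hrow : ∀ i, (ν i : ℝ) ^ 2 - ∑ j ∈ Finset.range (∑ i, ν i), (a i j : ℝ) ^ 2 =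
        (2 * ((ν i₀ : ℝ) - 1)) * if ν i = ν i₀ then 1 else 0 := fun i => by
      rw [sum_range_eq_zero_add_one hn _ fun j hj => by simp [ha i j hj], ha0, ha1]
      by_cases h : ν i = ν i₀
      · simp only [h, if_true]
        ring
      · simp [h]
    rw [sum_range_eq_zero_add_one hn (fun j => (∑ i, (a i j : ℝ)) ^ 2)
      fun j hj => by simp [ha _ j hj]]
    simp only [hrow, ha0, ha1, Finset.sum_sub_distrib, ← Finset.mul_sum, hind]
    push_cast
    rw [← mul_div_mul_left _ _ (mul_pos two_pos ht0).ne']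
    congr 1 <;> ring

/-- Theorem 4.11(i). For `n_1 ≥ n_2 ≥ ⋯ ≥ n_m ≥ 1` with
`n = n_1 + ⋯ + n_m`, `n_1 ≥ 2`, and `t` the number of indices `i` with
`n_i = n_1`: `(n_1 − 1)/(n − t) ≤ β(n_1, …, n_m) ≤ n_1/n`. -/
theorem betaGL_bounds (m : ℕ) (hm : 1 ≤ m) (ν : Fin m → ℕ)
    (hν : ∀ i, 1 ≤ ν i) (hsort : ∀ i j : Fin m, i ≤ j → ν j ≤ ν i)
    (h2 : 2 ≤ ν ⟨0, hm⟩) :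
    ((ν ⟨0, hm⟩ : ℝ) - 1) /
        ((∑ i, ν i : ℕ) -
          ((Finset.univ.filter (fun i : Fin m => ν i = ν ⟨0, hm⟩)).card : ℝ)) ≤
      betaGL m ν ∧
    betaGL m ν ≤ (ν ⟨0, hm⟩ : ℝ) / (∑ i, ν i : ℕ) := by
  have hβ : betaGL m ν = sSup (betaRatioSet m ν) :=
    if_neg fun h => absurd (h ⟨0, hm⟩) (by lia)
  have hub : ∀ r ∈ betaRatioSet m ν, r ≤ (ν ⟨0, hm⟩ : ℝ) / (∑ i, ν i : ℕ) := fun r hr =>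
    mem_betaRatioSet_le hν (fun i => hsort _ i (Nat.zero_le _)) hr
  have hmem := div_mem_betaRatioSet h2
  rw [hβ]
  exact ⟨le_csSup ⟨_, hub⟩ hmem, csSup_le ⟨_, hmem⟩ hub⟩
end

section
/- Let n_1 ≥ n_2 ≥ 1 be positive integers with n = n_1 + n_2 and n_1 ≥ 2, and let t = 2 if n_1 = n_2 and t = 1 otherwise. Then β(n_1, n_2) = (n_1 − 1)/(n − t). -/
/-- The absolute value of a sum of integers is at most the sum of their squares. -/
theorem abs_sum_le_sum_sq_int {ι : Type*} (s : Finset ι) (f : ι → ℤ) :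
    |∑ j ∈ s, f j| ≤ ∑ j ∈ s, f j ^ 2 :=
  (Finset.abs_sum_le_sum_abs f s).trans
    (Finset.sum_le_sum fun j _ => by rw [← sq_abs]; exact Int.le_self_sq _)

theorem sum_sub_sq_eq {ι R : Type*} [CommRing R] (s : Finset ι) (f g : ι → R) :
    ∑ j ∈ s, (f j - g j) ^ 2 =
      ∑ j ∈ s, f j ^ 2 + ∑ j ∈ s, g j ^ 2 - 2 * ∑ j ∈ s, f j * g j := by
  rw [Finset.mul_sum, ← Finset.sum_add_distrib, ← Finset.sum_sub_distrib]
  exact Finset.sum_congr rfl fun j _ => by ring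

theorem sum_add_sq_eq {ι R : Type*} [CommRing R] (s : Finset ι) (f g : ι → R) :
    ∑ j ∈ s, (f j + g j) ^ 2 =
      ∑ j ∈ s, f j ^ 2 + ∑ j ∈ s, g j ^ 2 + 2 * ∑ j ∈ s, f j * g j := by
  rw [Finset.mul_sum, ← Finset.sum_add_distrib, ← Finset.sum_add_distrib]
  exact Finset.sum_congr rfl fun j _ => by ring

/-- For non-negative integer sequences with `f` non-increasing and with sums `p > q`, the defect
`p² - ∑ f² + q² - ∑ g²` is controlled by the mixed defect `p q - ∑ f g`. -/
theorem sq_defect_le_mixed_defect {k : ℕ} {f g : ℕ → ℤ} {p q : ℤ} (hf : Antitone f)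
    (hf0 : ∀ j, 0 ≤ f j) (hg0 : ∀ j, 0 ≤ g j)
    (hp : ∑ j ∈ Finset.range (k + 1), f j = p) (hq : ∑ j ∈ Finset.range (k + 1), g j = q)
    (hqp : q < p) :
    q * (p ^ 2 - ∑ j ∈ Finset.range (k + 1), f j ^ 2 +
        (q ^ 2 - ∑ j ∈ Finset.range (k + 1), g j ^ 2)) ≤
      2 * (p - 1) * (p * q - ∑ j ∈ Finset.range (k + 1), f j * g j) := by
  have hq0 : 0 ≤ q := hq ▸ Finset.sum_nonneg fun j _ => hg0 j
  have hmixed : ∑ j ∈ Finset.range (k + 1), f j * g j ≤ f 0 * q := by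
    rw [← hq, Finset.mul_sum]
    exact Finset.sum_le_sum fun j _ => mul_le_mul_of_nonneg_right (hf (Nat.zero_le j)) (hg0 j)
  have hsq := sum_sub_sq_eq (Finset.range (k + 1)) f g
  have htail := abs_sum_le_sum_sq_int (Finset.range k) fun j => f (j + 1) - g (j + 1)
  have hfx : 0 ≤ ∑ j ∈ Finset.range k, f (j + 1) := Finset.sum_nonneg fun j _ => hf0 _
  have hgy : 0 ≤ ∑ j ∈ Finset.range k, g (j + 1) := Finset.sum_nonneg fun j _ => hg0 _
  rw [Finset.sum_range_succ' (fun j => (f j - g j) ^ 2)] at hsq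
  rw [Finset.sum_range_succ'] at hp hq
  rw [Finset.sum_sub_distrib] at htail
  set x := ∑ j ∈ Finset.range k, f (j + 1)
  set y := ∑ j ∈ Finset.range k, g (j + 1)
  set F := ∑ j ∈ Finset.range (k + 1), f j ^ 2
  set G := ∑ j ∈ Finset.range (k + 1), g j ^ 2
  set M := ∑ j ∈ Finset.range (k + 1), f j * g j
  have hdiff : f 0 - g 0 = (p - q) - (x - y) := by linarith
  rw [hdiff] at hsq
  have hC : q * x ≤ p * q - M := by
    have : f 0 = p - x := by linarith
    rw [this] at hmixed
    linarith
  have hbound : (p - q) ^ 2 - (F + G - 2 * M) ≤ 2 * (p - q - 1) * x := by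
    rcases le_total 0 (x - y) with he | he
    · rw [abs_of_nonneg he] at htail
      have h1 : x - y ≤ (x - y) ^ 2 := Int.le_self_sq _
      have h2 : 0 ≤ (p - q - 1) * y := mul_nonneg (by linarith) hgy
      linarith
    · rw [abs_of_nonpos he] at htail
      have h1 : 0 ≤ (p - q - 1) * x := mul_nonneg (by linarith) hfx
      have h2 : 0 ≤ (p - q) * (y - x) := mul_nonneg (by linarith) (by linarith)
      nlinarith [sq_nonneg (x - y)]
  have h1 := mul_le_mul_of_nonneg_left hbound hq0
  have h2 := mul_le_mul_of_nonneg_left hC (show 0 ≤ 2 * (p - q - 1) by linarith)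
  linarith

/-- The members of `betaRatioSet` for two blocks, in terms of the two rows. -/
theorem mem_betaRatioSet_two {p q : ℕ} {r : ℝ} :
    r ∈ betaRatioSet 2 ![p, q] ↔ ∃ f g : ℕ → ℕ,
      ∑ j ∈ Finset.range (p + q), f j = p ∧ ∑ j ∈ Finset.range (p + q), g j = q ∧
      (∀ j, f (j + 1) ≤ f j) ∧ (∀ j, g (j + 1) ≤ g j) ∧ (0 < f 1 ∨ 0 < g 1) ∧
      r = ((p : ℝ) ^ 2 - ∑ j ∈ Finset.range (p + q), (f j : ℝ) ^ 2 +
          ((q : ℝ) ^ 2 - ∑ j ∈ Finset.range (p + q), (g j : ℝ) ^ 2)) /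
        (((p : ℝ) + q) ^ 2 - ∑ j ∈ Finset.range (p + q), ((f j : ℝ) + g j) ^ 2) := by
  simp only [betaRatioSet, Set.mem_ofPred_eq, Fin.sum_univ_two, Fin.forall_fin_two,
    Fin.exists_fin_two, Matrix.cons_val_zero, Matrix.cons_val_one]
  constructor
  · rintro ⟨a, ⟨hf, hg⟩, ⟨hf', hg'⟩, h, hr⟩
    exact ⟨a 0, a 1, hf, hg, hf', hg', h, hr⟩
  · rintro ⟨f, g, hf, hg, hf', hg', h, hr⟩
    exact ⟨![f, g], ⟨hf, hg⟩, ⟨hf', hg'⟩, h, hr⟩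

theorem sum_range_two_terms {R : Type*} [AddCommMonoid R] {n : ℕ} (hn : 2 ≤ n) (F : ℕ → R)
    (hF : ∀ j, F (j + 2) = 0) : ∑ j ∈ Finset.range n, F j = F 0 + F 1 := by
  obtain ⟨k, rfl⟩ := Nat.exists_eq_add_of_le' hn
  rw [Finset.sum_range_succ', Finset.sum_range_succ', Finset.sum_eq_zero fun j _ => hF j,
    zero_add, add_comm]

/-- The ratio coming from rows `(c, d, 0, …)` and `(u, v, 0, …)`. -/
theorem mem_betaRatioSet_of_two_columns {c d u v : ℕ} (hdc : d ≤ c) (hvu : v ≤ u)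
    (hpos : 0 < d ∨ 0 < v) (hn : 2 ≤ c + d + (u + v)) :
    (((c + d : ℝ) ^ 2 - (c ^ 2 + d ^ 2) + ((u + v) ^ 2 - (u ^ 2 + v ^ 2))) /
      ((c + d + (u + v)) ^ 2 - ((c + u) ^ 2 + (d + v) ^ 2))) ∈
      betaRatioSet 2 ![c + d, u + v] := by
  rw [mem_betaRatioSet_two]
  have hanti : ∀ c d : ℕ, d ≤ c → ∀ j,
      (fun j => if j = 0 then c else if j = 1 then d else 0) (j + 1) ≤
        (fun j => if j = 0 then c else if j = 1 then d else 0) j := by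
    rintro c d h (_ | _ | j) <;> simp [h]
  refine ⟨fun j => if j = 0 then c else if j = 1 then d else 0,
    fun j => if j = 0 then u else if j = 1 then v else 0, ?_, ?_, hanti c d hdc, hanti u v hvu,
    by simpa using hpos, ?_⟩
  · rw [sum_range_two_terms hn _ (by simp)]; simp
  · rw [sum_range_two_terms hn _ (by simp)]; simp
  · rw [sum_range_two_terms hn _ (by simp), sum_range_two_terms hn _ (by simp),
      sum_range_two_terms hn _ (by simp)]
    simp

theorem le_of_mem_betaRatioSet_two {p q : ℕ} (hqp : q ≤ p) (hp : 2 ≤ p) {r : ℝ}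
    (hr : r ∈ betaRatioSet 2 ![p, q]) :
    r ≤ ((p : ℝ) - 1) / ((p + q : ℕ) - (if p = q then (2 : ℝ) else 1)) := by
  obtain ⟨f, g, hf, hg, hf', -, -, rfl⟩ := mem_betaRatioSet_two.1 hr
  have hp' : (2 : ℝ) ≤ p := by exact_mod_cast hp
  have hq' : (0 : ℝ) ≤ q := q.cast_nonneg
  have hden : 0 < (((p + q : ℕ) : ℝ) - (if p = q then (2 : ℝ) else 1)) := by
    push_cast
    split_ifs with h
    · subst h; linarith
    · linarith
  have hD : 0 ≤ ((p : ℝ) + q) ^ 2 -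
      ∑ j ∈ Finset.range (p + q), ((f j : ℝ) + g j) ^ 2 := by
    have hsum : (p : ℝ) + q = ∑ j ∈ Finset.range (p + q), ((f j : ℝ) + g j) := by
      rw [Finset.sum_add_distrib]
      exact_mod_cast congrArg₂ (· + ·) hf.symm hg.symm
    rw [hsum, sub_nonneg]
    exact Finset.sum_sq_le_sq_sum_of_nonneg fun j _ => by positivity
  refine div_le_of_le_mul₀ hD (div_nonneg (by linarith) hden.le) ?_
  rw [div_mul_eq_mul_div, le_div_iff₀ hden, sum_add_sq_eq]
  push_cast
  split_ifs with h
  · subst h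
    have hP : 0 ≤ ∑ j ∈ Finset.range (p + p), ((f j : ℝ) - g j) ^ 2 :=
      Finset.sum_nonneg fun j _ => sq_nonneg _
    rw [sum_sub_sq_eq] at hP
    nlinarith [mul_nonneg (show (0 : ℝ) ≤ p - 1 by linarith) hP]
  · obtain ⟨k, hk⟩ := Nat.exists_eq_add_of_le' (show 1 ≤ p + q by omega)
    rw [hk] at hf hg ⊢
    have key := sq_defect_le_mixed_defect (k := k) (f := fun j => (f j : ℤ))
      (g := fun j => (g j : ℤ)) (p := p) (q := q)
      (antitone_nat_of_succ_le fun j => by exact_mod_cast hf' j)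
      (fun j => by positivity) (fun j => by positivity)
      (by exact_mod_cast hf) (by exact_mod_cast hg) (by omega)
    have key' := (Int.cast_le (R := ℝ)).2 key
    push_cast at key'
    linarith

theorem value_mem_betaRatioSet_two {p q : ℕ} (hq : 1 ≤ q) (hp : 2 ≤ p) :
    ((p : ℝ) - 1) / ((p + q : ℕ) - (if p = q then (2 : ℝ) else 1)) ∈
      betaRatioSet 2 ![p, q] := by
  obtain ⟨c, rfl⟩ := Nat.exists_eq_add_of_le' (show 1 ≤ p by omega)
  have hc : (1 : ℝ) ≤ c := by exact_mod_cast (show 1 ≤ c by omega)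
  have hq' : (1 : ℝ) ≤ q := by exact_mod_cast hq
  split_ifs with h
  · subst h
    convert mem_betaRatioSet_of_two_columns (c := c) (d := 1) (u := c) (v := 1)
      (by omega) (by omega) (by simp) (by omega) using 1
    push_cast
    rw [div_eq_div_iff (by linarith) (by nlinarith)]
    ring
  · have hmem := mem_betaRatioSet_of_two_columns (c := c) (d := 1) (u := q) (v := 0)
      (by omega) (by omega) (by simp) (by omega)
    rw [show q + 0 = q from rfl] at hmem
    convert hmem using 1
    push_cast
    rw [div_eq_div_iff (by linarith) (by nlinarith)]
    ring

/-- Theorem 4.11(ii), the case `m = 2`. For `n_1 ≥ n_2 ≥ 1`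
with `n = n_1 + n_2`, `n_1 ≥ 2`, and `t = 2` if `n_1 = n_2`, `t = 1`
otherwise: `β(n_1, n_2) = (n_1 − 1)/(n − t)`. -/
theorem betaGL_two_blocks (n1 n2 : ℕ) (h1 : 1 ≤ n2) (h12 : n2 ≤ n1) (h2 : 2 ≤ n1) :
    betaGL 2 ![n1, n2] =
      ((n1 : ℝ) - 1) / ((n1 + n2 : ℕ) - (if n1 = n2 then (2 : ℝ) else 1)) := by
  have hne : ¬ ∀ i, (![n1, n2] : Fin 2 → ℕ) i ≤ 1 := fun h => by
    have := h 0
    simp only [Matrix.cons_val_zero] at this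
    omega
  rw [betaGL, if_neg hne]
  exact IsGreatest.csSup_eq
    ⟨value_mem_betaRatioSet_two h1 h2, fun _ hr => le_of_mem_betaRatioSet_two h12 h2 hr⟩
end

section
/- Let m ≥ 1 and k ≥ 2 be integers and set n = m·k. Then β(k, k, …, k) (with m equal entries k) equals 1/m. -/
/-- For natural-valued matrices whose rows all sum to `k`, the ratio in `betaRatioSet` is at most
`1 / m`, by the Cauchy–Schwarz inequality in each column. -/
lemma le_one_div_of_mem_betaRatioSet {m k : ℕ} (hm : 1 ≤ m) {r : ℝ}
    (hr : r ∈ betaRatioSet m (fun _ : Fin m => k)) : r ≤ 1 / (m : ℝ) := by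
  obtain ⟨a, hsum, -, -, rfl⟩ := hr
  set s := Finset.range (∑ _i : Fin m, k)
  have hm0 : (0 : ℝ) < m := by exact_mod_cast hm
  have htotal : ∑ j ∈ s, ∑ i, (a i j : ℝ) = ∑ _i : Fin m, (k : ℝ) := by
    rw [Finset.sum_comm]
    exact Finset.sum_congr rfl fun i _ => by exact_mod_cast hsum i
  have hden : ∑ j ∈ s, (∑ i, (a i j : ℝ)) ^ 2 ≤ (∑ _i : Fin m, (k : ℝ)) ^ 2 := by
    rw [← htotal]
    exact Finset.sum_sq_le_sq_sum_of_nonneg fun j _ =>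
      Finset.sum_nonneg fun i _ => Nat.cast_nonneg _
  have hcs : ∑ j ∈ s, (∑ i, (a i j : ℝ)) ^ 2 ≤ m * ∑ i, ∑ j ∈ s, (a i j : ℝ) ^ 2 := by
    rw [Finset.sum_comm, Finset.mul_sum]
    refine Finset.sum_le_sum fun j _ => ?_
    simpa using sq_sum_le_card_mul_sum_sq (s := Finset.univ) (f := fun i => (a i j : ℝ))
  refine div_le_of_le_mul₀ (sub_nonneg.2 hden) (by positivity) ?_
  rw [one_div, inv_mul_eq_div, le_div_iff₀ hm0, Finset.sum_sub_distrib]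
  simp only [Finset.sum_const, Finset.card_univ, Fintype.card_fin, nsmul_eq_mul] at hcs ⊢
  nlinarith [hcs]

/-- The matrix whose rows all equal `(1, …, 1, 0, …, 0)`, with `k` ones, attains the ratio
`1 / m`. -/
lemma one_div_mem_betaRatioSet {m k : ℕ} (hm : 1 ≤ m) (hk : 2 ≤ k) :
    1 / (m : ℝ) ∈ betaRatioSet m (fun _ : Fin m => k) := by
  have hfilter : (Finset.range (m * k)).filter (· < k) = Finset.range k := by
    ext j
    simp only [Finset.mem_filter, Finset.mem_range]
    exact ⟨fun h => h.2, fun h => ⟨h.trans_le (Nat.le_mul_of_pos_left k hm), h⟩⟩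
  have hm0 : (m : ℝ) ≠ 0 := by positivity
  have hk2 : (2 : ℝ) ≤ k := by exact_mod_cast hk
  refine ⟨fun _ j => if j < k then 1 else 0, fun i => ?_, fun i j => ?_, ⟨⟨0, hm⟩, ?_⟩, ?_⟩
  · simp [Finset.sum_boole, hfilter]
  · dsimp only
    split_ifs <;> omega
  · simp only [show 1 < k by omega, if_true, zero_lt_one]
  · have hrow : ∑ j ∈ Finset.range (m * k), (((if j < k then 1 else 0 : ℕ) : ℝ)) ^ 2 = k := by
      simp [ite_pow, Finset.sum_boole, hfilter]
    have hne : (k : ℝ) - 1 ≠ 0 := by linarith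
    simp only [Finset.sum_const, Finset.card_univ, Fintype.card_fin, nsmul_eq_mul, smul_eq_mul,
      mul_pow, ← Finset.mul_sum, hrow]
    rw [← mul_sub]
    field_simp

/-- combinatorial content of Corollary 1.10, the Lie analogue of
the Fomin–Lulov bound. For `m ≥ 1`, `k ≥ 2` and `n = m·k`:
`β(k, k, …, k) = 1/m` (with `m` equal entries `k`). -/
theorem betaGL_equal_blocks (m k : ℕ) (hm : 1 ≤ m) (hk : 2 ≤ k) :
    betaGL m (fun _ : Fin m => k) = 1 / (m : ℝ) := by
  have hlarge : ¬ ∀ _i : Fin m, k ≤ 1 := fun h => by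
    have := h ⟨0, hm⟩
    omega
  rw [betaGL, if_neg hlarge]
  exact IsGreatest.csSup_eq
    ⟨one_div_mem_betaRatioSet hm hk, fun _ hr => le_one_div_of_mem_betaRatioSet hm hr⟩
end

section
/- Let 1 ≤ n_1 ≤ n_2 ≤ ⋯ ≤ n_r be integers with r ≥ 2 and n_r ≥ 2, let n = n_1 + ⋯ + n_r, and let q be a prime power such that N := n_r · ∏_{i=1}^{r−1}(n_i + 1) divides q − 1. Then there exist pairwise distinct elements λ_1, …, λ_r ∈ 𝔽_q^× such that ∏_{i=1}^r λ_i^{n_i} = 1; consequently the block-scalar matrix s = diag(λ_1·I_{n_1}, …, λ_r·I_{n_r}) lies in SL_n(𝔽_q), and its centralizer in GL_n(𝔽_q) is exactly the subgroup of invertible block-diagonal matrices GL_{n_1}(𝔽_q) × ⋯ × GL_{n_r}(𝔽_q). -/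
theorem sum_mul_prod_range_add_one (c : ℕ → ℕ) (m : ℕ) :
    ∑ i ∈ Finset.range m, c i * ∏ j ∈ Finset.range i, (c j + 1) + 1 =
      ∏ j ∈ Finset.range m, (c j + 1) := by
  induction m with
  | zero => simp
  | succ k ih =>
    rw [Finset.sum_range_succ, Finset.prod_range_succ, ← ih]
    ring

theorem prod_range_add_one_lt {c : ℕ → ℕ} {m i j : ℕ} (hc : ∀ k < m, 1 ≤ c k)
    (hij : i < j) (hj : j ≤ m) :
    ∏ k ∈ Finset.range i, (c k + 1) < ∏ k ∈ Finset.range j, (c k + 1) := by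
  have hpos : 0 < ∏ k ∈ Finset.range i, (c k + 1) := Finset.prod_pos fun _ _ => Nat.succ_pos _
  calc ∏ k ∈ Finset.range i, (c k + 1)
      < (∏ k ∈ Finset.range i, (c k + 1)) * (c i + 1) :=
        lt_mul_of_one_lt_right hpos (Nat.lt_succ_of_le (hc i (hij.trans_le hj)))
    _ = ∏ k ∈ Finset.range (i + 1), (c k + 1) := (Finset.prod_range_succ _ _).symm
    _ ≤ ∏ k ∈ Finset.range j, (c k + 1) :=
        Finset.prod_le_prod_of_subset_of_one_le' (Finset.range_mono hij)
          fun k _ _ => Nat.succ_pos (c k)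

/-- Distinct exponents below `c m * ∏ j < m, (c j + 1)` whose sum weighted by `c` equals that
modulus. They are `1` at `m` and mixed-radix place values, scaled by `c m`, elsewhere. -/
theorem exists_injOn_weighted_sum_eq (c : ℕ → ℕ) (m : ℕ) (hc : ∀ i < m, 1 ≤ c i)
    (hm : 2 ≤ c m) :
    ∃ a : ℕ → ℕ, Set.InjOn a (Set.Iic m) ∧
      (∀ i ≤ m, a i < c m * ∏ j ∈ Finset.range m, (c j + 1)) ∧
      ∑ i ∈ Finset.range (m + 1), c i * a i = c m * ∏ j ∈ Finset.range m, (c j + 1) := by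
  have hpos : ∀ i, 0 < ∏ j ∈ Finset.range i, (c j + 1) := fun i =>
    Finset.prod_pos fun _ _ => Nat.succ_pos _
  have hone : ∀ i, 1 < c m * ∏ j ∈ Finset.range i, (c j + 1) := fun i => by
    nlinarith [hpos i]
  have hlt : ∀ i j, i < j → j ≤ m → c m * ∏ k ∈ Finset.range i, (c k + 1) <
      c m * ∏ k ∈ Finset.range j, (c k + 1) := fun i j hij hj =>
    Nat.mul_lt_mul_of_pos_left (prod_range_add_one_lt hc hij hj) (by omega)
  refine ⟨fun i => if i = m then 1 else c m * ∏ j ∈ Finset.range i, (c j + 1), ?_, ?_, ?_⟩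
  · intro i hi j hj h
    simp only [Set.mem_Iic] at hi hj
    dsimp only at h
    have hi1 := hone i
    have hj1 := hone j
    split_ifs at h with him hjm hjm
    · omega
    · omega
    · omega
    · rcases lt_trichotomy i j with hij | hij | hij
      · exact absurd h (hlt i j hij hj).ne
      · exact hij
      · exact absurd h (hlt j i hij hi).ne'
  · intro i hi
    dsimp only
    split_ifs with him
    · exact hone m
    · exact hlt i m (lt_of_le_of_ne hi him) le_rfl
  · have hsum : ∑ i ∈ Finset.range m,
        c i * (if i = m then 1 else c m * ∏ j ∈ Finset.range i, (c j + 1)) =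
        c m * ∑ i ∈ Finset.range m, c i * ∏ j ∈ Finset.range i, (c j + 1) := by
      rw [Finset.mul_sum]
      refine Finset.sum_congr rfl fun i hi => ?_
      rw [if_neg (Finset.mem_range.mp hi).ne]
      ring
    beta_reduce
    rw [Finset.sum_range_succ, hsum, if_pos rfl, ← mul_add, sum_mul_prod_range_add_one]

theorem IsCyclic.exists_orderOf_eq_of_dvd {G : Type*} [Group G] [Finite G] [IsCyclic G] {d : ℕ}
    (hd : d ∣ Nat.card G) : ∃ g : G, orderOf g = d := by
  obtain ⟨g, hg⟩ := IsCyclic.exists_ofOrder_eq_natCard (α := G)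
  obtain ⟨e, he⟩ := hd
  have h0 : d * e ≠ 0 := he ▸ Nat.card_pos.ne'
  refine ⟨g ^ e, ?_⟩
  rw [orderOf_pow_of_dvd (right_ne_zero_of_mul h0) (hg ▸ he ▸ dvd_mul_left e d), hg, he]
  exact Nat.mul_div_cancel _ (Nat.pos_of_ne_zero (right_ne_zero_of_mul h0))

theorem Matrix.commute_diagonal_comp_iff {n ι R : Type*} [Fintype n] [DecidableEq n]
    [CommRing R] [IsDomain R] (f : n → ι) {d : ι → R} (hd : Function.Injective d)
    (M : Matrix n n R) :
    M * Matrix.diagonal (fun p => d (f p)) = Matrix.diagonal (fun p => d (f p)) * M ↔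
      ∀ p q, f p ≠ f q → M p q = 0 := by
  rw [← Matrix.ext_iff]
  refine forall₂_congr fun p q => ?_
  rw [Matrix.mul_diagonal, Matrix.diagonal_mul, mul_comm, ← sub_eq_zero, ← sub_mul, mul_eq_zero,
    sub_eq_zero, hd.eq_iff, eq_comm, or_iff_not_imp_left]

theorem Matrix.det_diagonal_sigma_fst {ι R : Type*} [Fintype ι] [DecidableEq ι] [CommRing R]
    (k : ι → ℕ) (d : ι → R) :
    (Matrix.diagonal (fun p : (i : ι) × Fin (k i) => d p.1)).det = ∏ i, d i ^ k i := by
  rw [Matrix.det_diagonal, Fintype.prod_sigma]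
  simp


/-- Lemma 3.3. Let `1 ≤ n_1 ≤ ⋯ ≤ n_r` with `r ≥ 2`, `n_r ≥ 2`,
and let `𝔽_q` be a finite field such that `N = n_r·∏_{i<r}(n_i+1)` divides `q − 1`.
Then there are pairwise distinct `λ_1, …, λ_r ∈ 𝔽_q^×` with `∏ λ_i^{n_i} = 1`; the
block-scalar matrix `s = diag(λ_1·I_{n_1}, …, λ_r·I_{n_r})` has determinant `1`
(i.e. lies in `SL_n(𝔽_q)`), and a matrix in `GL_n(𝔽_q)` commutes with `s` exactly
when it is block-diagonal, so `C_{GL_n(𝔽_q)}(s) = GL_{n_1}(𝔽_q) × ⋯ × GL_{n_r}(𝔽_q)`. -/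
theorem exists_semisimple_element_with_block_centralizer
    (r : ℕ) (hr : 2 ≤ r) (nn : Fin r → ℕ) (h1 : ∀ i, 1 ≤ nn i)
    (hmono : ∀ i j : Fin r, i ≤ j → nn i ≤ nn j)
    (hlast : 2 ≤ nn ⟨r - 1, by omega⟩)
    (F : Type*) [Field F] [Fintype F] [DecidableEq F]
    (hdvd : (nn ⟨r - 1, by omega⟩ *
        ∏ i ∈ Finset.univ.filter (fun i : Fin r => (i : ℕ) < r - 1), (nn i + 1)) ∣
      (Fintype.card F - 1)) :
    ∃ lam : Fin r → Fˣ, Function.Injective lam ∧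
      (∏ i, (lam i : F) ^ (nn i)) = 1 ∧
      (Matrix.diagonal (fun p : (i : Fin r) × Fin (nn i) => (lam p.1 : F))).det = 1 ∧
      ∀ M : GL ((i : Fin r) × Fin (nn i)) F,
        ((M : Matrix ((i : Fin r) × Fin (nn i)) ((i : Fin r) × Fin (nn i)) F) *
            Matrix.diagonal (fun p => (lam p.1 : F)) =
          Matrix.diagonal (fun p => (lam p.1 : F)) *
            (M : Matrix ((i : Fin r) × Fin (nn i)) ((i : Fin r) × Fin (nn i)) F)) ↔
        ∀ p q : (i : Fin r) × Fin (nn i), p.1 ≠ q.1 →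
          (M : Matrix ((i : Fin r) × Fin (nn i)) ((i : Fin r) × Fin (nn i)) F) p q = 0 := by
  obtain ⟨m, rfl⟩ : ∃ m, r = m + 1 := ⟨r - 1, by omega⟩
  let c : ℕ → ℕ := fun k => if h : k < m + 1 then nn ⟨k, h⟩ else 0
  have hcv : ∀ i : Fin (m + 1), c i = nn i := fun i => dif_pos i.2
  have hcm : c m = nn ⟨m + 1 - 1, by omega⟩ := hcv (Fin.last m)
  have hN : nn ⟨m + 1 - 1, by omega⟩ *
      ∏ i ∈ Finset.univ.filter (fun i : Fin (m + 1) => (i : ℕ) < m + 1 - 1), (nn i + 1) =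
      c m * ∏ j ∈ Finset.range m, (c j + 1) := by
    rw [hcm, Finset.prod_filter, Fin.prod_univ_castSucc, ← Fin.prod_univ_eq_prod_range]
    simp [← hcv]
  obtain ⟨a, hinj, hlt, hsum⟩ := exists_injOn_weighted_sum_eq c m
    (fun i hi => (h1 _).trans_eq (hcv ⟨i, by omega⟩).symm) (hlast.trans_eq hcm.symm)
  obtain ⟨g, hg⟩ := IsCyclic.exists_orderOf_eq_of_dvd (G := Fˣ)
    (d := c m * ∏ j ∈ Finset.range m, (c j + 1))
    (by rwa [Nat.card_eq_fintype_card, Fintype.card_units, ← hN])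
  have hlam : Function.Injective fun i : Fin (m + 1) => g ^ a i := fun i j hij =>
    Fin.ext <| hinj (Nat.lt_succ_iff.mp i.2) (Nat.lt_succ_iff.mp j.2) <|
      pow_injOn_Iio_orderOf (hg ▸ hlt i (Nat.lt_succ_iff.mp i.2))
        (hg ▸ hlt j (Nat.lt_succ_iff.mp j.2)) hij
  have hprod : ∏ i : Fin (m + 1), ((g ^ a i : Fˣ) : F) ^ nn i = 1 := by
    have : ∏ i : Fin (m + 1), (g ^ a i) ^ nn i = 1 := by
      simp_rw [← pow_mul, Finset.prod_pow_eq_pow_sum, ← hcv, mul_comm (a _)]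
      rw [Fin.sum_univ_eq_sum_range (fun i => c i * a i), hsum, ← hg, pow_orderOf_eq_one]
    simpa using congrArg Units.val this
  exact ⟨fun i => g ^ a i, hlam, hprod,
    (Matrix.det_diagonal_sigma_fst nn fun i => ((g ^ a i : Fˣ) : F)).trans hprod,
    fun M => Matrix.commute_diagonal_comp_iff Sigma.fst
      (d := fun i : Fin (m + 1) => ((g ^ a i : Fˣ) : F)) (Units.val_injective.comp hlam) M.val⟩
end

section
/- For every n ≥ 2 there is a constant C_n > 0, depending only on n, with the following property. For every prime power q ≥ C_n and all positive integers n_1, …, n_m with n_1 + ⋯ + n_m = n, there exist pairwise distinct elements μ_1, …, μ_m ∈ 𝔽_q^×, the element g = diag(μ_1·I_{n_1}, …, μ_m·I_{n_m}) ∈ GL_n(𝔽_q), and an irreducible finite-dimensional complex representation of GL_n(𝔽_q) with character χ, such that χ(g) is a real number satisfying χ(g) ≥ (1/4)·χ(1)^{β(n_1,…,n_m)}. -/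
section CauchyDeterminant

open Finset Matrix

/-- A polynomial form of Cauchy's determinant, over a field. -/
theorem det_prod_erase_of_field {K : Type*} [Field K] {k : ℕ} (x y : Fin k → K)
    (hy : Function.Injective y) (hy0 : ∀ i, y i ≠ 0) :
    (Matrix.of fun i j => ∏ l ∈ univ.erase j, (1 - x i * y l)).det =
      (vandermonde x).det * (vandermonde y).det := by
  let p : Fin k → Polynomial K := fun j =>
    ∏ l ∈ univ.erase j, (1 - Polynomial.X * Polynomial.C (y l))
  have hdeg : ∀ j, (p j).natDegree < k := by
    intro j
    refine lt_of_le_of_lt (Polynomial.natDegree_prod_le _ _) ?_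
    refine lt_of_le_of_lt (sum_le_sum (g := fun _ => 1) fun l _ => ?_) ?_
    · refine (Polynomial.natDegree_sub_le _ _).trans ?_
      simp only [Polynomial.natDegree_one, zero_le, sup_of_le_right]
      exact (Polynomial.natDegree_mul_le).trans (by simp)
    · have := j.pos
      simp [card_erase_of_mem]
      omega
  let c : Matrix (Fin k) (Fin k) K := Matrix.of fun l j => (p j).coeff l
  have hfac : ∀ z : Fin k → K, (Matrix.of fun i j => ∏ l ∈ univ.erase j, (1 - z i * y l)) =
      vandermonde z * c := by
    intro z
    ext i j
    have : ∏ l ∈ univ.erase j, (1 - z i * y l) = (p j).eval (z i) := by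
      simp only [p, Polynomial.eval_prod]
      exact prod_congr rfl fun l _ => by rw [mul_comm]; simp
    rw [Matrix.of_apply, this, Polynomial.eval_eq_sum_range' (hdeg j), Matrix.mul_apply,
      ← Fin.sum_univ_eq_sum_range (fun l => (p j).coeff l * z i ^ l)]
    simp [c, vandermonde_apply, mul_comm]
  have hV : (vandermonde fun i => (y i)⁻¹).det ≠ 0 :=
    det_vandermonde_ne_zero_iff.2 fun a b h => hy (inv_injective h)
  have hdiag : (vandermonde fun i => (y i)⁻¹).det * c.det =
      (vandermonde fun i => (y i)⁻¹).det * (vandermonde y).det := by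
    rw [← det_mul, ← hfac]
    have : (Matrix.of fun i j => ∏ l ∈ univ.erase j, (1 - (y i)⁻¹ * y l)) =
        Matrix.diagonal fun i => ∏ l ∈ ({i}ᶜ : Finset (Fin k)), (1 - (y i)⁻¹ * y l) := by
      ext i j
      rw [Matrix.of_apply, Matrix.diagonal_apply]
      split_ifs with h
      · subst h
        refine prod_congr ?_ fun _ _ => rfl
        ext; simp
      · exact prod_eq_zero (mem_erase.2 ⟨h, mem_univ i⟩) (by simp [hy0 i])
    rw [this, det_diagonal, det_vandermonde, det_vandermonde,
      ← prod_prod_Ioi_mul_eq_prod_prod_off_diag (fun a b => 1 - (y b)⁻¹ * y a),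
      ← prod_mul_distrib]
    refine prod_congr rfl fun i _ => ?_
    rw [← prod_mul_distrib]
    refine prod_congr rfl fun j _ => ?_
    have := hy0 i
    have := hy0 j
    field_simp
  rw [hfac, det_mul, mul_left_cancel₀ hV hdiag]

/-- A polynomial form of Cauchy's determinant, over a domain. -/
theorem det_prod_erase {R : Type*} [CommRing R] [IsDomain R] {k : ℕ} (x y : Fin k → R)
    (hy : Function.Injective y) (hy0 : ∀ i, y i ≠ 0) :
    (Matrix.of fun i j => ∏ l ∈ univ.erase j, (1 - x i * y l)).det =
      (vandermonde x).det * (vandermonde y).det := by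
  have hinj := IsFractionRing.injective R (FractionRing R)
  apply hinj
  have := det_prod_erase_of_field (fun i => algebraMap R (FractionRing R) (x i))
    (fun i => algebraMap R (FractionRing R) (y i)) (hinj.comp hy)
    (fun i => by simpa using hy0 i)
  have hV : ∀ z : Fin k → R, (algebraMap R (FractionRing R)).mapMatrix (vandermonde z) =
      vandermonde fun i => algebraMap R (FractionRing R) (z i) := by
    intro z
    ext i j
    simp [vandermonde_apply]
  rw [map_mul, RingHom.map_det, RingHom.map_det, RingHom.map_det, hV, hV, ← this]
  congr 1
  ext i j
  simp

end CauchyDeterminant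

section Counting

open Finset

variable {P σ : Type*} [Fintype P]

/-- The ways to write the exponent `m` as `n` plus a combination of the `e p`, `p ∈ s`. -/
def combinations (e : P → σ →₀ ℕ) (s : Finset P) (n m : σ →₀ ℕ) : Set (P → ℕ) :=
  {A | (∀ p ∉ s, A p = 0) ∧ ∑ p, A p • e p + n = m}

theorem finite_combinations {e : P → σ →₀ ℕ} (he : ∀ p, e p ≠ 0) (s : Finset P)
    (n m : σ →₀ ℕ) : (combinations e s n m).Finite := by
  refine (Set.Finite.pi' fun _ : P => Set.finite_Iic m.degree).subset ?_
  rintro A ⟨-, hA⟩ p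
  have h1 : m.degree = ∑ p, A p * (e p).degree + n.degree := by
    rw [← hA]; simp [map_sum]
  have h2 : A p * (e p).degree ≤ ∑ p, A p * (e p).degree :=
    single_le_sum (f := fun p => A p * (e p).degree) (fun _ _ => Nat.zero_le _) (mem_univ p)
  have h3 : 1 ≤ (e p).degree := Nat.one_le_iff_ne_zero.2 fun h =>
      he p ((Finsupp.degree_eq_zero_iff _).1 h)
  show A p ≤ m.degree
  nlinarith

/-- The generating function of the number of combinations. -/
noncomputable def combinationSeries (e : P → σ →₀ ℕ) (s : Finset P) : MvPowerSeries σ ℤ :=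
  fun m => ((combinations e s 0 m).ncard : ℤ)

theorem coeff_monomial_mul_combinationSeries (e : P → σ →₀ ℕ) (s : Finset P) (n m : σ →₀ ℕ) :
    MvPowerSeries.coeff m (MvPowerSeries.monomial n (1 : ℤ) * combinationSeries e s) =
      ((combinations e s n m).ncard : ℤ) := by
  classical
  rw [MvPowerSeries.coeff_monomial_mul, one_mul]
  split_ifs with h
  · change ((combinations e s 0 (m - n)).ncard : ℤ) = _
    congr 2
    ext A
    simp only [combinations, Set.mem_ofPred_eq, add_zero]
    refine and_congr_right fun _ => ⟨fun h' => ?_, fun h' => ?_⟩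
    · rw [h', tsub_add_cancel_of_le h]
    · rw [← h', add_tsub_cancel_right]
  · have : combinations e s n m = ∅ := by
      ext A
      simp only [combinations, Set.mem_ofPred_eq, Set.mem_empty_iff_false, iff_false, not_and]
      rintro - rfl
      exact h le_add_self
    simp [this]

theorem combinationSeries_insert [DecidableEq P] {e : P → σ →₀ ℕ} (he : ∀ p, e p ≠ 0)
    {s : Finset P} {p : P}
    (hp : p ∉ s) : combinationSeries e (insert p s) * (1 - MvPowerSeries.monomial (e p) 1) =
      combinationSeries e s := by
  ext m
  rw [mul_sub, mul_one, mul_comm _ (MvPowerSeries.monomial _ _), map_sub,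
    coeff_monomial_mul_combinationSeries, sub_eq_iff_eq_add]
  change ((combinations e (insert p s) 0 m).ncard : ℤ) = (combinations e s 0 m).ncard + _
  have himg : combinations e (insert p s) 0 m = combinations e s 0 m ∪
      (fun A => A + Pi.single p 1) '' combinations e (insert p s) (e p) m := by
    ext A
    simp only [combinations, Set.mem_ofPred_eq, Set.mem_union, Set.mem_image, add_zero]
    constructor
    · rintro ⟨h1, h2⟩
      by_cases hA : A p = 0
      · left
        refine ⟨fun q hq => ?_, h2⟩
        by_cases hqp : q = p
        · rw [hqp, hA]
        · exact h1 q (by simp [hq, hqp])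
      · right
        have hA' : A - Pi.single p 1 + Pi.single p 1 = A := by
          ext q
          by_cases hqp : q = p
          · subst hqp; simp; omega
          · simp [hqp]
        refine ⟨A - Pi.single p 1, ⟨fun q hq => ?_, ?_⟩, hA'⟩
        · simp [h1 q hq]
        · rw [← h2]
          conv_rhs => rw [← hA']
          simp [add_smul, sum_add_distrib, Pi.single_apply, ite_smul]
    · rintro (⟨h1, h2⟩ | ⟨B, ⟨h1, h2⟩, rfl⟩)
      · exact ⟨fun q hq => h1 q (fun h => hq (mem_insert_of_mem h)), h2⟩
      · refine ⟨fun q hq => ?_, ?_⟩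
        · have : q ≠ p := fun h => hq (by simp [h])
          simp [h1 q hq, this]
        · rw [← h2]
          simp [add_smul, sum_add_distrib, Pi.single_apply, ite_smul]
  rw [himg, Set.ncard_union_eq _ (finite_combinations he _ _ _)
    ((finite_combinations he _ _ _).image _),
    Set.ncard_image_of_injective _ (add_left_injective _)]
  · push_cast; rfl
  · rw [Set.disjoint_left]
    rintro _ ⟨h1, -⟩ ⟨B, -, rfl⟩
    simpa using h1 p hp

theorem combinationSeries_mul_prod [DecidableEq P] {e : P → σ →₀ ℕ} (he : ∀ p, e p ≠ 0)
    {s t : Finset P}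
    (hst : Disjoint s t) :
    combinationSeries e (s ∪ t) * ∏ p ∈ t, (1 - MvPowerSeries.monomial (e p) 1) =
      combinationSeries e s := by
  induction t using Finset.induction_on with
  | empty => simp
  | insert p t hp ih =>
    rw [disjoint_insert_right] at hst
    rw [prod_insert hp, ← mul_assoc, union_insert, combinationSeries_insert he, ih hst.2]
    simp [hp, hst.1]

/-- The alternating count of matrices with margins `γ - v` and `γ - w` is `1`. -/
theorem sum_sign_mul_ncard_matrices {k : ℕ} {γ : Fin k → ℕ} (hγ : Function.Injective γ) :
    ∑ v : Equiv.Perm (Fin k), ∑ w : Equiv.Perm (Fin k),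
      ((Equiv.Perm.sign v : ℤ) * Equiv.Perm.sign w) *
        ({A : Fin k × Fin k → ℕ | (∀ i, ∑ j, A (i, j) + v i = γ i) ∧
          ∀ j, ∑ i, A (i, j) + w j = γ j}.ncard : ℤ) = 1 := by
  classical
  let x : Fin k → MvPowerSeries (Fin k ⊕ Fin k) ℤ := fun i => MvPowerSeries.X (Sum.inl i)
  let y : Fin k → MvPowerSeries (Fin k ⊕ Fin k) ℤ := fun i => MvPowerSeries.X (Sum.inr i)
  let e : Fin k × Fin k → Fin k ⊕ Fin k →₀ ℕ := fun p =>
    Finsupp.single (Sum.inl p.1) 1 + Finsupp.single (Sum.inr p.2) 1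
  have he : ∀ p, e p ≠ 0 := fun p h => by
    simpa [e] using DFunLike.congr_fun h (Sum.inl p.1)
  let N : (Fin k → ℕ) → (Fin k → ℕ) → Fin k ⊕ Fin k →₀ ℕ := fun a b =>
    Finsupp.equivFunOnFinite.symm (Sum.elim a b)
  have hsum : ∀ A : Fin k × Fin k → ℕ, ∑ p, A p • e p =
      N (fun i => ∑ j, A (i, j)) (fun j => ∑ i, A (i, j)) := by
    intro A
    ext (i | j)
    · simp only [e, N, Finsupp.finsetSum_apply, Fintype.sum_prod_type]
      rw [sum_eq_single i] <;> simp +contextual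
    · simp only [e, N, Finsupp.finsetSum_apply, Fintype.sum_prod_type]
      rw [sum_comm, sum_eq_single j] <;> simp +contextual
  have hNadd : ∀ a b c d, N a b + N c d = N (a + c) (b + d) := by
    intro a b c d
    ext (i | j) <;> simp [N]
  have hNinj : ∀ a b c d, N a b = N c d ↔ a = c ∧ b = d := by
    intro a b c d
    simp only [N, EmbeddingLike.apply_eq_iff_eq]
    exact Sum.elim_eq_iff
  have hmon : ∀ a b, (MvPowerSeries.monomial (N a b) (1 : ℤ)) =
      (∏ i, x i ^ a i) * ∏ i, y i ^ b i := by
    intro a b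
    simp only [x, y, MvPowerSeries.X_pow_eq, MvPowerSeries.prod_monomial,
      MvPowerSeries.monomial_mul_monomial, prod_const_one, mul_one]
    congr 2
    ext (i | j) <;> simp [N, Finsupp.single_apply]
  have hX : ∀ p, (MvPowerSeries.monomial (e p) (1 : ℤ)) = x p.1 * y p.2 := by
    intro p
    simp [x, y, e, MvPowerSeries.X_def, MvPowerSeries.monomial_mul_monomial]
  have hdet : ∀ M : Matrix (Fin k) (Fin k) (MvPowerSeries (Fin k ⊕ Fin k) ℤ),
      M.det = ∑ v : Equiv.Perm (Fin k), ((Equiv.Perm.sign v : ℤ) : MvPowerSeries (Fin k ⊕ Fin k) ℤ) *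
        ∏ i, M i (v i) := by
    intro M
    rw [← Matrix.det_transpose, Matrix.det_apply']
    rfl
  have key : ((Matrix.vandermonde x).det * (Matrix.vandermonde y).det) *
      combinationSeries e univ = ∑ w : Equiv.Perm (Fin k),
        ((Equiv.Perm.sign w : ℤ) : MvPowerSeries (Fin k ⊕ Fin k) ℤ) *
          combinationSeries e (univ.filter fun p => p.2 = w p.1) := by
    have : IsDomain (MvPowerSeries (Fin k ⊕ Fin k) ℤ) := NoZeroDivisors.to_isDomain _
    rw [← det_prod_erase, hdet, sum_mul]
    · refine sum_congr rfl fun w _ => ?_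
      rw [← combinationSeries_mul_prod he (disjoint_filter_filter_not univ univ
        fun p => p.2 = w p.1), filter_union_filter_not_eq, mul_assoc, mul_comm (∏ i, _)]
      congr 2
      simp only [Matrix.of_apply, hX]
      rw [prod_filter, Fintype.prod_prod_type]
      refine prod_congr rfl fun i _ => ?_
      rw [← prod_filter]
      refine prod_congr ?_ fun _ _ => rfl
      ext; simp
    · exact fun a b h => Sum.inr_injective (MvPowerSeries.X_inj.1 h)
    · exact fun i h => by
        simpa [y] using congrArg (MvPowerSeries.coeff (Finsupp.single (Sum.inr i) 1)) h
  have hcoeff := congrArg (MvPowerSeries.coeff (N γ γ)) key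
  have hsc : ∀ (z : ℤ) (f : MvPowerSeries (Fin k ⊕ Fin k) ℤ), MvPowerSeries.coeff (N γ γ)
      ((z : MvPowerSeries (Fin k ⊕ Fin k) ℤ) * f) = z * MvPowerSeries.coeff (N γ γ) f := by
    intro z f
    rw [← zsmul_eq_mul, map_zsmul, smul_eq_mul]
  rw [map_sum] at hcoeff
  simp only [hsc] at hcoeff
  have hL : MvPowerSeries.coeff (N γ γ) (((Matrix.vandermonde x).det *
      (Matrix.vandermonde y).det) * combinationSeries e univ) =
      ∑ v : Equiv.Perm (Fin k), ∑ w : Equiv.Perm (Fin k),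
      ((Equiv.Perm.sign v : ℤ) * Equiv.Perm.sign w) *
        ({A : Fin k × Fin k → ℕ | (∀ i, ∑ j, A (i, j) + v i = γ i) ∧
          ∀ j, ∑ i, A (i, j) + w j = γ j}.ncard : ℤ) := by
    rw [hdet, hdet, sum_mul_sum, sum_mul, map_sum]
    refine sum_congr rfl fun v _ => ?_
    rw [sum_mul, map_sum]
    refine sum_congr rfl fun w _ => ?_
    rw [show ∀ a b c d f : MvPowerSeries (Fin k ⊕ Fin k) ℤ,
      a * b * (c * d) * f = a * (c * ((b * d) * f)) by
      intros; ring, hsc, hsc]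
    simp only [Matrix.vandermonde_apply]
    rw [← hmon (fun i => v i) (fun i => w i), coeff_monomial_mul_combinationSeries]
    rw [← mul_assoc]
    congr 3
    ext A
    simp only [combinations, Set.mem_ofPred_eq, hsum, hNadd, hNinj, funext_iff, Pi.add_apply]
    simp
  rw [← hL, hcoeff, sum_eq_single 1]
  · rw [Equiv.Perm.sign_one, Units.val_one, one_mul]
    change ((combinations e _ 0 _).ncard : ℤ) = 1
    have : combinations e (univ.filter fun p => p.2 = (1 : Equiv.Perm (Fin k)) p.1) 0 (N γ γ) =
        {fun p => if p.2 = p.1 then γ p.1 else 0} := by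
      ext A
      simp only [combinations, Set.mem_ofPred_eq, hsum, hNinj, add_zero, Set.mem_singleton_iff]
      constructor
      · rintro ⟨h0, h1, -⟩
        ext ⟨i, j⟩
        by_cases hij : j = i
        · subst hij
          have := congrFun h1 j
          rw [sum_eq_single j (fun b _ hb => h0 _ fun h => hb (mem_filter.1 h).2) (by simp)] at this
          simpa using this
        · simpa [hij] using h0 (i, j) fun h => hij (mem_filter.1 h).2
      · rintro rfl
        refine ⟨fun p hp => if_neg fun h => hp (mem_filter.2 ⟨mem_univ p, h⟩), ?_, ?_⟩ <;> ext i <;> simp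
    rw [this]; simp
  · intro w _ hw
    have : combinations e (univ.filter fun p => p.2 = w p.1) 0 (N γ γ) = ∅ := by
      ext A
      simp only [combinations, Set.mem_ofPred_eq, hsum, hNinj, add_zero, mem_filter, mem_univ,
        true_and, Set.mem_empty_iff_false, iff_false]
      rintro ⟨h0, h1, h2⟩
      refine hw (Equiv.ext fun i => hγ ?_)
      have h1 := congrFun h1 i
      have h2 := congrFun h2 (w i)
      rw [sum_eq_single (w i) (fun b _ hb => h0 _ hb) (by simp)] at h1
      rw [sum_eq_single i (fun b _ hb => h0 _ fun h => hb (w.injective h.symm)) (by simp)] at h2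
      exact (h2.symm.trans h1)
    change _ * ((combinations e _ 0 _).ncard : ℤ) = 0
    simp [this]
  · simp

end Counting

section VirtualCharacters

open Module Representation

variable {G : Type*} [Group G]

/-- A subrepresentation and a complement split the character into a sum. -/
theorem character_eq_add_of_isCompl {A : Type*} [AddCommGroup A] [Module ℂ A]
    [FiniteDimensional ℂ A] {ρ : Representation ℂ G A} {K K' : Subrepresentation ρ}
    (h : IsCompl K.toSubmodule K'.toSubmodule) (g : G) :
    ρ.character g = K.toRepresentation.character g + K'.toRepresentation.character g := by
  have key : (Submodule.prodEquivOfIsCompl _ _ h).conj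
      ((K.toRepresentation g).prodMap (K'.toRepresentation g)) = ρ g := by
    ext v
    obtain ⟨p, rfl⟩ := (Submodule.prodEquivOfIsCompl _ _ h).surjective v
    simp [LinearEquiv.conj_apply, Subrepresentation.toRepresentation]
  unfold Representation.character
  rw [← key, LinearMap.trace_conj', LinearMap.trace_prodMap']

theorem isCompl_toSubmodule {A : Type*} [AddCommGroup A] [Module ℂ A]
    {ρ : Representation ℂ G A} {K K' : Subrepresentation ρ} (h : IsCompl K K') :
    IsCompl K.toSubmodule K'.toSubmodule := by
  constructor
  · rw [disjoint_iff, ← Subrepresentation.toSubmodule_inf, h.inf_eq_bot]; rfl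
  · rw [codisjoint_iff, ← Subrepresentation.toSubmodule_sup, h.sup_eq_top]; rfl

/-- An irreducibility criterion: the commutant is one-dimensional. -/
theorem eq_bot_or_eq_top_of_finrank_eq_one [Finite G] {A : Type*} [AddCommGroup A] [Module ℂ A]
    {ρ : Representation ℂ G A}
    (h1 : finrank ℂ (IntertwiningMap ρ ρ) = 1) (W : Submodule ℂ A)
    (hW : ∀ x v, v ∈ W → ρ x v ∈ W) : W = ⊥ ∨ W = ⊤ := by
  let S : Subrepresentation ρ := ⟨W, hW⟩
  obtain ⟨S', hS'⟩ := exists_isCompl S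
  have hc : IsCompl W S'.toSubmodule := isCompl_toSubmodule hS'
  have hequiv : ∀ g v, Submodule.projection _ _ hc (ρ g v) =
      ρ g (Submodule.projection _ _ hc v) := by
    intro g v
    obtain ⟨⟨a, b⟩, rfl⟩ := (Submodule.prodEquivOfIsCompl _ _ hc).surjective v
    simp only [Submodule.coe_prodEquivOfIsCompl', map_add]
    rw [Submodule.projection_apply_left hc a, Submodule.projection_apply_right hc b,
      Submodule.projection_apply_left hc ⟨ρ g a, hW g a a.2⟩,
      Submodule.projection_apply_right hc ⟨ρ g b, S'.apply_mem_toSubmodule g b.2⟩]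
    simp
  let p : IntertwiningMap ρ ρ :=
    (Submodule.projection _ _ hc).intertwiningMap_of_isIntertwiningMap ρ ρ hequiv
  by_cases hA : ∀ v : A, v = 0
  · left; rw [eq_bot_iff]; intro v _; simp [hA v]
  push Not at hA
  obtain ⟨v, hv⟩ := hA
  have hone : (1 : IntertwiningMap ρ ρ) ≠ 0 := by
    intro h
    apply hv
    have := congrArg (fun f : IntertwiningMap ρ ρ => f v) h
    simpa using this
  obtain ⟨c, hc'⟩ := (finrank_eq_one_iff_of_nonzero' 1 hone).1 h1 p
  have happ : ∀ w, Submodule.projection _ _ hc w = c • w := by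
    intro w
    have := congrArg (fun f : IntertwiningMap ρ ρ => f w) hc'
    exact this.symm
  by_cases hc0 : c = 0
  · left
    rw [eq_bot_iff]; intro w hw
    have := happ w
    rw [Submodule.projection_apply_left hc ⟨w, hw⟩, hc0, zero_smul] at this
    simpa using this
  · right
    rw [eq_top_iff]; intro w _
    have h2 : c • w ∈ W := by rw [← happ]; exact Submodule.projection_apply_mem hc w
    exact (Submodule.smul_mem_iff _ hc0).1 h2

/-- A virtual character of norm one is, up to sign, an irreducible character. -/
theorem exists_irreducible_of_norm_one [Fintype G] : ∀ (d : ℕ) (A B : Type) [AddCommGroup A]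
    [Module ℂ A] [FiniteDimensional ℂ A] [AddCommGroup B] [Module ℂ B] [FiniteDimensional ℂ B]
    (ρ : Representation ℂ G A) (σ : Representation ℂ G B), finrank ℂ A = d →
    ∑ g, (ρ.character g - σ.character g) * (ρ.character g⁻¹ - σ.character g⁻¹) = Fintype.card G →
    ∃ (V : Type) (_ : AddCommGroup V) (_ : Module ℂ V) (_ : FiniteDimensional ℂ V)
      (τ : Representation ℂ G V), Nontrivial V ∧
      (∀ W : Submodule ℂ V, (∀ x v, v ∈ W → τ x v ∈ W) → W = ⊥ ∨ W = ⊤) ∧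
      ((∀ g, τ.character g = ρ.character g - σ.character g) ∨
        (∀ g, τ.character g = σ.character g - ρ.character g)) := by
  intro d
  induction d using Nat.strong_induction_on with
  | _ d ih =>
  intro A B _ _ _ _ _ _ ρ σ hd hnorm
  by_cases hf : ∀ f : IntertwiningMap ρ σ, f = 0
  · have hG : (Nat.card G : ℂ) ≠ 0 := by exact_mod_cast Nat.card_pos.ne'
    let : Invertible (Nat.card G : ℂ) := invertibleOfNonzero hG
    have h0 : finrank ℂ (IntertwiningMap ρ σ) = 0 := by
      have : Subsingleton (IntertwiningMap ρ σ) := ⟨fun f g => by rw [hf f, hf g]⟩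
      exact finrank_zero_of_subsingleton
    have e1 := card_inv_mul_sum_char_mul_char_eq_finrank ρ ρ
    have e2 := card_inv_mul_sum_char_mul_char_eq_finrank σ σ
    have e3 := card_inv_mul_sum_char_mul_char_eq_finrank ρ σ
    have e4 : ∑ g, ρ.character g * σ.character g⁻¹ = ∑ g, σ.character g * ρ.character g⁻¹ :=
      Fintype.sum_equiv (Equiv.inv G) _ _ (fun g => by simp [mul_comm])
    have hsum : (finrank ℂ (IntertwiningMap ρ ρ) : ℂ) + finrank ℂ (IntertwiningMap σ σ) = 1 := by
      rw [h0, Nat.cast_zero] at e3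
      have e3' := (mul_eq_zero.1 e3).resolve_left (inv_ne_zero hG)
      rw [← e1, ← e2, ← mul_add, inv_mul_eq_iff_eq_mul₀ hG, mul_one, Nat.card_eq_fintype_card,
        ← hnorm]
      simp only [sub_mul, mul_sub, Finset.sum_sub_distrib, e4, e3']
      ring
    have hsum' : finrank ℂ (IntertwiningMap ρ ρ) + finrank ℂ (IntertwiningMap σ σ) = 1 := by
      exact_mod_cast hsum
    have aux : ∀ (X : Type) [AddCommGroup X] [Module ℂ X] [FiniteDimensional ℂ X]
        (θ : Representation ℂ G X), finrank ℂ (IntertwiningMap θ θ) = 0 →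
        ∀ g, θ.character g = 0 := by
      intro X _ _ _ θ hθ g
      have : Module.Finite ℂ (IntertwiningMap θ θ) :=
        Module.Finite.equiv (invariantsEquivIntertwiningMap θ θ)
      have := finrank_zero_iff.1 hθ
      have h1 : (1 : IntertwiningMap θ θ) = 0 := Subsingleton.elim _ _
      have : θ g = 0 := by
        ext v
        have := congrArg (fun f : IntertwiningMap θ θ => f (θ g v)) h1
        simpa using this
      simp [Representation.character, this]
    have aux2 : ∀ (X : Type) [AddCommGroup X] [Module ℂ X]
        (θ : Representation ℂ G X), finrank ℂ (IntertwiningMap θ θ) = 1 → Nontrivial X := by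
      intro X _ _ θ hθ
      by_contra hX
      rw [not_nontrivial_iff_subsingleton] at hX
      have : Subsingleton (IntertwiningMap θ θ) :=
        ⟨fun f g => by ext v; exact Subsingleton.elim _ _⟩
      rw [finrank_zero_of_subsingleton] at hθ
      exact zero_ne_one hθ
    rcases Nat.add_eq_one_iff.1 hsum' with ⟨ha, hb⟩ | ⟨ha, hb⟩
    · refine ⟨B, _, _, ‹_›, σ, aux2 _ _ hb, eq_bot_or_eq_top_of_finrank_eq_one hb, Or.inr ?_⟩
      intro g; rw [aux A ρ ha, sub_zero]
    · refine ⟨A, _, _, ‹_›, ρ, aux2 _ _ ha, eq_bot_or_eq_top_of_finrank_eq_one ha, Or.inl ?_⟩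
      intro g; rw [aux B σ hb, sub_zero]
  · push Not at hf
    obtain ⟨f, hf⟩ := hf
    obtain ⟨K', hK⟩ := exists_isCompl f.ker
    obtain ⟨I', hI⟩ := exists_isCompl f.range
    have hK' := isCompl_toSubmodule hK
    have hI' := isCompl_toSubmodule hI
    let e : K'.toSubmodule ≃ₗ[ℂ] f.range.toSubmodule :=
      LinearEquiv.ofBijective (f.toLinearMap.rangeRestrict ∘ₗ K'.toSubmodule.subtype) (by
        constructor
        · rw [← LinearMap.ker_eq_bot, LinearMap.ker_eq_bot']
          intro m hm
          have h1 : (m : A) ∈ f.ker.toSubmodule := by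
            have := congrArg Subtype.val hm
            simpa using this
          have := Submodule.disjoint_def.1 hK'.disjoint _ h1 m.2
          exact Subtype.ext this
        · rintro ⟨w, v, rfl⟩
          obtain ⟨⟨a, b⟩, rfl⟩ := (Submodule.prodEquivOfIsCompl _ _ hK').surjective v
          refine ⟨b, Subtype.ext ?_⟩
          have ha : f (a : A) = 0 := a.2
          simp [ha])
    have hchar : ∀ g, K'.toRepresentation.character g = f.range.toRepresentation.character g := by
      intro g
      have : e.conj (K'.toRepresentation g) = f.range.toRepresentation g := by
        ext w
        obtain ⟨v, rfl⟩ := e.surjective w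
        have := LinearMap.congr_fun (f.isIntertwining' g) (v : A)
        change ((e (K'.toRepresentation g (e.symm (e v)))) : B) = σ g (e v)
        rw [e.symm_apply_apply]
        exact this
      unfold Representation.character
      rw [← this, LinearMap.trace_conj']
    have hdiff : ∀ g, ρ.character g - σ.character g =
        f.ker.toRepresentation.character g - I'.toRepresentation.character g := by
      intro g
      rw [character_eq_add_of_isCompl hK', character_eq_add_of_isCompl hI', hchar]
      ring
    have hlt : finrank ℂ f.ker.toSubmodule < d := by
      rw [← hd]
      apply Submodule.finrank_lt
      intro htop
      apply hf
      ext v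
      have : v ∈ f.ker.toSubmodule := by rw [htop]; trivial
      exact this
    obtain ⟨V, i1, i2, i3, τ, h1, h2, h3⟩ := ih _ hlt f.ker.toSubmodule I'.toSubmodule
      f.ker.toRepresentation I'.toRepresentation rfl (by simpa only [← hdiff] using hnorm)
    refine ⟨V, i1, i2, i3, τ, h1, h2, h3.imp (fun h g => by rw [h, hdiff]) (fun h g => ?_)⟩
    rw [h, ← neg_sub, ← hdiff, neg_sub]

/-- The permutation representation on complex functions on a `G`-set. -/
def permutationRep (G X : Type*) [Group G] [MulAction G X] : Representation ℂ G (X → ℂ) where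
  toFun g := LinearMap.funLeft ℂ ℂ (fun x => g⁻¹ • x)
  map_one' := by ext; simp [LinearMap.funLeft]
  map_mul' a b := by ext; simp [LinearMap.funLeft, mul_smul]

theorem permutationRep_character {X : Type*} [MulAction G X] [Finite X] (g : G) :
    (permutationRep G X).character g = (Nat.card (MulAction.fixedBy X g) : ℂ) := by
  classical
  have := Fintype.ofFinite X
  unfold Representation.character
  rw [LinearMap.trace_eq_matrix_trace ℂ (Pi.basisFun ℂ X), Matrix.trace, Nat.card_eq_fintype_card,
    Fintype.card_subtype, Finset.card_filter]
  push_cast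
  refine Finset.sum_congr rfl fun x _ => ?_
  rw [Matrix.diag_apply, LinearMap.toMatrix_apply]
  simp only [permutationRep, Pi.basisFun_apply, Pi.basisFun_repr, MonoidHom.coe_mk, OneHom.coe_mk,
    LinearMap.funLeft_apply, Pi.single_apply, MulAction.mem_fixedBy, inv_smul_eq_iff]
  exact if_congr eq_comm rfl rfl

theorem card_fixedBy_inv {X : Type*} [MulAction G X] (g : G) :
    Nat.card (MulAction.fixedBy X g⁻¹) = Nat.card (MulAction.fixedBy X g) := by
  rw [MulAction.fixedBy_inv]

/-- The scalar product of two permutation characters counts orbits on the product. -/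
theorem sum_card_fixedBy_mul [Fintype G] (X Y : Type*) [MulAction G X] [MulAction G Y] [Finite X]
    [Finite Y] : ∑ g : G, Nat.card (MulAction.fixedBy X g) * Nat.card (MulAction.fixedBy Y g) =
      Nat.card (MulAction.orbitRel.Quotient G (X × Y)) * Fintype.card G := by
  classical
  have := Fintype.ofFinite X
  have := Fintype.ofFinite Y
  rw [Nat.card_eq_fintype_card, ← MulAction.sum_card_fixedBy_eq_card_orbits_mul_card_group]
  refine Finset.sum_congr rfl fun g _ => ?_
  rw [← Nat.card_prod, ← Nat.card_eq_fintype_card]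
  refine Nat.card_congr ⟨fun p => ⟨(p.1.1, p.2.1), Prod.ext p.1.2 p.2.2⟩,
    fun p => (⟨p.1.1, congrArg Prod.fst p.2⟩, ⟨p.1.2, congrArg Prod.snd p.2⟩),
    fun _ => rfl, fun _ => rfl⟩

/-- A signed combination of permutation characters of norm one is, up to sign, irreducible. -/
theorem exists_irreducible_of_signed_permutation [Fintype G] {ι : Type} [Fintype ι]
    (X : ι → Type) [∀ i, MulAction G (X i)] [∀ i, Finite (X i)] (s : ι → ℤˣ)
    (h : ∑ i, ∑ j, ((s i : ℤ) * s j) * Nat.card (MulAction.orbitRel.Quotient G (X i × X j)) = 1) :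
    ∃ (V : Type) (_ : AddCommGroup V) (_ : Module ℂ V) (_ : FiniteDimensional ℂ V)
      (τ : Representation ℂ G V), Nontrivial V ∧
      (∀ W : Submodule ℂ V, (∀ x v, v ∈ W → τ x v ∈ W) → W = ⊥ ∨ W = ⊤) ∧
      ∃ ε : ℤˣ, ∀ g, τ.character g =
        (((ε : ℤ) * ∑ i, (s i : ℤ) * Nat.card (MulAction.fixedBy (X i) g) : ℤ) : ℂ) := by
  classical
  let f : G → ℤ := fun g => ∑ i, (s i : ℤ) * Nat.card (MulAction.fixedBy (X i) g)
  let Y : ℤˣ → Type := fun u => Σ i : {i // s i = u}, X i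
  have hY : ∀ u g, (permutationRep G (Y u)).character g =
      ((∑ i : {i // s i = u}, (Nat.card (MulAction.fixedBy (X i) g) : ℤ) : ℤ) : ℂ) := by
    intro u g
    rw [permutationRep_character]
    push_cast
    rw [← Nat.cast_sum, ← Nat.card_sigma]
    congr 1
    refine Nat.card_congr ⟨fun p => ⟨p.1.1, ⟨p.1.2, ?_⟩⟩, fun p => ⟨⟨p.1, p.2.1⟩, ?_⟩,
      fun _ => rfl, fun _ => rfl⟩
    · have := p.2
      rw [MulAction.mem_fixedBy] at this ⊢
      exact eq_of_heq (Sigma.mk.inj_iff.1 this).2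
    · have := p.2.2
      rw [MulAction.mem_fixedBy] at this ⊢
      exact congrArg (Sigma.mk p.1) this
  have hf : ∀ g, (permutationRep G (Y 1)).character g - (permutationRep G (Y (-1))).character g =
      (f g : ℂ) := by
    intro g
    rw [hY, hY, ← Int.cast_sub]
    congr 1
    simp only [f]
    rw [← Finset.sum_subtype (Finset.univ.filter fun i => s i = 1) (by simp)
        (fun i => (Nat.card (MulAction.fixedBy (X i) g) : ℤ)),
      ← Finset.sum_subtype (Finset.univ.filter fun i => s i = -1) (by simp)
        (fun i => (Nat.card (MulAction.fixedBy (X i) g) : ℤ)),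
      Finset.sum_filter, Finset.sum_filter, ← Finset.sum_sub_distrib]
    refine Finset.sum_congr rfl fun i _ => ?_
    rcases Int.units_eq_one_or (s i) with h | h <;> simp [h]
  have hinv : ∀ g, f g⁻¹ = f g := fun g => by simp only [f, card_fixedBy_inv]
  have hnorm : ∑ g, f g * f g = Fintype.card G := by
    have : ∑ g, f g * f g = (∑ i, ∑ j, ((s i : ℤ) * s j) *
        Nat.card (MulAction.orbitRel.Quotient G (X i × X j))) * Fintype.card G := by
      simp only [f, Finset.sum_mul_sum]
      rw [Finset.sum_comm, Finset.sum_mul]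
      refine Finset.sum_congr rfl fun i _ => ?_
      rw [Finset.sum_comm, Finset.sum_mul]
      refine Finset.sum_congr rfl fun j _ => ?_
      have := sum_card_fixedBy_mul (G := G) (X i) (X j)
      zify at this
      rw [mul_assoc, ← this, Finset.mul_sum]
      exact Finset.sum_congr rfl fun g _ => by ring
    rw [this, h, one_mul]
  obtain ⟨V, i1, i2, i3, τ, h1, h2, h3⟩ := exists_irreducible_of_norm_one _ _ _
    (permutationRep G (Y 1)) (permutationRep G (Y (-1))) rfl (by
      simp only [hf, hinv]; exact_mod_cast hnorm)
  refine ⟨V, i1, i2, i3, τ, h1, h2, ?_⟩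
  rcases h3 with h3 | h3
  · exact ⟨1, fun g => by rw [h3, hf]; simp [f]⟩
  · exact ⟨-1, fun g => by rw [h3, ← neg_sub, hf]; simp [f]⟩

end VirtualCharacters

section PartialFlags

open Module Finset

theorem sum_castSucc_lt_succ {k : ℕ} {M : Type*} [AddCommMonoid M] (a : Fin k → M) (i : Fin k) :
    ∑ j with j.castSucc < i.succ, a j = ∑ j with j.castSucc < i.castSucc, a j + a i := by
  have : (univ.filter fun j : Fin k => j.castSucc < i.succ) =
      insert i (univ.filter fun j : Fin k => j.castSucc < i.castSucc) := by
    ext j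
    simp only [mem_filter, mem_univ, true_and, mem_insert, Fin.lt_def, Fin.ext_iff,
      Fin.val_castSucc, Fin.val_succ]
    omega
  rw [this, sum_insert (by simp), add_comm]

theorem eq_of_forall_sum_castSucc_lt {k : ℕ} {M : Type*} [AddCancelCommMonoid M]
    {a b : Fin k → M}
    (h : ∀ i : Fin (k + 1), ∑ j with j.castSucc < i, a j = ∑ j with j.castSucc < i, b j) :
    a = b := by
  ext i
  have := h i.succ
  rwa [sum_castSucc_lt_succ, sum_castSucc_lt_succ, h i.castSucc, add_right_inj] at this

theorem sum_castSucc_lt_last {k : ℕ} {M : Type*} [AddCommMonoid M] (a : Fin k → M) :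
    ∑ j with j.castSucc < Fin.last k, a j = ∑ j, a j := by
  simp [Fin.castSucc_lt_last]

theorem Fin.sum_succ_sub_castSucc {k : ℕ} {M : Type*} [AddCommGroup M] (f : Fin (k + 1) → M) :
    ∑ i : Fin k, (f i.succ - f i.castSucc) = f (Fin.last k) - f 0 := by
  rw [sum_sub_distrib, sub_eq_sub_iff_add_eq_add, add_comm, ← Fin.sum_univ_succ,
    Fin.sum_univ_castSucc, add_comm]

variable {K V : Type*} [Field K] [AddCommGroup V] [Module K V]

theorem Module.Basis.span_image_inf_span_image {κ : Type*} (b : Basis κ K V) (s t : Set κ) :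
    Submodule.span K (b '' s) ⊓ Submodule.span K (b '' t) = Submodule.span K (b '' (s ∩ t)) := by
  ext x
  simp only [Submodule.mem_inf, Basis.mem_span_image, Set.subset_inter_iff]

theorem Module.Basis.finrank_span_image {κ : Type*} [Fintype κ] (b : Basis κ K V) (s : Set κ) :
    finrank K (Submodule.span K (b '' s)) = s.ncard := by
  classical
  have : b '' s = Set.range fun x : s => b x := by
    ext; simp
  rw [this, finrank_span_eq_card (b := fun x : s => b x)
    (b.linearIndependent.comp _ Subtype.val_injective), ← Nat.card_eq_fintype_card]
  rfl

variable (K V) in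
/-- Chains of subspaces whose successive dimensions jump by `α`. -/
def PartialFlag {k : ℕ} (α : Fin k → ℕ) : Type _ :=
  {F : Fin (k + 1) → Submodule K V //
    Monotone F ∧ ∀ i, finrank K (F i) = ∑ j with j.castSucc < i, α j}

instance {k : ℕ} (α : Fin k → ℕ) : MulAction (V ≃ₗ[K] V) (PartialFlag K V α) where
  smul g F := ⟨fun i => (F.1 i).map (g : V →ₗ[K] V), fun _ _ h => Submodule.map_mono (F.2.1 h),
    fun i => by rw [LinearEquiv.finrank_map_eq]; exact F.2.2 i⟩
  one_smul F := Subtype.ext <| funext fun i => Submodule.map_id _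
  mul_smul g h F := Subtype.ext <| funext fun i => Submodule.map_comp _ _ _

theorem PartialFlag.smul_val {k : ℕ} {α : Fin k → ℕ} (g : V ≃ₗ[K] V) (F : PartialFlag K V α)
    (i : Fin (k + 1)) : (g • F).1 i = (F.1 i).map (g : V →ₗ[K] V) := rfl

/-- The chain spanned by the initial colour classes of a coloured basis. -/
def Module.Basis.coloredSpan {κ : Type*} {k : ℕ} (b : Basis κ K V) (c : κ → Fin k)
    (i : Fin (k + 1)) : Submodule K V :=
  Submodule.span K (b '' {x | (c x).castSucc < i})

theorem ncard_castSucc_lt {κ : Type*} [Fintype κ] {k : ℕ} (c : κ → Fin k) (i : Fin (k + 1)) :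
    {x | (c x).castSucc < i}.ncard = ∑ j with j.castSucc < i, {x | c x = j}.ncard := by
  classical
  simp only [Set.ncard_eq_toFinset_card', Set.toFinset_ofPred]
  rw [card_eq_sum_card_fiberwise (f := c) (t := univ.filter fun j => j.castSucc < i)
    (by intro x; simp)]
  refine sum_congr rfl fun j hj => ?_
  congr 1
  ext x
  simp only [mem_filter, mem_univ, true_and] at hj ⊢
  exact ⟨fun h => h.2, fun h => ⟨h ▸ hj, h⟩⟩

theorem Module.Basis.finrank_coloredSpan {κ : Type*} [Fintype κ] {k : ℕ} (b : Basis κ K V)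
    (c : κ → Fin k) (i : Fin (k + 1)) :
    finrank K (b.coloredSpan c i) = ∑ j with j.castSucc < i, {x | c x = j}.ncard := by
  rw [coloredSpan, b.finrank_span_image, ncard_castSucc_lt]

theorem Module.Basis.monotone_coloredSpan {κ : Type*} {k : ℕ} (b : Basis κ K V)
    (c : κ → Fin k) : Monotone (b.coloredSpan c) := fun _ _ h =>
  Submodule.span_mono (Set.image_mono fun _ hx => lt_of_lt_of_le hx h)

/-- The partial flag attached to a coloured basis. -/
def Module.Basis.partialFlag {κ : Type*} [Fintype κ] {k : ℕ} (b : Basis κ K V) (c : κ → Fin k)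
    {α : Fin k → ℕ} (h : ∀ j, {x | c x = j}.ncard = α j) : PartialFlag K V α :=
  ⟨b.coloredSpan c, b.monotone_coloredSpan c, fun i => by simp only [b.finrank_coloredSpan, h]⟩

theorem Module.Basis.map_equiv_coloredSpan {κ : Type*} {k : ℕ} (b b' : Basis κ K V)
    (c : κ → Fin k) (i : Fin (k + 1)) :
    (b.coloredSpan c i).map (b.equiv b' (Equiv.refl κ) : V →ₗ[K] V) = b'.coloredSpan c i := by
  rw [coloredSpan, coloredSpan, Submodule.map_span, Set.image_image]
  simp

theorem ncard_sigma_fst {ι : Type*} [Fintype ι] (A : ι → ℕ) (s : Set ι) [DecidablePred (· ∈ s)] :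
    {x : (Σ p : ι, Fin (A p)) | x.1 ∈ s}.ncard = ∑ p with p ∈ s, A p := by
  classical
  rw [Set.ncard_eq_toFinset_card', Set.toFinset_ofPred]
  have : (univ.filter fun x : (Σ p : ι, Fin (A p)) => x.1 ∈ s) =
      (univ.filter (· ∈ s)).sigma fun _ => univ := by
    ext; simp
  rw [this, card_sigma]
  simp

/-- Two chains of subspaces have a common adapted basis. -/
theorem exists_basis_coloredSpan_eq [FiniteDimensional K V] {k l : ℕ}
    {F : Fin (k + 1) → Submodule K V} {E : Fin (l + 1) → Submodule K V}
    (hF : Monotone F) (hE : Monotone E) (hF0 : F 0 = ⊥) (hE0 : E 0 = ⊥)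
    (hF1 : F (Fin.last k) = ⊤) (hE1 : E (Fin.last l) = ⊤) :
    ∃ (A : Fin k × Fin l → ℕ) (b : Basis (Σ p, Fin (A p)) K V),
      b.coloredSpan (fun x => x.1.1) = F ∧ b.coloredSpan (fun x => x.1.2) = E := by
  classical
  let D : Fin k × Fin l → Submodule K V := fun p =>
    (F p.1.castSucc ⊓ E p.2.succ) ⊔ (F p.1.succ ⊓ E p.2.castSucc)
  have hD : ∀ p, D p ≤ F p.1.succ ⊓ E p.2.succ := fun p =>
    sup_le (inf_le_inf_right _ (hF (Fin.castSucc_le_succ _)))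
      (inf_le_inf_left _ (hE (Fin.castSucc_le_succ _)))
  have hW : ∀ p, ∃ W : Submodule K V, D p ⊓ W = ⊥ ∧ D p ⊔ W = F p.1.succ ⊓ E p.2.succ := by
    intro p
    obtain ⟨W, hW⟩ := Submodule.exists_isCompl (D p)
    refine ⟨W ⊓ (F p.1.succ ⊓ E p.2.succ), ?_, ?_⟩
    · rw [← inf_assoc, hW.inf_eq_bot, bot_inf_eq]
    · rw [← sup_inf_assoc_of_le _ (hD p), hW.sup_eq_top, top_inf_eq]
  choose W hW1 hW2 using hW
  have hWle : ∀ p, W p ≤ F p.1.succ ⊓ E p.2.succ := fun p => hW2 p ▸ le_sup_right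
  let A : Fin k × Fin l → ℕ := fun p => finrank K (W p)
  let d : Fin (k + 1) → Fin (l + 1) → ℤ := fun i j => finrank K ↥(F i ⊓ E j)
  have hA : ∀ p, (A p : ℤ) = (d p.1.succ p.2.succ - d p.1.succ p.2.castSucc) -
      (d p.1.castSucc p.2.succ - d p.1.castSucc p.2.castSucc) := by
    intro p
    have h1 := Submodule.finrank_sup_add_finrank_inf_eq (D p) (W p)
    have h2 := Submodule.finrank_sup_add_finrank_inf_eq (F p.1.castSucc ⊓ E p.2.succ)
      (F p.1.succ ⊓ E p.2.castSucc)
    rw [hW1, hW2, finrank_bot] at h1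
    rw [inf_inf_inf_comm, inf_eq_left.2 (hF (Fin.castSucc_le_succ _)),
      inf_eq_right.2 (hE (Fin.castSucc_le_succ _))] at h2
    have h3 : finrank K ↥(D p) = finrank K
      ↥((F p.1.castSucc ⊓ E p.2.succ) ⊔ (F p.1.succ ⊓ E p.2.castSucc)) := rfl
    simp only [A, d]
    omega
  have hcard : Fintype.card (Σ p, Fin (A p)) = finrank K V := by
    have : (Fintype.card (Σ p, Fin (A p)) : ℤ) = finrank K V := by
      rw [Fintype.card_sigma]
      push_cast
      have hrow : ∀ i, ∑ j, (A (i, j) : ℤ) = (d i.succ (Fin.last l) - d i.succ 0) -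
          (d i.castSucc (Fin.last l) - d i.castSucc 0) := by
        intro i
        simp only [hA]
        rw [sum_sub_distrib, Fin.sum_succ_sub_castSucc, Fin.sum_succ_sub_castSucc]
      simp only [Fintype.card_fin, Fintype.sum_prod_type, hrow]
      rw [Fin.sum_succ_sub_castSucc fun i => d i (Fin.last l) - d i 0]
      simp only [d]
      rw [hF0, hE0, hF1, hE1, top_inf_eq, inf_bot_eq, bot_inf_eq, bot_inf_eq, finrank_bot, finrank_top]
      simp
    exact_mod_cast this
  have hle : ∀ i j, F i ⊓ E j ≤
      ⨆ p : {p : Fin k × Fin l // p.1.castSucc < i ∧ p.2.castSucc < j}, W p := by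
    intro i
    induction i using Fin.induction with
    | zero => intro j; simp [hF0]
    | succ i ihi =>
      intro j
      induction j using Fin.induction with
      | zero => simp [hE0]
      | succ j ihj =>
        rw [← hW2 (i, j)]
        refine sup_le (sup_le ((ihi j.succ).trans ?_) (ihj.trans ?_)) ?_
        · exact iSup_le fun p => le_iSup_of_le
            ⟨p.1, p.2.1.trans Fin.castSucc_lt_succ, p.2.2⟩ le_rfl
        · exact iSup_le fun p => le_iSup_of_le
            ⟨p.1, p.2.1, p.2.2.trans Fin.castSucc_lt_succ⟩ le_rfl
        · exact le_iSup_of_le ⟨(i, j), Fin.castSucc_lt_succ, Fin.castSucc_lt_succ⟩ le_rfl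
  let v : (Σ p, Fin (A p)) → V := fun x => (finBasis K (W x.1) x.2 : V)
  have hWspan : ∀ (s : Set (Σ p, Fin (A p))) p, (∀ a, (⟨p, a⟩ : Σ p, Fin (A p)) ∈ s) →
      W p ≤ Submodule.span K (v '' s) := by
    intro s p hp
    have : W p = Submodule.span K (Set.range fun a => v ⟨p, a⟩) := by
      have := congrArg (Submodule.map (W p).subtype) (finBasis K (W p)).span_eq
      rw [Submodule.map_span, Submodule.map_top, Submodule.range_subtype, ← Set.range_comp] at this
      exact this.symm
    rw [this]
    refine Submodule.span_mono ?_
    rintro _ ⟨a, rfl⟩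
    exact ⟨_, hp a, rfl⟩
  have hspan : ⊤ ≤ Submodule.span K (Set.range v) := by
    have := hle (Fin.last k) (Fin.last l)
    rw [hF1, hE1, inf_top_eq] at this
    rw [← Set.image_univ]
    exact this.trans (iSup_le fun p => hWspan _ _ fun _ => trivial)
  let b := basisOfTopLeSpanOfCardEqFinrank v hspan hcard
  have hb : ⇑b = v := coe_basisOfTopLeSpanOfCardEqFinrank _ _ _
  refine ⟨A, b, funext fun i => le_antisymm ?_ ?_, funext fun j => le_antisymm ?_ ?_⟩
  · rw [Basis.coloredSpan, Submodule.span_le, hb]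
    rintro _ ⟨x, hx, rfl⟩
    refine hF (?_ : x.1.1.succ ≤ i) ((hWle x.1).trans inf_le_left (Subtype.prop _))
    exact Fin.castSucc_lt_iff_succ_le.1 hx
  · have := hle i (Fin.last l)
    rw [hE1, inf_top_eq] at this
    rw [Basis.coloredSpan, hb]
    exact this.trans (iSup_le fun p => hWspan _ _ fun _ => p.2.1)
  · rw [Basis.coloredSpan, Submodule.span_le, hb]
    rintro _ ⟨x, hx, rfl⟩
    refine hE (?_ : x.1.2.succ ≤ j) ((hWle x.1).trans inf_le_right (Subtype.prop _))
    exact Fin.castSucc_lt_iff_succ_le.1 hx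
  · have := hle (Fin.last k) j
    rw [hF1, top_inf_eq] at this
    rw [Basis.coloredSpan, hb]
    exact this.trans (iSup_le fun p => hWspan _ _ fun _ => p.2.2)

theorem PartialFlag.val_zero [FiniteDimensional K V] {k : ℕ} {α : Fin k → ℕ}
    (F : PartialFlag K V α) : F.1 0 = ⊥ := by
  rw [← Submodule.finrank_eq_zero, F.2.2]
  simp

theorem PartialFlag.val_last [FiniteDimensional K V] {k : ℕ} {α : Fin k → ℕ}
    (hα : ∑ i, α i = finrank K V) (F : PartialFlag K V α) : F.1 (Fin.last k) = ⊤ := by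
  apply Submodule.eq_top_of_finrank_eq
  rw [F.2.2, sum_castSucc_lt_last, hα]

theorem exists_basis_of_card_eq_finrank [FiniteDimensional K V] {κ : Type*} [Fintype κ]
    (h : Fintype.card κ = finrank K V) : Nonempty (Basis κ K V) :=
  ⟨(finBasis K V).reindex (Fintype.equivOfCardEq (by simp [h]))⟩

theorem Module.Basis.coloredSpan_map {κ : Type*} {k : ℕ} (b : Basis κ K V) (g : V ≃ₗ[K] V)
    (c : κ → Fin k) (i : Fin (k + 1)) :
    (b.map g).coloredSpan c i = (b.coloredSpan c i).map (g : V →ₗ[K] V) := by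
  rw [coloredSpan, coloredSpan, Submodule.map_span, Set.image_image]
  rfl

theorem Module.Basis.finrank_coloredSpan_inf {k l : ℕ} {A : Fin k × Fin l → ℕ}
    (b : Basis (Σ p, Fin (A p)) K V) (i : Fin (k + 1)) (j : Fin (l + 1)) :
    finrank K ↥(b.coloredSpan (fun x => x.1.1) i ⊓ b.coloredSpan (fun x => x.1.2) j) =
      ∑ i' with i'.castSucc < i, ∑ j' with j'.castSucc < j, A (i', j') := by
  classical
  rw [coloredSpan, coloredSpan, b.span_image_inf_span_image, b.finrank_span_image]
  rw [← sum_product' _ _ fun i j => A (i, j)]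
  refine (ncard_sigma_fst A {p | p.1.castSucc < i ∧ p.2.castSucc < j}).trans ?_
  refine sum_congr ?_ fun _ _ => rfl
  ext p
  simp

theorem eq_of_coloredSpan_eq {k l : ℕ} {A B : Fin k × Fin l → ℕ}
    (a : Basis (Σ p, Fin (A p)) K V) (b : Basis (Σ p, Fin (B p)) K V)
    (h1 : a.coloredSpan (fun x => x.1.1) = b.coloredSpan (fun x => x.1.1))
    (h2 : a.coloredSpan (fun x => x.1.2) = b.coloredSpan (fun x => x.1.2)) : A = B := by
  have : ∀ i : Fin k, ∀ j : Fin (l + 1),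
      ∑ j' with j'.castSucc < j, A (i, j') = ∑ j' with j'.castSucc < j, B (i, j') := by
    intro i j
    refine congrFun (eq_of_forall_sum_castSucc_lt
      (a := fun i => ∑ j' with j'.castSucc < j, A (i, j'))
      (b := fun i => ∑ j' with j'.castSucc < j, B (i, j')) fun i' => ?_) i
    rw [← a.finrank_coloredSpan_inf, ← b.finrank_coloredSpan_inf, h1, h2]
  ext ⟨i, j⟩
  exact congrFun (eq_of_forall_sum_castSucc_lt (this i)) j

theorem ncard_sigma_prod_fst {k l : ℕ} (A : Fin k × Fin l → ℕ) (i : Fin k) :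
    {x : (Σ p, Fin (A p)) | x.1.1 = i}.ncard = ∑ j, A (i, j) := by
  classical
  refine (ncard_sigma_fst A {p | p.1 = i}).trans ?_
  simp only [Set.mem_ofPred_eq, sum_filter, Fintype.sum_prod_type]
  rw [sum_eq_single i] <;> simp +contextual

theorem ncard_sigma_prod_snd {k l : ℕ} (A : Fin k × Fin l → ℕ) (j : Fin l) :
    {x : (Σ p, Fin (A p)) | x.1.2 = j}.ncard = ∑ i, A (i, j) := by
  classical
  refine (ncard_sigma_fst A {p | p.2 = j}).trans ?_
  simp only [Set.mem_ofPred_eq, sum_filter, Fintype.sum_prod_type]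
  rw [sum_comm, sum_eq_single j] <;> simp +contextual

/-- Pairs of partial flags up to simultaneous change of basis are counted by matrices. -/
theorem card_orbits_partialFlag [FiniteDimensional K V] {k l : ℕ} {α : Fin k → ℕ}
    {β : Fin l → ℕ} (hα : ∑ i, α i = finrank K V) (hβ : ∑ i, β i = finrank K V) :
    Nat.card (MulAction.orbitRel.Quotient (V ≃ₗ[K] V) (PartialFlag K V α × PartialFlag K V β)) =
      {A : Fin k × Fin l → ℕ | (∀ i, ∑ j, A (i, j) = α i) ∧ ∀ j, ∑ i, A (i, j) = β j}.ncard := by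
  classical
  let X := PartialFlag K V α × PartialFlag K V β
  let R : X → (Fin k × Fin l → ℕ) → Prop := fun x A => ∃ b : Basis (Σ p, Fin (A p)) K V,
    b.coloredSpan (fun x => x.1.1) = x.1.1 ∧ b.coloredSpan (fun x => x.1.2) = x.2.1
  have hR1 : ∀ x : X, ∃ A, R x A := fun x => exists_basis_coloredSpan_eq x.1.2.1 x.2.2.1
    x.1.val_zero x.2.val_zero (x.1.val_last hα) (x.2.val_last hβ)
  have hR2 : ∀ x A B, R x A → R x B → A = B := by
    rintro x A B ⟨a, ha1, ha2⟩ ⟨b, hb1, hb2⟩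
    exact eq_of_coloredSpan_eq a b (ha1.trans hb1.symm) (ha2.trans hb2.symm)
  have hR3 : ∀ x A (g : V ≃ₗ[K] V), R x A → R (g • x) A := by
    rintro x A g ⟨a, ha1, ha2⟩
    refine ⟨a.map g, funext fun i => ?_, funext fun i => ?_⟩
    · rw [a.coloredSpan_map, ha1]; rfl
    · rw [a.coloredSpan_map, ha2]; rfl
  have hR4 : ∀ x y A, R x A → R y A → ∃ g : V ≃ₗ[K] V, g • x = y := by
    rintro x y A ⟨a, ha1, ha2⟩ ⟨b, hb1, hb2⟩
    refine ⟨a.equiv b (Equiv.refl _), Prod.ext (Subtype.ext (funext fun i => ?_))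
      (Subtype.ext (funext fun i => ?_))⟩
    · change (x.1.1 i).map _ = _
      rw [← ha1, ← hb1, a.map_equiv_coloredSpan b]
    · change (x.2.1 i).map _ = _
      rw [← ha2, ← hb2, a.map_equiv_coloredSpan b]
  choose P hP using hR1
  have hmargin : ∀ x, (∀ i, ∑ j, P x (i, j) = α i) ∧ ∀ j, ∑ i, P x (i, j) = β j := by
    intro x
    obtain ⟨a, ha1, ha2⟩ := hP x
    constructor
    · refine congrFun (eq_of_forall_sum_castSucc_lt fun i => ?_)
      rw [← x.1.2.2, ← ha1, a.finrank_coloredSpan]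
      exact sum_congr rfl fun j _ => (ncard_sigma_prod_fst _ _).symm
    · refine congrFun (eq_of_forall_sum_castSucc_lt fun i => ?_)
      rw [← x.2.2.2, ← ha2, a.finrank_coloredSpan]
      exact sum_congr rfl fun j _ => (ncard_sigma_prod_snd _ _).symm
  have hinv : ∀ x y : X, (MulAction.orbitRel (V ≃ₗ[K] V) X) x y → P x = P y := by
    rintro _ y ⟨g, rfl⟩
    exact hR2 _ _ _ (hP _) (hR3 _ _ g (hP _))
  let f : MulAction.orbitRel.Quotient (V ≃ₗ[K] V) X →
      {A : Fin k × Fin l → ℕ | (∀ i, ∑ j, A (i, j) = α i) ∧ ∀ j, ∑ i, A (i, j) = β j} :=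
    Quotient.lift (fun x => ⟨P x, hmargin x⟩) fun x y h => Subtype.ext (hinv x y h)
  refine Nat.card_congr (Equiv.ofBijective f ⟨?_, ?_⟩)
  · rintro ⟨x⟩ ⟨y⟩ hxy
    have hxy : P x = P y := congrArg Subtype.val hxy
    obtain ⟨g, hg⟩ := hR4 y x (P x) (hxy ▸ hP y) (hP x)
    exact Quotient.sound ⟨g, hg⟩
  · rintro ⟨A, hA1, hA2⟩
    obtain ⟨b⟩ : Nonempty (Basis (Σ p, Fin (A p)) K V) := by
      apply exists_basis_of_card_eq_finrank
      simp [Fintype.sum_prod_type, hA1, hα]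
    let x : X := (b.partialFlag (fun x => x.1.1) fun i => (ncard_sigma_prod_fst A i).trans (hA1 i),
      b.partialFlag (fun x => x.1.2) fun i => (ncard_sigma_prod_snd A i).trans (hA2 i))
    exact ⟨Quotient.mk _ x, Subtype.ext (hR2 x _ _ (hP x) ⟨b, rfl, rfl⟩)⟩

end PartialFlags

section SupportedMatrices

open Module Finset

variable {K : Type*} [Field K] [Fintype K] {ι : Type*} [Fintype ι] [DecidableEq ι]

/-- The number of invertible matrices supported on the relation `P`. -/
noncomputable def cardInvertible (K : Type*) [Field K] {ι : Type*} [Fintype ι] [DecidableEq ι]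
    (P : ι → ι → Prop) : ℕ :=
  Nat.card {M : Matrix ι ι K // (∀ i j, ¬ P i j → M i j = 0) ∧ M.det ≠ 0}

theorem card_supported (P : ι → ι → Prop) [∀ i j, Decidable (P i j)] :
    Nat.card {M : Matrix ι ι K // ∀ i j, ¬ P i j → M i j = 0} =
      Fintype.card K ^ #{p : ι × ι | P p.1 p.2} := by
  classical
  let f : {M : Matrix ι ι K // ∀ i j, ¬ P i j → M i j = 0} ≃
      ({p : ι × ι // P p.1 p.2} → K) :=
    { toFun := fun M p => M.1 p.1.1 p.1.2
      invFun := fun v => ⟨fun i j => if h : P i j then v ⟨(i, j), h⟩ else 0,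
        fun i j h => dif_neg h⟩
      left_inv := fun M => by
        ext i j
        by_cases h : P i j
        · simp [h]
        · simp [h, M.2 i j h]
      right_inv := fun v => by
        ext ⟨p, h⟩
        simp [h] }
  rw [Nat.card_congr f, Nat.card_eq_fintype_card, Fintype.card_fun, Fintype.card_subtype]

theorem cardInvertible_le (P : ι → ι → Prop) [∀ i j, Decidable (P i j)] :
    cardInvertible K P ≤ Fintype.card K ^ #{p : ι × ι | P p.1 p.2} := by
  rw [← card_supported]
  exact Nat.card_le_card_of_injective (fun M => ⟨M.1, M.2.1⟩) fun M N h => by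
    simpa [Subtype.ext_iff] using h

theorem le_cardInvertible (P : ι → ι → Prop) [∀ i j, Decidable (P i j)] (hP : ∀ i, P i i) :
    Fintype.card K * Fintype.card K ^ #{p : ι × ι | P p.1 p.2} ≤
      Fintype.card K * cardInvertible K P +
        Fintype.card ι * Fintype.card K ^ #{p : ι × ι | P p.1 p.2} := by
  classical
  rw [← card_supported]
  let T : Finset (Matrix ι ι K) := {M | ∀ i j, ¬ P i j → M i j = 0}
  have hT : Nat.card {M : Matrix ι ι K // ∀ i j, ¬ P i j → M i j = 0} = #T := by
    rw [Nat.card_eq_fintype_card, Fintype.card_subtype]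
  have hgood : cardInvertible K P = #{M ∈ T | M.det ≠ 0} := by
    rw [cardInvertible, Nat.card_eq_fintype_card, Fintype.card_subtype, filter_filter]
  rw [hT, hgood]
  have hsplit : #T = #{M ∈ T | M.det = 0} + #{M ∈ T | M.det ≠ 0} :=
    (card_filter_add_card_filter_not _).symm
  have hshift : ∀ t : K, #{M ∈ T | (Matrix.scalar ι t - M).det = 0} = #{M ∈ T | M.det = 0} := by
    intro t
    have hmem : ∀ M ∈ T, Matrix.scalar ι t - M ∈ T := by
      intro M hM
      simp only [T, mem_filter, mem_univ, true_and] at hM ⊢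
      intro i j hij
      have : i ≠ j := fun h => hij (h ▸ hP i)
      simp [this, hM i j hij]
    refine card_bij' (fun M _ => Matrix.scalar ι t - M) (fun M _ => Matrix.scalar ι t - M)
      ?_ ?_ ?_ ?_
    · intro M hM
      rw [mem_filter] at hM ⊢
      exact ⟨hmem M hM.1, hM.2⟩
    · intro M hM
      rw [mem_filter] at hM ⊢
      exact ⟨hmem M hM.1, by rw [sub_sub_cancel]; exact hM.2⟩
    · intro M _; exact sub_sub_cancel _ _
    · intro M _; exact sub_sub_cancel _ _
  have hroots : ∀ M : Matrix ι ι K, #{t : K | (Matrix.scalar ι t - M).det = 0} ≤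
      Fintype.card ι := by
    intro M
    rw [← M.charpoly_natDegree_eq_dim]
    refine le_trans (card_le_card (t := M.charpoly.roots.toFinset) fun t ht => ?_)
      ((Multiset.toFinset_card_le _).trans (Polynomial.card_roots' _))
    rw [Multiset.mem_toFinset, Polynomial.mem_roots M.charpoly_monic.ne_zero, Polynomial.IsRoot,
      Matrix.eval_charpoly]
    exact (mem_filter.1 ht).2
  have hdouble : Fintype.card K * #{M ∈ T | M.det = 0} ≤ Fintype.card ι * #T := by
    calc Fintype.card K * #{M ∈ T | M.det = 0}
        = ∑ t : K, #{M ∈ T | (Matrix.scalar ι t - M).det = 0} := by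
          simp only [hshift, sum_const, card_univ, smul_eq_mul]
      _ = ∑ M ∈ T, #{t : K | (Matrix.scalar ι t - M).det = 0} := by
          simp only [card_filter]
          exact sum_comm
      _ ≤ ∑ M ∈ T, Fintype.card ι := sum_le_sum fun M _ => hroots M
      _ = Fintype.card ι * #T := by simp [mul_comm]
  calc Fintype.card K * #T = Fintype.card K * #{M ∈ T | M.det = 0} +
        Fintype.card K * #{M ∈ T | M.det ≠ 0} := by rw [← mul_add, ← hsplit]
    _ ≤ _ := by rw [add_comm]; exact Nat.add_le_add_left hdouble _

end SupportedMatrices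

section CardPartialFlag

open Module Finset

variable {K V : Type*} [Field K] [AddCommGroup V] [Module K V]

theorem card_supported_linearEquiv {κ : Type*} [Fintype κ] [DecidableEq κ] (b : Basis κ K V)
    (P : κ → κ → Prop) :
    Nat.card {g : V ≃ₗ[K] V // ∀ i j, ¬ P i j → LinearMap.toMatrix b b (g : V →ₗ[K] V) i j = 0} =
      cardInvertible K P := by
  refine Nat.card_congr (Equiv.ofBijective (fun g => ⟨LinearMap.toMatrix b b (g.1 : V →ₗ[K] V),
    g.2, ?_⟩) ⟨?_, ?_⟩)
  · exact (LinearEquiv.isUnit_det g.1 b b).ne_zero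
  · intro g h hgh
    have := congrArg Subtype.val hgh
    exact Subtype.ext (LinearEquiv.toLinearMap_injective ((LinearMap.toMatrix b b).injective this))
  · rintro ⟨M, hM, hdet⟩
    have h : LinearMap.toMatrix b b (Matrix.toLinearEquiv b M (Ne.isUnit hdet) : V →ₗ[K] V) = M := by
      exact LinearMap.toMatrix_toLin b b M
    exact ⟨⟨Matrix.toLinearEquiv b M (Ne.isUnit hdet), fun i j => by rw [h]; exact hM i j⟩,
      Subtype.ext h⟩

/-- The degree of the number of partial flags of type `α` as a polynomial in `q`. -/
def flagDim {k : ℕ} (α : Fin k → ℕ) : ℕ := ∑ p : Fin k × Fin k with p.1 < p.2, α p.1 * α p.2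

theorem two_mul_flagDim_add {k : ℕ} (α : Fin k → ℕ) :
    2 * flagDim α + ∑ i, α i ^ 2 = (∑ i, α i) ^ 2 := by
  have h1 : (∑ i, α i) ^ 2 = ∑ p : Fin k × Fin k, α p.1 * α p.2 := by
    rw [sq, sum_mul_sum, Fintype.sum_prod_type]
  have h2 : flagDim α = ∑ p : Fin k × Fin k with p.2 < p.1, α p.1 * α p.2 := by
    refine sum_equiv (Equiv.prodComm _ _) (by simp) fun p _ => mul_comm _ _
  have h3 : ∑ i, α i ^ 2 = ∑ p : Fin k × Fin k with p.1 = p.2, α p.1 * α p.2 := by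
    rw [sum_filter, Fintype.sum_prod_type]
    simp [sq]
  rw [h1, h3, two_mul]
  nth_rewrite 2 [h2]
  rw [flagDim, sum_filter, sum_filter, sum_filter, ← sum_add_distrib, ← sum_add_distrib]
  refine sum_congr rfl fun p _ => ?_
  rcases lt_trichotomy p.1 p.2 with h | h | h
  · simp [h, h.ne, h.not_gt]
  · simp [h]
  · simp [h, h.ne', h.not_gt]

theorem card_le_add_flagDim {k : ℕ} (α : Fin k → ℕ) :
    #{p : (Σ i, Fin (α i)) × (Σ i, Fin (α i)) | p.1.1 ≤ p.2.1} + flagDim α = (∑ i, α i) ^ 2 := by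
  have h : #{p : (Σ i, Fin (α i)) × (Σ i, Fin (α i)) | ¬ p.1.1 ≤ p.2.1} = flagDim α := by
    rw [card_filter, Fintype.sum_prod_type, sum_comm]
    simp only [Fintype.sum_sigma, not_le]
    rw [flagDim, sum_filter, Fintype.sum_prod_type]
    refine sum_congr rfl fun i _ => ?_
    refine (sum_congr rfl fun x _ => sum_congr rfl fun j _ =>
      (?_ : _ = if i < j then α j else 0)).trans ?_
    · split_ifs <;> simp [*]
    · rw [sum_const, card_univ, Fintype.card_fin, smul_eq_mul, mul_sum]
      exact sum_congr rfl fun j _ => by simp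
  rw [← h, card_filter_add_card_filter_not]
  simp [sq]

theorem PartialFlag.exists_smul_eq [FiniteDimensional K V] {k : ℕ} {α : Fin k → ℕ}
    (hα : ∑ i, α i = finrank K V) (F E : PartialFlag K V α) : ∃ g : V ≃ₗ[K] V, g • F = E := by
  classical
  let T : Fin (1 + 1) → Submodule K V := fun i => if i = 0 then ⊥ else ⊤
  have hT : Monotone T := by
    intro i j hij
    fin_cases i <;> fin_cases j <;> simp_all [T]
  obtain ⟨A, a, ha, -⟩ := exists_basis_coloredSpan_eq F.2.1 hT F.val_zero rfl
    (F.val_last hα) rfl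
  obtain ⟨B, b, hb, -⟩ := exists_basis_coloredSpan_eq E.2.1 hT E.val_zero rfl
    (E.val_last hα) rfl
  have hA : ∀ i, ∑ j, A (i, j) = α i := by
    refine congrFun (eq_of_forall_sum_castSucc_lt fun i => ?_)
    rw [← F.2.2, ← ha, a.finrank_coloredSpan]
    exact sum_congr rfl fun j _ => (ncard_sigma_prod_fst _ _).symm
  have hB : ∀ i, ∑ j, B (i, j) = α i := by
    refine congrFun (eq_of_forall_sum_castSucc_lt fun i => ?_)
    rw [← E.2.2, ← hb, b.finrank_coloredSpan]
    exact sum_congr rfl fun j _ => (ncard_sigma_prod_fst _ _).symm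
  obtain rfl : A = B := by
    ext ⟨i, j⟩
    rw [Subsingleton.elim j 0]
    simpa using (hA i).trans (hB i).symm
  refine ⟨a.equiv b (Equiv.refl _), Subtype.ext (funext fun i => ?_)⟩
  rw [smul_val, ← ha, ← hb, a.map_equiv_coloredSpan b]

theorem mem_stabilizer_partialFlag_iff [FiniteDimensional K V] {κ : Type*} [Fintype κ]
    [DecidableEq κ] {k : ℕ} (b : Basis κ K V) (c : κ → Fin k) {α : Fin k → ℕ}
    (h : ∀ j, {x | c x = j}.ncard = α j) (g : V ≃ₗ[K] V) :
    g ∈ MulAction.stabilizer (V ≃ₗ[K] V) (b.partialFlag c h) ↔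
      ∀ i j, ¬ c i ≤ c j → LinearMap.toMatrix b b (g : V →ₗ[K] V) i j = 0 := by
  rw [MulAction.mem_stabilizer_iff]
  constructor
  · intro hg i j hij
    have h1 : (b.coloredSpan c (c j).succ).map (g : V →ₗ[K] V) = b.coloredSpan c (c j).succ :=
      congrFun (congrArg Subtype.val hg) (c j).succ
    have h2 : g (b j) ∈ b.coloredSpan c (c j).succ := by
      rw [← h1]
      exact Submodule.mem_map_of_mem (Submodule.subset_span ⟨j, Fin.castSucc_lt_succ, rfl⟩)
    rw [Basis.coloredSpan, Basis.mem_span_image] at h2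
    rw [LinearMap.toMatrix_apply]
    by_contra h3
    have h4 := h2 (Finsupp.mem_support_iff.2 h3)
    exact hij (Fin.castSucc_lt_succ_iff.1 h4)
  · intro hg
    refine Subtype.ext (funext fun i => ?_)
    change (b.coloredSpan c i).map (g : V →ₗ[K] V) = b.coloredSpan c i
    refine Submodule.eq_of_le_of_finrank_eq ?_ (LinearEquiv.finrank_map_eq g _)
    rw [Basis.coloredSpan, Submodule.map_span, Submodule.span_le]
    rintro _ ⟨_, ⟨x, hx, rfl⟩, rfl⟩
    rw [SetLike.mem_coe, Basis.mem_span_image]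
    intro y hy
    by_contra hyi
    refine Finsupp.mem_support_iff.1 hy ?_
    have := hg y x fun hyx => hyi (lt_of_le_of_lt (Fin.castSucc_le_castSucc_iff.2 hyx) hx)
    rwa [LinearMap.toMatrix_apply] at this

theorem card_partialFlag_mul [FiniteDimensional K V] {k : ℕ} {α : Fin k → ℕ}
    (hα : ∑ i, α i = finrank K V) :
    Nat.card (PartialFlag K V α) *
        cardInvertible K (fun x y : (Σ i, Fin (α i)) => x.1 ≤ y.1) =
      cardInvertible K (fun _ _ : (Σ i, Fin (α i)) => True) := by
  classical
  obtain ⟨b⟩ : Nonempty (Basis (Σ i, Fin (α i)) K V) := by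
    apply exists_basis_of_card_eq_finrank
    simp [hα]
  have hc : ∀ j, {x : (Σ i, Fin (α i)) | x.1 = j}.ncard = α j := fun j => by
    refine (ncard_sigma_fst α {j}).trans ?_
    rw [sum_filter]
    simp
  let F : PartialFlag K V α := b.partialFlag Sigma.fst hc
  have hpre : MulAction.IsPretransitive (V ≃ₗ[K] V) (PartialFlag K V α) :=
    ⟨PartialFlag.exists_smul_eq hα⟩
  have h1 : Nat.card (MulAction.stabilizer (V ≃ₗ[K] V) F) =
      cardInvertible K (fun x y : (Σ i, Fin (α i)) => x.1 ≤ y.1) := by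
    rw [← card_supported_linearEquiv b]
    exact Nat.card_congr (Equiv.subtypeEquivRight fun g => mem_stabilizer_partialFlag_iff b _ hc g)
  have h2 : Nat.card (V ≃ₗ[K] V) =
      cardInvertible K (fun _ _ : (Σ i, Fin (α i)) => True) := by
    rw [← card_supported_linearEquiv b]
    exact Nat.card_congr (Equiv.subtypeUnivEquiv fun g => by simp).symm
  rw [← h1, ← h2, ← MulAction.index_stabilizer_of_transitive (V ≃ₗ[K] V) F, mul_comm,
    Subgroup.card_mul_index]

theorem card_partialFlag_bounds [Fintype K] [FiniteDimensional K V] {k : ℕ} {α : Fin k → ℕ}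
    (hα : ∑ i, α i = finrank K V) :
    (1 - (finrank K V : ℝ) / Fintype.card K) * (Fintype.card K : ℝ) ^ flagDim α ≤
        Nat.card (PartialFlag K V α) ∧
      (1 - (finrank K V : ℝ) / Fintype.card K) * Nat.card (PartialFlag K V α) ≤
        (Fintype.card K : ℝ) ^ flagDim α := by
  classical
  have hmul := card_partialFlag_mul (K := K) (V := V) hα
  have hdim := card_le_add_flagDim α
  have hS1 := cardInvertible_le (K := K) (fun x y : (Σ i, Fin (α i)) => x.1 ≤ y.1)
  have hS2 := le_cardInvertible (K := K) (fun x y : (Σ i, Fin (α i)) => x.1 ≤ y.1) fun _ => le_rfl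
  have hG1 := cardInvertible_le (K := K) (fun _ _ : (Σ i, Fin (α i)) => True)
  have hG2 := le_cardInvertible (K := K) (fun _ _ : (Σ i, Fin (α i)) => True) fun _ => trivial
  have hn : Fintype.card (Σ i, Fin (α i)) = finrank K V := by simp [hα]
  have hT : #{p : (Σ i, Fin (α i)) × (Σ i, Fin (α i)) | True} = (∑ i, α i) ^ 2 := by
    simp [sq]
  rw [hT, ← hdim, hn] at hG2
  rw [hT, ← hdim] at hG1
  rw [hn] at hS2
  have hq : (0 : ℝ) < Fintype.card K := by exact_mod_cast Fintype.card_pos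
  generalize #{p : (Σ i, Fin (α i)) × (Σ i, Fin (α i)) | p.1.1 ≤ p.2.1} = s at *
  generalize cardInvertible K (fun x y : (Σ i, Fin (α i)) => x.1 ≤ y.1) = cS at *
  generalize cardInvertible K (fun _ _ : (Σ i, Fin (α i)) => True) = cG at *
  generalize Nat.card (PartialFlag K V α) = X at *
  generalize Fintype.card K = q at *
  generalize finrank K V = n at *
  have hmul' : (X : ℝ) * cS = cG := by exact_mod_cast hmul
  have hS1' : (cS : ℝ) ≤ (q : ℝ) ^ s := by exact_mod_cast hS1
  have hS2' : (q : ℝ) * q ^ s ≤ q * cS + n * q ^ s := by exact_mod_cast hS2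
  have hG1' : (cG : ℝ) ≤ (q : ℝ) ^ s * q ^ flagDim α := by
    rw [← pow_add]; exact_mod_cast hG1
  have hG2' : (q : ℝ) * (q ^ s * q ^ flagDim α) ≤ q * cG + n * (q ^ s * q ^ flagDim α) := by
    rw [← pow_add]; exact_mod_cast hG2
  have hs : (0 : ℝ) < (q : ℝ) ^ s := by positivity
  have hX : (0 : ℝ) ≤ X := Nat.cast_nonneg _
  have hS3 : (1 - (n : ℝ) / q) * q ^ s ≤ cS := by
    rw [one_sub_div hq.ne', div_mul_eq_mul_div, div_le_iff₀ hq]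
    linarith
  have hG3 : (1 - (n : ℝ) / q) * (q ^ s * q ^ flagDim α) ≤ cG := by
    rw [one_sub_div hq.ne', div_mul_eq_mul_div, div_le_iff₀ hq]
    linarith
  constructor
  · refine le_of_mul_le_mul_right ?_ hs
    have := mul_le_mul_of_nonneg_left hS1' hX
    nlinarith
  · refine le_of_mul_le_mul_right ?_ hs
    have := mul_le_mul_of_nonneg_left hS3 hX
    nlinarith

end CardPartialFlag

section FixedFlags

open Module Finset

variable {K : Type*} [Field K] {m : ℕ} {U : Fin m → Type*} [∀ i, AddCommGroup (U i)]
  [∀ i, Module K (U i)]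

theorem single_mem_of_forall_smul_mem {μ : Fin m → K} (hμ : Function.Injective μ)
    {S : Submodule K (∀ i, U i)} (hS : ∀ x ∈ S, (fun i => μ i • x i) ∈ S) {x : ∀ i, U i}
    (hx : x ∈ S) (i : Fin m) : Pi.single i (x i) ∈ S := by
  have key : ∀ p : Polynomial K, (fun i => p.eval (μ i) • x i) ∈ S := by
    intro p
    induction p using Polynomial.induction_on with
    | C a => simp only [Polynomial.eval_C]; exact S.smul_mem a hx
    | add p q hp hq => simp only [Polynomial.eval_add, add_smul]; exact S.add_mem hp hq
    | monomial n a h =>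
      convert hS _ h using 2 with i
      simp only [Polynomial.eval_mul, Polynomial.eval_C, Polynomial.eval_pow, Polynomial.eval_X,
        smul_smul]
      ring_nf
  convert key (Lagrange.basis univ μ i) using 1
  ext j
  by_cases h : j = i
  · subst h
    simp [Lagrange.eval_basis_self (hμ.injOn (s := (univ : Finset (Fin m)))) (mem_univ j)]
  · rw [Lagrange.eval_basis_of_ne (Ne.symm h) (mem_univ _), zero_smul, Pi.single_eq_of_ne h]

theorem eq_pi_map_proj {μ : Fin m → K} (hμ : Function.Injective μ)
    {S : Submodule K (∀ i, U i)} (hS : ∀ x ∈ S, (fun i => μ i • x i) ∈ S) :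
    S = Submodule.pi Set.univ fun i => S.map (LinearMap.proj i) := by
  ext x
  rw [Submodule.mem_pi]
  refine ⟨fun hx i _ => ⟨x, hx, rfl⟩, fun h => ?_⟩
  rw [← Finset.univ_sum_single x]
  refine S.sum_mem fun i _ => ?_
  obtain ⟨y, hy, hyx⟩ := h i trivial
  rw [← hyx]
  exact single_mem_of_forall_smul_mem hμ hS hy i

/-- A product of submodules is linearly equivalent to the product of the underlying modules. -/
def Submodule.piUnivEquiv (p : ∀ i, Submodule K (U i)) :
    Submodule.pi Set.univ p ≃ₗ[K] ∀ i, p i where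
  toFun x i := ⟨x.1 i, x.2 i trivial⟩
  invFun y := ⟨fun i => y i, fun i _ => (y i).2⟩
  map_add' _ _ := rfl
  map_smul' _ _ := rfl
  left_inv _ := rfl
  right_inv _ := rfl

theorem Submodule.finrank_pi_univ [∀ i, FiniteDimensional K (U i)] (p : ∀ i, Submodule K (U i)) :
    finrank K (Submodule.pi Set.univ p) = ∑ i, finrank K (p i) := by
  rw [(Submodule.piUnivEquiv p).finrank_eq, finrank_pi_fintype]

theorem Submodule.map_proj_pi_univ (p : ∀ i, Submodule K (U i)) (i : Fin m) :
    (Submodule.pi Set.univ p).map (LinearMap.proj i) = p i := by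
  ext y
  constructor
  · rintro ⟨x, hx, rfl⟩
    exact hx i trivial
  · intro hy
    refine ⟨Pi.single i y, ?_, by simp⟩
    intro j _
    by_cases h : j = i
    · subst h; simpa using hy
    · rw [Pi.single_eq_of_ne h]; exact zero_mem _

theorem map_pi_univ {μ : Fin m → Kˣ} {g : (∀ i, U i) ≃ₗ[K] ∀ i, U i}
    (hg : ∀ x i, g x i = (μ i : K) • x i) (p : ∀ i, Submodule K (U i)) :
    (Submodule.pi Set.univ p).map (g : (∀ i, U i) →ₗ[K] ∀ i, U i) = Submodule.pi Set.univ p := by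
  ext x
  simp only [Submodule.mem_map_equiv, Submodule.mem_pi]
  have : ∀ i, x i = (μ i : K) • g.symm x i := fun i => by rw [← hg, g.apply_symm_apply]
  refine forall₂_congr fun i _ => ?_
  rw [this i]
  exact (Submodule.smul_mem_iff _ (μ i).ne_zero).symm

variable [∀ i, Finite (U i)]

theorem prod_card_partialFlag_le_card_fixedBy {μ : Fin m → Kˣ}
    {g : (∀ i, U i) ≃ₗ[K] ∀ i, U i} (hg : ∀ x i, g x i = (μ i : K) • x i) {k : ℕ}
    (a : Fin m → Fin k → ℕ) {α : Fin k → ℕ} (h : ∀ j, ∑ i, a i j = α j) :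
    ∏ i, Nat.card (PartialFlag K (U i) (a i)) ≤
      Nat.card (MulAction.fixedBy (PartialFlag K (∀ i, U i) α) g) := by
  have : Finite (PartialFlag K (∀ i, U i) α) := Subtype.finite
  rw [← Nat.card_pi]
  refine Nat.card_le_card_of_injective (fun F => ⟨⟨fun j => Submodule.pi Set.univ fun i => (F i).1 j,
    fun j l hjl => Submodule.pi_mono fun i _ => (F i).2.1 hjl, fun j => ?_⟩, ?_⟩) ?_
  · rw [Submodule.finrank_pi_univ]
    simp_rw [(F _).2.2 j]
    rw [sum_comm]
    exact sum_congr rfl fun l _ => h l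
  · exact Subtype.ext <| funext fun j => map_pi_univ hg _
  · intro F F' hF
    funext i
    refine Subtype.ext <| funext fun j => ?_
    have := congrArg (fun S => S.map (LinearMap.proj i)) (congrFun (congrArg (fun z => z.1.1) hF) j)
    simpa [Submodule.map_proj_pi_univ] using this

theorem exists_eq_sum_castSucc_lt {k : ℕ} {f : Fin (k + 1) → ℕ} (hf : Monotone f) (h0 : f 0 = 0) :
    ∃ a : Fin k → ℕ, ∀ i, f i = ∑ j with j.castSucc < i, a j := by
  refine ⟨fun j => f j.succ - f j.castSucc, fun i => ?_⟩
  induction i using Fin.induction with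
  | zero => simp [h0]
  | succ i ih =>
    rw [sum_castSucc_lt_succ, ← ih, Nat.add_sub_cancel' (hf (Fin.castSucc_le_succ i))]

theorem card_fixedBy_le {μ : Fin m → Kˣ} (hμ : Function.Injective μ)
    {g : (∀ i, U i) ≃ₗ[K] ∀ i, U i} (hg : ∀ x i, g x i = (μ i : K) • x i) {k : ℕ}
    {α : Fin k → ℕ} (hα : ∑ j, α j = finrank K (∀ i, U i)) (B : Finset (Fin m → Fin k → ℕ))
    (hB : ∀ b, (∀ i, ∑ j, b i j = finrank K (U i)) → (∀ j, ∑ i, b i j = α j) → b ∈ B) :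
    Nat.card (MulAction.fixedBy (PartialFlag K (∀ i, U i) α) g) ≤
      ∑ b ∈ B, ∏ i, Nat.card (PartialFlag K (U i) (b i)) := by
  have hfin : ∀ i (c : Fin k → ℕ), Finite (PartialFlag K (U i) c) := fun i c => Subtype.finite
  have hμ' : Function.Injective fun i => (μ i : K) := Units.val_injective.comp hμ
  have hpi : ∀ F : MulAction.fixedBy (PartialFlag K (∀ i, U i) α) g, ∀ j,
      F.1.1 j = Submodule.pi Set.univ fun i => (F.1.1 j).map (LinearMap.proj i) := by
    intro F j
    refine eq_pi_map_proj hμ' fun x hx => ?_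
    have h1 : (F.1.1 j).map (g : (∀ i, U i) →ₗ[K] ∀ i, U i) = F.1.1 j :=
      congrFun (congrArg Subtype.val F.2) j
    rw [← h1]
    exact ⟨x, hx, funext fun i => hg x i⟩
  have hex : ∀ F : MulAction.fixedBy (PartialFlag K (∀ i, U i) α) g, ∃ b : Fin m → Fin k → ℕ,
      ∀ i j, finrank K ((F.1.1 j).map (LinearMap.proj i : _ →ₗ[K] U i)) =
        ∑ l with l.castSucc < j, b i l := by
    intro F
    have : ∀ i, ∃ c : Fin k → ℕ,
      ∀ j, finrank K ((F.1.1 j).map (LinearMap.proj i : _ →ₗ[K] U i)) =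
        ∑ l with l.castSucc < j, c l := by
      intro i
      refine exists_eq_sum_castSucc_lt (fun j l hjl => ?_) ?_
      · exact Submodule.finrank_mono (Submodule.map_mono (F.1.2.1 hjl))
      · rw [F.1.val_zero, Submodule.map_bot, finrank_bot]
    choose b hb using this
    exact ⟨b, hb⟩
  choose b hb using hex
  have hbB : ∀ F, b F ∈ B := by
    intro F
    refine hB _ (fun i => ?_) (congrFun <| eq_of_forall_sum_castSucc_lt fun j => ?_)
    · rw [← sum_castSucc_lt_last, ← hb, F.1.val_last hα, Submodule.map_top, LinearMap.range_eq_top.2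
        (LinearMap.proj_surjective i), finrank_top]
    · rw [← F.1.2.2 j, hpi F j, Submodule.finrank_pi_univ, sum_comm]
      exact sum_congr rfl fun i _ => (hb F i j).symm
  have hcard : ∑ b ∈ B, ∏ i, Nat.card (PartialFlag K (U i) (b i)) =
      Nat.card ((b : B) × ∀ i, PartialFlag K (U i) (b.1 i)) := by
    rw [Nat.card_sigma, ← Finset.sum_coe_sort]
    simp_rw [Nat.card_pi]
  rw [hcard]
  refine Nat.card_le_card_of_injective (fun F => ⟨⟨b F, hbB F⟩, fun i =>
    ⟨fun j => (F.1.1 j).map (LinearMap.proj i), fun j l hjl => Submodule.map_mono (F.1.2.1 hjl),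
      hb F i⟩⟩) ?_
  refine Function.Injective.of_comp (f := fun s : (b : B) × ∀ i, PartialFlag K (U i) (b.1 i) =>
    fun j i => (s.2 i).1 j) fun F F' h => ?_
  refine Subtype.ext <| Subtype.ext <| funext fun j => ?_
  rw [hpi F j, hpi F' j]
  exact congrArg _ (congrFun h j)

end FixedFlags

section OptimalRows

open Finset

theorem flagDim_pos_iff {k : ℕ} {α : Fin k → ℕ} :
    0 < flagDim α ↔ ∃ p q, p < q ∧ 0 < α p ∧ 0 < α q := by
  rw [flagDim, sum_pos_iff]
  simp only [mem_filter, mem_univ, true_and, Prod.exists, CanonicallyOrderedAdd.mul_pos]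

theorem sum_flagDim_le_flagDim_sum {m k : ℕ} (b : Fin m → Fin k → ℕ) :
    ∑ i, flagDim (b i) ≤ flagDim fun j => ∑ i, b i j := by
  simp only [flagDim]
  rw [sum_comm]
  refine sum_le_sum fun p _ => ?_
  rw [sum_mul]
  exact sum_le_sum fun i _ => Nat.mul_le_mul_left _
    (single_le_sum (f := fun i => b i p.2) (fun _ _ => Nat.zero_le _) (mem_univ i))

theorem two_mul_flagDim_cast {k : ℕ} (α : Fin k → ℕ) :
    (2 * flagDim α : ℝ) = (∑ i, (α i : ℝ)) ^ 2 - ∑ i, (α i : ℝ) ^ 2 := by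
  rw [eq_sub_iff_add_eq]
  exact_mod_cast two_mul_flagDim_add α

/-- The ratios defining `betaGL` are ratios of dimensions of partial flag varieties. -/
theorem ratio_eq {m n : ℕ} {ν : Fin m → ℕ} (b : Fin m → Fin n → ℕ) (hb : ∀ i, ∑ j, b i j = ν i)
    (a : Fin m → ℕ → ℕ) (h : ∀ i j, a i (Fin.rev j : Fin n) = b i j) :
    (∑ i, ((ν i : ℝ) ^ 2 - ∑ j ∈ range n, (a i j : ℝ) ^ 2)) /
        ((∑ i, (ν i : ℝ)) ^ 2 - ∑ j ∈ range n, (∑ i, (a i j : ℝ)) ^ 2) =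
      ((∑ i, flagDim (b i) : ℕ) : ℝ) / (flagDim fun j => ∑ i, b i j : ℕ) := by
  have hrev : ∀ f : ℕ → ℝ, ∑ j ∈ range n, f j = ∑ j : Fin n, f (Fin.rev j : Fin n) := by
    intro f
    rw [← Fin.sum_univ_eq_sum_range]
    exact (Equiv.sum_comp Fin.revPerm (fun j : Fin n => f j)).symm
  rw [← mul_div_mul_left ((∑ i, flagDim (b i) : ℕ) : ℝ) _ (two_ne_zero' ℝ), two_mul_flagDim_cast,
    Nat.cast_sum, mul_sum]
  congr 1
  · refine sum_congr rfl fun i _ => ?_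
    rw [two_mul_flagDim_cast, hrev, ← Nat.cast_sum, hb]
    simp_rw [h]
  · rw [hrev]
    simp_rw [h, ← hb]
    push_cast
    rw [sum_comm]

theorem mem_betaRatioSet {m n : ℕ} {ν : Fin m → ℕ} (hn : ∑ i, ν i = n) (h2 : 2 ≤ n) {r : ℝ} :
    r ∈ betaRatioSet m ν ↔ ∃ b : Fin m → Fin n → ℕ, (∀ i, ∑ j, b i j = ν i) ∧
      (∀ i, Monotone (b i)) ∧ 0 < ∑ i, flagDim (b i) ∧
      r = ((∑ i, flagDim (b i) : ℕ) : ℝ) / (flagDim fun j => ∑ i, b i j : ℕ) := by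
  have hrev : ∀ f : ℕ → ℕ, ∑ j ∈ range n, f j = ∑ j : Fin n, f (Fin.rev j : Fin n) := by
    intro f
    rw [← Fin.sum_univ_eq_sum_range]
    exact (Equiv.sum_comp Fin.revPerm (fun j : Fin n => f j)).symm
  rw [betaRatioSet, Set.mem_ofPred_eq, hn]
  constructor
  · rintro ⟨a, ha, hanti, ⟨i, hi⟩, rfl⟩
    have hanti' : ∀ i, Antitone (a i) := fun i => antitone_nat_of_succ_le (hanti i)
    have hb : ∀ i, ∑ j : Fin n, a i (Fin.rev j : Fin n) = ν i := fun i => by rw [← ha, hrev]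
    refine ⟨fun i j => a i (Fin.rev j : Fin n), hb, fun i j l hjl => hanti' i ?_, ?_,
      ratio_eq _ hb _ fun _ _ => rfl⟩
    · exact Fin.rev_le_rev.2 hjl
    · refine sum_pos_iff.2 ⟨i, mem_univ i, flagDim_pos_iff.2
        ⟨Fin.rev ⟨1, h2⟩, Fin.rev ⟨0, by omega⟩, ?_, ?_, ?_⟩⟩
      · rw [Fin.rev_lt_rev]; simp [Fin.lt_def]
      · simpa only [Fin.rev_rev] using hi
      · simpa only [Fin.rev_rev] using hi.trans_le (hanti' i (Nat.zero_le 1))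
  · rintro ⟨b, hb, hmono, hpos, rfl⟩
    obtain ⟨i, -, hi⟩ := sum_pos_iff.1 hpos
    obtain ⟨p, q, hpq, hp, hq⟩ := flagDim_pos_iff.1 hi
    let a : Fin m → ℕ → ℕ := fun i j => if h : j < n then b i (Fin.rev ⟨j, h⟩) else 0
    have hab : ∀ i j, a i (Fin.rev j : Fin n) = b i j := fun i j => by
      simp only [a, dif_pos (Fin.rev j).is_lt, Fin.eta, Fin.rev_rev]
    refine ⟨a, fun i => ?_, fun i j => ?_, ⟨i, ?_⟩, (ratio_eq b hb a hab).symm⟩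
    · rw [hrev, ← hb]
      exact sum_congr rfl fun j _ => hab i j
    · simp only [a]
      split_ifs with h1 h2 h2
      · exact hmono i (Fin.rev_le_rev.2 (by simp [Fin.le_def]))
      · omega
      · exact Nat.zero_le _
      · exact le_rfl
    · simp only [a, dif_pos (show 1 < n from h2)]
      refine hp.trans_le (hmono i ?_)
      rw [Fin.le_def, Fin.val_rev]
      have := Fin.lt_def.1 hpq
      have := q.is_lt
      simp only
      omega

theorem betaRatioSet_nonempty {m : ℕ} {ν : Fin m → ℕ} {i : Fin m} (hi : 2 ≤ ν i) :
    (betaRatioSet m ν).Nonempty := by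
  have h2 : 2 ≤ ∑ i, ν i := hi.trans (single_le_sum (fun _ _ => Nat.zero_le _) (mem_univ i))
  refine ⟨_, fun i j => if j = 0 then ν i - ν i / 2 else if j = 1 then ν i / 2 else 0,
    fun i => ?_, fun i j => ?_, ⟨i, ?_⟩, rfl⟩
  · obtain ⟨k, hk⟩ := Nat.exists_eq_add_of_le' h2
    rw [hk, sum_range_succ', sum_range_succ']
    simp
    omega
  · rcases j with _ | _ | j <;> simp
    omega
  · simp
    omega

theorem betaRatioSet_finite {m n : ℕ} {ν : Fin m → ℕ} (hn : ∑ i, ν i = n) (h2 : 2 ≤ n) :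
    (betaRatioSet m ν).Finite := by
  refine ((Set.finite_Icc (0 : Fin m → Fin n → ℕ) fun i _ => ν i).image fun b =>
    ((∑ i, flagDim (b i) : ℕ) : ℝ) / (flagDim fun j => ∑ i, b i j : ℕ)).subset fun r hr => ?_
  obtain ⟨b, hb, -, -, rfl⟩ := (mem_betaRatioSet hn h2).1 hr
  refine ⟨b, ⟨fun _ _ => Nat.zero_le _, fun i j => ?_⟩, rfl⟩
  refine le_of_le_of_eq ?_ (hb i)
  exact single_le_sum (f := fun j => b i j) (fun _ _ => Nat.zero_le _) (mem_univ j)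

theorem flagDim_comp_perm {k : ℕ} (α : Fin k → ℕ) (σ : Equiv.Perm (Fin k)) :
    flagDim (α ∘ σ) = flagDim α := by
  have h1 := two_mul_flagDim_add (α ∘ σ)
  have h2 := two_mul_flagDim_add α
  simp only [Function.comp_apply] at h1
  rw [Equiv.sum_comp σ α, Equiv.sum_comp σ fun i => α i ^ 2] at h1
  omega

theorem flagDim_sum_le_of_monotone {m k : ℕ} (b : Fin m → Fin k → ℕ)
    (σ : Fin m → Equiv.Perm (Fin k)) (hσ : ∀ i, Monotone (b i ∘ σ i)) :
    flagDim (fun j => ∑ i, b i (σ i j)) ≤ flagDim fun j => ∑ i, b i j := by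
  have h1 := two_mul_flagDim_add fun j => ∑ i, b i (σ i j)
  have h2 := two_mul_flagDim_add fun j => ∑ i, b i j
  have h3 : ∑ j, ∑ i, b i (σ i j) = ∑ j, ∑ i, b i j := by
    rw [sum_comm, sum_comm (f := fun j i => b i j)]
    exact sum_congr rfl fun i _ => Equiv.sum_comp (σ i) (b i)
  have h4 : ∑ j, (∑ i, b i j) ^ 2 ≤ ∑ j, (∑ i, b i (σ i j)) ^ 2 := by
    simp_rw [sq, sum_mul_sum]
    rw [sum_comm, sum_comm (s := univ (α := Fin k))]
    refine sum_le_sum fun i _ => ?_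
    rw [sum_comm, sum_comm (s := univ (α := Fin k))]
    refine sum_le_sum fun l _ => ?_
    have hm : Monovary (b i ∘ σ i) (b l ∘ σ l) := (hσ i).monovary (hσ l)
    have := hm.sum_comp_perm_mul_le_sum_mul (σ := (σ l).trans (σ i).symm)
    rw [← Equiv.sum_comp (σ l) fun j => b i j * b l j]
    simpa using this
  rw [h3] at h1
  omega

/-- A matrix of non-negative integers with the given row sums attaining `betaGL`, together with
the extremality it enjoys. -/
theorem exists_optimal_rows {m n : ℕ} {ν : Fin m → ℕ} (hn : ∑ i, ν i = n) (h2 : 2 ≤ n)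
    (hν : ¬ ∀ i, ν i ≤ 1) :
    ∃ a : Fin m → Fin n → ℕ, (∀ i, ∑ j, a i j = ν i) ∧ (∀ i, Monotone (a i)) ∧
      0 ≤ betaGL m ν ∧ betaGL m ν ≤ 1 ∧
      betaGL m ν * (flagDim fun j => ∑ i, a i j : ℕ) = (∑ i, flagDim (a i) : ℕ) ∧
      ∀ b : Fin m → Fin n → ℕ, (∀ i, ∑ j, b i j = ν i) →
        (flagDim fun j => ∑ i, b i j) < (flagDim fun j => ∑ i, a i j) →
        ∑ i, flagDim (b i) < ∑ i, flagDim (a i) := by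
  have hfin := betaRatioSet_finite hn h2
  have hne : (betaRatioSet m ν).Nonempty := by
    push Not at hν
    obtain ⟨i, hi⟩ := hν
    exact betaRatioSet_nonempty hi
  have hβ : betaGL m ν = sSup (betaRatioSet m ν) := if_neg hν
  obtain ⟨a, ha, hmono, hpos, har⟩ := (mem_betaRatioSet hn h2).1 (hne.csSup_mem hfin)
  rw [← hβ] at har
  have hle := sum_flagDim_le_flagDim_sum a
  have hN : (0 : ℝ) < (∑ i, flagDim (a i) : ℕ) := by exact_mod_cast hpos
  have hD : (0 : ℝ) < (flagDim fun j => ∑ i, a i j : ℕ) := by exact_mod_cast hpos.trans_le hle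
  have hβpos : 0 < betaGL m ν := by rw [har]; positivity
  have hmul : betaGL m ν * (flagDim fun j => ∑ i, a i j : ℕ) = (∑ i, flagDim (a i) : ℕ) := by
    rw [har, div_mul_cancel₀ _ hD.ne']
  refine ⟨a, ha, hmono, hβpos.le, ?_, hmul, fun b hb hlt => ?_⟩
  · rw [har, div_le_one hD]
    exact_mod_cast hle
  · rcases Nat.eq_zero_or_pos (∑ i, flagDim (b i)) with h0 | h0
    · rwa [h0]
    let σ : Fin m → Equiv.Perm (Fin n) := fun i => Tuple.sort (b i)
    have hσ : ∀ i, Monotone (b i ∘ σ i) := fun i => Tuple.monotone_sort (b i)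
    have hsum : ∑ i, flagDim (b i ∘ σ i) = ∑ i, flagDim (b i) :=
      sum_congr rfl fun i _ => flagDim_comp_perm _ _
    have hmem : ((∑ i, flagDim (b i) : ℕ) : ℝ) / (flagDim fun j => ∑ i, b i (σ i j) : ℕ) ∈
        betaRatioSet m ν :=
      (mem_betaRatioSet hn h2).2 ⟨fun i => b i ∘ σ i, fun i => by
        rw [← hb]; exact Equiv.sum_comp (σ i) (b i), hσ, by rwa [hsum], by rw [hsum]; rfl⟩
    have hDb : (0 : ℝ) < (flagDim fun j => ∑ i, b i (σ i j) : ℕ) := by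
      have := sum_flagDim_le_flagDim_sum fun i => b i ∘ σ i
      rw [hsum] at this
      exact_mod_cast h0.trans_le this
    have h1 := le_csSup hfin.bddAbove hmem
    rw [← hβ, div_le_iff₀ hDb] at h1
    have h3 : (flagDim fun j => ∑ i, b i (σ i j)) < flagDim fun j => ∑ i, a i j :=
      (flagDim_sum_le_of_monotone b σ hσ).trans_lt hlt
    have h4 := mul_lt_mul_of_pos_left (Nat.cast_lt (α := ℝ).2 h3) hβpos
    rw [hmul] at h4
    exact_mod_cast h1.trans_lt h4

/-- Shifting a partition by a non-trivial permutation, as in the Jacobi–Trudi determinant,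
decreases the dimension of the flag variety. -/
theorem flagDim_lt_of_shift {n : ℕ} {lam α : Fin n → ℕ} (hlam : Monotone lam)
    {v : Equiv.Perm (Fin n)} (hv : v ≠ 1) (hα : ∀ j, α j + v j = lam j + j) :
    flagDim α < flagDim lam := by
  have h1 := two_mul_flagDim_add α
  have h2 := two_mul_flagDim_add lam
  have hvs : ∑ j, (v j : ℕ) = ∑ j : Fin n, (j : ℕ) := Equiv.sum_comp v fun j : Fin n => (j : ℕ)
  have hsum : ∑ j, α j = ∑ j, lam j := by
    have : ∑ j, (α j + v j) = ∑ j, (lam j + j) := sum_congr rfl fun j _ => hα j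
    rw [sum_add_distrib, sum_add_distrib, hvs] at this
    omega
  have hsq : ∑ j, lam j ^ 2 < ∑ j, α j ^ 2 := by
    have hre : ∑ j, lam j * (v j : ℕ) ≤ ∑ j, lam j * (j : ℕ) :=
      (hlam.monovary (Fin.val_strictMono.monotone)).sum_mul_comp_perm_le_sum_mul (σ := v)
    obtain ⟨j, hj⟩ : ∃ j, v j ≠ j := by
      by_contra! h
      exact hv (Equiv.ext h)
    have hpos : (0 : ℤ) < ∑ j : Fin n, ((j : ℤ) - v j) ^ 2 := by
      refine sum_pos' (fun _ _ => sq_nonneg _) ⟨j, mem_univ j, ?_⟩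
      have : ((j : ℕ) : ℤ) - (v j : ℕ) ≠ 0 := by
        rw [sub_ne_zero]
        exact fun h => hj (Fin.ext (Nat.cast_injective h).symm)
      positivity
    have hex : ∑ j, (α j : ℤ) ^ 2 = ∑ j, (lam j : ℤ) ^ 2 +
        2 * (∑ j, (lam j : ℤ) * (j : ℕ) - ∑ j, (lam j : ℤ) * (v j : ℕ)) +
        ∑ j : Fin n, (((j : ℕ) : ℤ) - (v j : ℕ)) ^ 2 := by
      rw [← sum_sub_distrib, mul_sum, ← sum_add_distrib, ← sum_add_distrib]
      refine sum_congr rfl fun j _ => ?_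
      have : (α j : ℤ) = lam j + j - v j := by have := hα j; omega
      rw [this]
      ring
    zify at hre ⊢
    linarith
  rw [hsum] at h1
  omega

end OptimalRows

section ShiftedFlags

open Module Finset

/-- The permutations contributing to the Jacobi–Trudi expansion attached to `lam`. -/
abbrev ShiftPerm {k : ℕ} (lam : Fin k → ℕ) : Type :=
  {v : Equiv.Perm (Fin k) // ∀ j, (v j : ℕ) ≤ lam j + j}

/-- The composition obtained by shifting `lam` by the permutation `v`. -/
def shiftType {k : ℕ} (lam : Fin k → ℕ) (v : ShiftPerm lam) : Fin k → ℕ :=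
  fun j => lam j + j - v.1 j

theorem shiftType_add {k : ℕ} {lam : Fin k → ℕ} (v : ShiftPerm lam) (j : Fin k) :
    shiftType lam v j + v.1 j = lam j + j :=
  Nat.sub_add_cancel (v.2 j)

theorem sum_shiftType {k : ℕ} {lam : Fin k → ℕ} (v : ShiftPerm lam) :
    ∑ j, shiftType lam v j = ∑ j, lam j := by
  have h : ∑ j, (shiftType lam v j + v.1 j) = ∑ j, (lam j + j) :=
    sum_congr rfl fun j _ => shiftType_add v j
  rw [sum_add_distrib, sum_add_distrib, Equiv.sum_comp v.1 fun j : Fin k => (j : ℕ)] at h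
  omega

/-- The alternating sum of the numbers of fixed partial flags of the shifted types. -/
noncomputable def alternatingFixed (K V : Type) [Field K] [AddCommGroup V] [Module K V] {k : ℕ}
    (lam : Fin k → ℕ) (g : V ≃ₗ[K] V) : ℤ :=
  ∑ v : ShiftPerm lam, (Equiv.Perm.sign v.1 : ℤ) *
    Nat.card (MulAction.fixedBy (PartialFlag K V (shiftType lam v)) g)

variable {K V : Type} [Field K] [AddCommGroup V] [Module K V]

theorem exists_irreducible_character_eq_alternatingFixed [Finite V] [FiniteDimensional K V]
    {k : ℕ} {lam : Fin k → ℕ} (hlam : Monotone lam) (hsum : ∑ j, lam j = finrank K V) :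
    ∃ (W : Type) (_ : AddCommGroup W) (_ : Module ℂ W) (_ : FiniteDimensional ℂ W)
      (τ : Representation ℂ (V ≃ₗ[K] V) W), Nontrivial W ∧
      (∀ S : Submodule ℂ W, (∀ x v, v ∈ S → τ x v ∈ S) → S = ⊥ ∨ S = ⊤) ∧
      ∃ ε : ℤˣ, ∀ g, τ.character g = (((ε : ℤ) * alternatingFixed K V lam g : ℤ) : ℂ) := by
  have hfin : Finite (V ≃ₗ[K] V) := DFunLike.finite _
  have := Fintype.ofFinite (V ≃ₗ[K] V)
  have hX : ∀ v : ShiftPerm lam, Finite (PartialFlag K V (shiftType lam v)) :=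
    fun _ => Subtype.finite
  refine exists_irreducible_of_signed_permutation
    (fun v : ShiftPerm lam => PartialFlag K V (shiftType lam v))
    (fun v => Equiv.Perm.sign v.1) ?_
  have hinj : Function.Injective fun j : Fin k => lam j + (j : ℕ) :=
    (hlam.add_strictMono Fin.val_strictMono).injective
  rw [← sum_sign_mul_ncard_matrices hinj]
  have hrestrict : ∀ f : Equiv.Perm (Fin k) → ℤ, (∀ v, f v ≠ 0 → ∀ j, (v j : ℕ) ≤ lam j + j) →
      ∑ v : ShiftPerm lam, f v.1 = ∑ v, f v := by
    intro f hf
    rw [← sum_filter_of_ne (p := fun v : Equiv.Perm (Fin k) => ∀ j, (v j : ℕ) ≤ lam j + j)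
      fun v _ => hf v]
    exact (sum_subtype _ (by simp) _).symm
  rw [← hrestrict]
  · refine sum_congr rfl fun v _ => ?_
    rw [← hrestrict]
    · refine sum_congr rfl fun w _ => ?_
      rw [card_orbits_partialFlag ((sum_shiftType v).trans hsum) ((sum_shiftType w).trans hsum)]
      congr 4
      ext A
      have h : ∀ (u : ShiftPerm lam) (s : ℕ) (j : Fin k),
          s + u.1 j = lam j + j ↔ s = shiftType lam u j := fun u s j => by
        rw [← shiftType_add u, add_left_inj]
      simp only [h]
    · intro w hw j
      obtain ⟨A, -, hA⟩ := Set.nonempty_of_ncard_ne_zero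
        (Nat.cast_ne_zero.1 (right_ne_zero_of_mul hw))
      rw [← hA j]
      exact Nat.le_add_left _ _
  · intro v hv j
    obtain ⟨w, -, hw⟩ := exists_ne_zero_of_sum_ne_zero hv
    obtain ⟨A, hA, -⟩ := Set.nonempty_of_ncard_ne_zero
      (Nat.cast_ne_zero.1 (right_ne_zero_of_mul hw))
    rw [← hA j]
    exact Nat.le_add_left _ _

theorem card_shiftPerm_le {k : ℕ} (lam : Fin k → ℕ) :
    Fintype.card (ShiftPerm lam) ≤ k.factorial := by
  refine (Fintype.card_subtype_le _).trans_eq ?_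
  rw [Fintype.card_perm, Fintype.card_fin]

/-- The alternating sum is approximated by its term at the identity permutation. -/
theorem abs_alternatingFixed_sub_le {k : ℕ} {lam : Fin k → ℕ} (g : V ≃ₗ[K] V) {c : ℝ}
    (hc0 : 0 ≤ c)
    (hc : ∀ v : ShiftPerm lam, v.1 ≠ 1 →
      (Nat.card (MulAction.fixedBy (PartialFlag K V (shiftType lam v)) g) : ℝ) ≤ c) :
    |(alternatingFixed K V lam g : ℝ) - Nat.card (MulAction.fixedBy (PartialFlag K V lam) g)| ≤
      k.factorial * c := by
  let e : ShiftPerm lam := ⟨1, fun j => Nat.le_add_left _ _⟩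
  have he : shiftType lam e = lam := funext fun j => Nat.add_sub_cancel _ _
  have h1 : (alternatingFixed K V lam g : ℝ) -
      Nat.card (MulAction.fixedBy (PartialFlag K V lam) g) =
      ∑ v ∈ univ.erase e, ((Equiv.Perm.sign v.1 : ℤ) : ℝ) *
        (Nat.card (MulAction.fixedBy (PartialFlag K V (shiftType lam v)) g) : ℝ) := by
    rw [alternatingFixed, ← add_sum_erase _ _ (mem_univ e), he]
    simp [e]
  rw [h1]
  have h2 : ((univ.erase e).card : ℝ) ≤ k.factorial := by
    exact_mod_cast (card_erase_le.trans (card_shiftPerm_le lam))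
  calc _ ≤ ∑ v ∈ univ.erase e, c := by
        refine (abs_sum_le_sum_abs _ _).trans (sum_le_sum fun v hv => ?_)
        have : |((Equiv.Perm.sign v.1 : ℤ) : ℝ)| = 1 := by
          rcases Int.units_eq_one_or (Equiv.Perm.sign v.1) with h | h <;> simp [h]
        rw [abs_mul, this, one_mul, Nat.abs_cast]
        exact hc v fun h => (mem_erase.1 hv).1 (Subtype.ext h)
    _ ≤ _ := by
        rw [sum_const, nsmul_eq_mul]
        exact mul_le_mul_of_nonneg_right h2 hc0

theorem card_partialFlag_le_two_mul [Fintype K] [FiniteDimensional K V] {k : ℕ} {α : Fin k → ℕ}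
    (hα : ∑ i, α i = finrank K V) (hq : 2 * finrank K V ≤ Fintype.card K) :
    (Nat.card (PartialFlag K V α) : ℝ) ≤ 2 * (Fintype.card K : ℝ) ^ flagDim α := by
  have h := (card_partialFlag_bounds hα).2
  have hq0 : (0 : ℝ) < Fintype.card K := by exact_mod_cast Fintype.card_pos
  have hq' : (2 * finrank K V : ℝ) ≤ Fintype.card K := by exact_mod_cast hq
  have h2 : (finrank K V : ℝ) / Fintype.card K ≤ 1 / 2 := by
    rw [div_le_div_iff₀ hq0 two_pos]; linarith
  have h3 : (0 : ℝ) ≤ Nat.card (PartialFlag K V α) := Nat.cast_nonneg _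
  nlinarith

/-- Bounds for the degree of the alternating sum. -/
theorem alternatingFixed_one_bounds [Fintype K] [FiniteDimensional K V] {k : ℕ} {lam : Fin k → ℕ}
    (hlam : Monotone lam) (hsum : ∑ j, lam j = finrank K V)
    (h4 : 4 * finrank K V ≤ Fintype.card K) (h8 : 8 * k.factorial ≤ Fintype.card K) :
    (0 : ℝ) < alternatingFixed K V lam 1 ∧
      (alternatingFixed K V lam 1 : ℝ) ≤ 2 * (Fintype.card K : ℝ) ^ flagDim lam := by
  have hcard : ∀ α : Fin k → ℕ, Nat.card (MulAction.fixedBy (PartialFlag K V α) (1 : V ≃ₗ[K] V)) =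
      Nat.card (PartialFlag K V α) := fun α => by
    rw [MulAction.fixedBy_one_eq_univ, Nat.card_univ]
  set q : ℝ := (Fintype.card K : ℝ) with hq
  have hq0 : 0 < q := by rw [hq]; exact_mod_cast Fintype.card_pos
  have hq1 : 1 ≤ q := by rw [hq]; exact_mod_cast Fintype.card_pos
  have h4' : 4 * (finrank K V : ℝ) ≤ q := by rw [hq]; exact_mod_cast h4
  have h8' : 8 * (k.factorial : ℝ) ≤ q := by rw [hq]; exact_mod_cast h8
  have habs := abs_alternatingFixed_sub_le (K := K) (V := V) (lam := lam) 1
    (c := 2 * q ^ flagDim lam / q) (by positivity) fun v hv => by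
      rw [hcard]
      refine (card_partialFlag_le_two_mul ((sum_shiftType v).trans hsum) (by omega)).trans ?_
      have hlt := flagDim_lt_of_shift hlam hv (shiftType_add v)
      rw [mul_div_assoc, ← hq]
      refine mul_le_mul_of_nonneg_left ?_ two_pos.le
      rw [le_div_iff₀ hq0, ← pow_succ]
      exact pow_le_pow_right₀ hq1 hlt
  rw [hcard] at habs
  have hb := card_partialFlag_bounds (K := K) (V := V) hsum
  rw [← hq] at hb
  have hf : (finrank K V : ℝ) / q ≤ 1 / 4 := by
    rw [div_le_div_iff₀ hq0 (by norm_num)]; linarith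
  have hP : 0 < q ^ flagDim lam := by positivity
  have herr : (k.factorial : ℝ) * (2 * q ^ flagDim lam / q) ≤ q ^ flagDim lam / 4 := by
    rw [← mul_div_assoc, div_le_div_iff₀ hq0 (by norm_num)]
    nlinarith
  obtain ⟨ha1, ha2⟩ := abs_le.1 (habs.trans herr)
  have hc0 : (0 : ℝ) ≤ Nat.card (PartialFlag K V lam) := Nat.cast_nonneg _
  constructor <;> nlinarith [hb.1, hb.2]

end ShiftedFlags

section BlockScalar

open Module Finset

theorem one_sub_sum_le_prod_one_sub {ι : Type*} {s : Finset ι} {x : ι → ℝ}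
    (h0 : ∀ i ∈ s, 0 ≤ x i) (h1 : ∀ i ∈ s, x i ≤ 1) : 1 - ∑ i ∈ s, x i ≤ ∏ i ∈ s, (1 - x i) := by
  classical
  induction s using Finset.induction_on with
  | empty => simp
  | insert i s hi ih =>
    rw [sum_insert hi, prod_insert hi]
    have hx := h0 i (mem_insert_self i s)
    have hx1 := h1 i (mem_insert_self i s)
    have hs : 0 ≤ ∑ i ∈ s, x i := sum_nonneg fun j hj => h0 j (mem_insert_of_mem hj)
    have := ih (fun j hj => h0 j (mem_insert_of_mem hj)) fun j hj => h1 j (mem_insert_of_mem hj)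
    nlinarith

variable {K : Type} [Field K] {m : ℕ} {U : Fin m → Type} [∀ i, AddCommGroup (U i)]
  [∀ i, Module K (U i)] [∀ i, Finite (U i)]

theorem one_sub_div_mul_le_prod_card_partialFlag [Fintype K] {k n : ℕ} {a : Fin m → Fin k → ℕ}
    (ha : ∀ i, ∑ j, a i j = finrank K (U i)) (hn : ∑ i, finrank K (U i) = n)
    (hq : n ≤ Fintype.card K) :
    (1 - (n : ℝ) / Fintype.card K) * (Fintype.card K : ℝ) ^ (∑ i, flagDim (a i)) ≤
      (∏ i, Nat.card (PartialFlag K (U i) (a i)) : ℕ) := by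
  have hq0 : (0 : ℝ) < Fintype.card K := by exact_mod_cast Fintype.card_pos
  have hle : ∀ i, (finrank K (U i) : ℝ) / Fintype.card K ≤ 1 := fun i => by
    rw [div_le_one hq0]
    have : finrank K (U i) ≤ n := hn ▸
      single_le_sum (f := fun i => finrank K (U i)) (fun _ _ => Nat.zero_le _) (mem_univ i)
    exact_mod_cast this.trans hq
  calc _ ≤ (∏ i, (1 - (finrank K (U i) : ℝ) / Fintype.card K)) *
        ∏ i, (Fintype.card K : ℝ) ^ flagDim (a i) := by
        rw [prod_pow_eq_pow_sum]
        refine mul_le_mul_of_nonneg_right ?_ (by positivity)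
        rw [← hn, Nat.cast_sum, sum_div]
        exact one_sub_sum_le_prod_one_sub (fun i _ => by positivity) fun i _ => hle i
    _ = ∏ i, ((1 - (finrank K (U i) : ℝ) / Fintype.card K) *
        (Fintype.card K : ℝ) ^ flagDim (a i)) := prod_mul_distrib.symm
    _ ≤ _ := by
        rw [Nat.cast_prod]
        refine prod_le_prod (fun i _ => mul_nonneg (sub_nonneg.2 (hle i)) (by positivity)) fun i _ => ?_
        exact (card_partialFlag_bounds (ha i)).1

theorem card_fixedBy_le_of_forall_lt [Fintype K] {n : ℕ} {μ : Fin m → Kˣ}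
    (hμ : Function.Injective μ) {g : (∀ i, U i) ≃ₗ[K] ∀ i, U i}
    (hg : ∀ x i, g x i = (μ i : K) • x i) (hn : ∑ i, finrank K (U i) = n) (hm : m ≤ n)
    (hq : 2 * n ≤ Fintype.card K) {α : Fin n → ℕ} (hα : ∑ j, α j = n) {N : ℕ}
    (hN : ∀ b : Fin m → Fin n → ℕ, (∀ i, ∑ j, b i j = finrank K (U i)) →
      (∀ j, ∑ i, b i j = α j) → ∑ i, flagDim (b i) < N) :
    (Nat.card (MulAction.fixedBy (PartialFlag K (∀ i, U i) α) g) : ℝ) ≤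
      (n + 1) ^ (n * n) * (2 ^ n * (Fintype.card K : ℝ) ^ N / Fintype.card K) := by
  classical
  have hq0 : (0 : ℝ) < Fintype.card K := by exact_mod_cast Fintype.card_pos
  have hq1 : (1 : ℝ) ≤ Fintype.card K := by exact_mod_cast Fintype.card_pos
  have hle : ∀ i, finrank K (U i) ≤ n := fun i => hn ▸
    single_le_sum (f := fun i => finrank K (U i)) (fun _ _ => Nat.zero_le _) (mem_univ i)
  let E : Finset (Fin m → Fin n → ℕ) :=
    Fintype.piFinset fun _ => Fintype.piFinset fun _ => range (n + 1)
  let B : Finset (Fin m → Fin n → ℕ) :=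
    {b ∈ E | (∀ i, ∑ j, b i j = finrank K (U i)) ∧ ∀ j, ∑ i, b i j = α j}
  have hcard : (#B : ℝ) ≤ (n + 1) ^ (n * n) := by
    have h1 : #B ≤ (n + 1) ^ (n * m) := by
      refine (card_filter_le _ _).trans_eq ?_
      simp [E, Fintype.card_piFinset, pow_mul]
    have h2 : (n + 1) ^ (n * m) ≤ (n + 1) ^ (n * n) :=
      Nat.pow_le_pow_right n.succ_pos (Nat.mul_le_mul_left n hm)
    exact_mod_cast h1.trans h2
  have hfix := card_fixedBy_le hμ hg (by rw [hα, finrank_pi_fintype, hn]) B fun b hb hb' => by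
    simp only [B, E, mem_filter, Fintype.mem_piFinset, mem_range]
    refine ⟨fun i j => Nat.lt_succ_of_le (le_trans ?_ (hle i)), hb, hb'⟩
    rw [← hb i]
    exact single_le_sum (f := fun j => b i j) (fun _ _ => Nat.zero_le _) (mem_univ j)
  calc (Nat.card (MulAction.fixedBy (PartialFlag K (∀ i, U i) α) g) : ℝ)
      ≤ ∑ b ∈ B, ∏ i, (Nat.card (PartialFlag K (U i) (b i)) : ℝ) := by exact_mod_cast hfix
    _ ≤ ∑ b ∈ B, (2 ^ n * (Fintype.card K : ℝ) ^ N / Fintype.card K) := by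
        refine sum_le_sum fun b hb => ?_
        obtain ⟨-, hb1, hb2⟩ := mem_filter.1 hb
        calc ∏ i, (Nat.card (PartialFlag K (U i) (b i)) : ℝ)
            ≤ ∏ i, (2 * (Fintype.card K : ℝ) ^ flagDim (b i)) :=
              prod_le_prod (fun _ _ => Nat.cast_nonneg _) fun i _ =>
                card_partialFlag_le_two_mul (hb1 i) (by have := hle i; omega)
          _ = 2 ^ m * (Fintype.card K : ℝ) ^ (∑ i, flagDim (b i)) := by
              rw [prod_mul_distrib, prod_pow_eq_pow_sum, prod_const, card_univ, Fintype.card_fin]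
          _ ≤ _ := by
              rw [mul_div_assoc]
              refine mul_le_mul (pow_le_pow_right₀ one_le_two hm) ?_ (by positivity) (by positivity)
              rw [le_div_iff₀ hq0, ← pow_succ]
              exact pow_le_pow_right₀ hq1 (hN b hb1 hb2)
    _ ≤ _ := by
        rw [sum_const, nsmul_eq_mul]
        exact mul_le_mul_of_nonneg_right hcard (by positivity)

/-- A lower bound for the alternating sum at a block-scalar element. -/
theorem pow_le_two_mul_alternatingFixed [Fintype K] {n : ℕ} {μ : Fin m → Kˣ}
    (hμ : Function.Injective μ) {g : (∀ i, U i) ≃ₗ[K] ∀ i, U i}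
    (hg : ∀ x i, g x i = (μ i : K) • x i) (hn : ∑ i, finrank K (U i) = n) (hm : m ≤ n)
    (hq : 4 * n ≤ Fintype.card K)
    (hq' : 4 * (n.factorial * (n + 1) ^ (n * n) * 2 ^ n) ≤ Fintype.card K)
    {a : Fin m → Fin n → ℕ} (ha : ∀ i, ∑ j, a i j = finrank K (U i))
    (hmono : Monotone fun j => ∑ i, a i j)
    (hopt : ∀ b : Fin m → Fin n → ℕ, (∀ i, ∑ j, b i j = finrank K (U i)) →
        (flagDim fun j => ∑ i, b i j) < (flagDim fun j => ∑ i, a i j) →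
        ∑ i, flagDim (b i) < ∑ i, flagDim (a i)) :
    (Fintype.card K : ℝ) ^ (∑ i, flagDim (a i)) ≤
      2 * alternatingFixed K (∀ i, U i) (fun j => ∑ i, a i j) g := by
  set q : ℝ := (Fintype.card K : ℝ) with hqdef
  have hq0 : 0 < q := by rw [hqdef]; exact_mod_cast Fintype.card_pos
  have h4 : 4 * (n : ℝ) ≤ q := by rw [hqdef]; exact_mod_cast hq
  have h4' : 4 * (n.factorial * (n + 1) ^ (n * n) * 2 ^ n) ≤ q := by
    rw [hqdef]; exact_mod_cast hq'
  have hsum : ∑ j, ∑ i, a i j = n := by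
    rw [sum_comm]
    refine Eq.trans ?_ hn
    exact sum_congr rfl fun i _ => ha i
  set N := ∑ i, flagDim (a i) with hN
  have habs := abs_alternatingFixed_sub_le (K := K) (lam := fun j => ∑ i, a i j) g
    (c := (n + 1) ^ (n * n) * (2 ^ n * q ^ N / q)) (by positivity) fun v hv =>
      card_fixedBy_le_of_forall_lt hμ hg hn hm (by omega) ((sum_shiftType v).trans hsum)
        fun b hb hb' => hopt b hb <| by
          rw [funext hb']
          exact flagDim_lt_of_shift hmono hv (shiftType_add v)
  have hmain : (1 - (n : ℝ) / q) * q ^ N ≤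
      Nat.card (MulAction.fixedBy (PartialFlag K (∀ i, U i) fun j => ∑ i, a i j) g) :=
    (one_sub_div_mul_le_prod_card_partialFlag ha hn (by omega)).trans <| by
      exact_mod_cast prod_card_partialFlag_le_card_fixedBy hg a fun _ => rfl
  have hP : 0 < q ^ N := by positivity
  have hf : (n : ℝ) / q ≤ 1 / 4 := by
    rw [div_le_div_iff₀ hq0 (by norm_num)]; linarith
  have herr : (n.factorial : ℝ) * ((n + 1) ^ (n * n) * (2 ^ n * q ^ N / q)) ≤ q ^ N / 4 := by
    rw [← mul_div_assoc, ← mul_div_assoc, div_le_div_iff₀ hq0 (by norm_num)]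
    nlinarith
  have := (abs_le.1 (habs.trans herr)).1
  nlinarith

end BlockScalar

section GeneralLinear

open Module Finset

/-- The automorphisms of `Π i, (κ i → F)` as invertible matrices. -/
noncomputable def glEquivPi (F : Type) [Field F] {m : ℕ} (κ : Fin m → Type) [∀ i, Fintype (κ i)]
    [∀ i, DecidableEq (κ i)] :
    GL ((i : Fin m) × κ i) F ≃* ((∀ i, κ i → F) ≃ₗ[F] ∀ i, κ i → F) :=
  (Matrix.GeneralLinearGroup.toLin.trans (LinearMap.GeneralLinearGroup.congrLinearEquiv
    (LinearEquiv.piCurry F fun (i : Fin m) (_ : κ i) => F))).trans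
    (LinearMap.GeneralLinearGroup.generalLinearEquiv F _)

theorem glEquivPi_apply_of_eq_diagonal {F : Type} [Field F] {m : ℕ} {κ : Fin m → Type}
    [∀ i, Fintype (κ i)] [∀ i, DecidableEq (κ i)] {μ : Fin m → F} {g : GL ((i : Fin m) × κ i) F}
    (hg : (g : Matrix ((i : Fin m) × κ i) ((i : Fin m) × κ i) F) =
      Matrix.diagonal fun p => μ p.1) (x : ∀ i, κ i → F) (i : Fin m) :
    glEquivPi F κ g x i = μ i • x i := by
  have : glEquivPi F κ g x = LinearEquiv.piCurry F (fun (i : Fin m) (_ : κ i) => F)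
      ((g : Matrix ((i : Fin m) × κ i) ((i : Fin m) × κ i) F).mulVec
        ((LinearEquiv.piCurry F fun (i : Fin m) (_ : κ i) => F).symm x)) := rfl
  rw [this, hg]
  ext j
  simp [Sigma.curry, Matrix.mulVec_diagonal, Sigma.uncurry]

theorem exists_injective_units {F : Type} [Field F] [Fintype F] {m : ℕ}
    (h : m < Fintype.card F) : ∃ μ : Fin m → Fˣ, Function.Injective μ := by
  classical
  obtain ⟨f⟩ := Function.Embedding.nonempty_of_card_le (α := Fin m) (β := Fˣ) (by
    rw [Fintype.card_fin, Fintype.card_units]; omega)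
  exact ⟨f, f.injective⟩

theorem quarter_mul_rpow_le {q d x β : ℝ} {e N : ℕ} (hq : 0 < q) (hd : 0 ≤ d)
    (hde : d ≤ 2 * q ^ e) (hβ0 : 0 ≤ β) (hβ1 : β ≤ 1) (hβ : β * e = N) (hx : q ^ N ≤ 2 * x) :
    (1 / 4) * d ^ β ≤ x := by
  have h1 : d ^ β ≤ (2 * q ^ e) ^ β := Real.rpow_le_rpow hd hde hβ0
  have h2 : (2 * q ^ e) ^ β = 2 ^ β * q ^ N := by
    rw [Real.mul_rpow two_pos.le (by positivity), ← Real.rpow_natCast q e,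
      ← Real.rpow_mul hq.le, mul_comm (e : ℝ), hβ, Real.rpow_natCast]
  have h3 : (2 : ℝ) ^ β ≤ 2 := by
    simpa using Real.rpow_le_rpow_of_exponent_le one_le_two hβ1
  have : 0 < q ^ N := by positivity
  nlinarith

theorem exists_irreducible_of_not_forall_le_one {n : ℕ} (hn : 2 ≤ n) {F : Type} [Field F]
    [Fintype F] [DecidableEq F]
    (hC : 8 * (n.factorial * (n + 1) ^ (n * n) * 2 ^ n) ≤ Fintype.card F) {m : ℕ} {ν : Fin m → ℕ}
    (hm : m ≤ n) (hsum : ∑ i, ν i = n) (hν : ¬ ∀ i, ν i ≤ 1) {μ : Fin m → Fˣ}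
    (hμ : Function.Injective μ) {g : GL ((i : Fin m) × Fin (ν i)) F}
    (hg : (g : Matrix ((i : Fin m) × Fin (ν i)) ((i : Fin m) × Fin (ν i)) F) =
      Matrix.diagonal fun p => (μ p.1 : F)) :
    ∃ (V : Type) (_ : AddCommGroup V) (_ : Module ℂ V) (_ : FiniteDimensional ℂ V)
      (ρ : Representation ℂ (GL ((i : Fin m) × Fin (ν i)) F) V), Nontrivial V ∧
      (∀ W : Submodule ℂ V, (∀ x v, v ∈ W → ρ x v ∈ W) → W = ⊥ ∨ W = ⊤) ∧
      ∃ x : ℝ, LinearMap.trace ℂ V (ρ g) = (x : ℂ) ∧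
        (1 / 4) * (finrank ℂ V : ℝ) ^ (betaGL m ν) ≤ x := by
  have hbig : n ≤ (n + 1) ^ (n * n) := calc
    n ≤ n + 1 := n.le_succ
    _ ≤ (n + 1) ^ (n * n) := Nat.le_self_pow (by positivity) _
  have hfac := n.factorial_pos
  have hpow := Nat.two_pow_pos n
  have hD1 : n ≤ n.factorial * (n + 1) ^ (n * n) * 2 ^ n :=
    hbig.trans (by rw [mul_right_comm]; exact Nat.le_mul_of_pos_left _ (by positivity))
  have hD2 : n.factorial ≤ n.factorial * (n + 1) ^ (n * n) * 2 ^ n := by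
    rw [mul_assoc]; exact Nat.le_mul_of_pos_right _ (by positivity)
  obtain ⟨a, ha, hmono, hβ0, hβ1, hβ, hopt⟩ := exists_optimal_rows hsum hn hν
  have hrank : ∀ i, finrank F (Fin (ν i) → F) = ν i := fun i => by simp
  have hmono' : Monotone fun j => ∑ i, a i j := fun j l h => sum_le_sum fun i _ => hmono i h
  have hlam : ∑ j, ∑ i, a i j = finrank F (∀ i, Fin (ν i) → F) := by
    rw [sum_comm, finrank_pi_fintype]
    exact sum_congr rfl fun i _ => (ha i).trans (hrank i).symm
  have hV : finrank F (∀ i, Fin (ν i) → F) = n := by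
    rw [finrank_pi_fintype, ← hsum]
    exact sum_congr rfl fun i _ => hrank i
  obtain ⟨W, _, _, hW, τ, hnt, hirr, ε, hchar⟩ :=
    exists_irreducible_character_eq_alternatingFixed hmono' hlam
  obtain ⟨hpos, hle⟩ := alternatingFixed_one_bounds hmono' hlam (by rw [hV]; omega) (by omega)
  have hdim := hchar 1
  rw [Representation.char_one] at hdim
  have hdim' : (finrank ℂ W : ℤ) =
      ε * alternatingFixed F (∀ i, Fin (ν i) → F) (fun j => ∑ i, a i j) 1 := by
    exact_mod_cast hdim
  have hε : ε = 1 := by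
    rcases Int.units_eq_one_or ε with h | h
    · exact h
    · have h0 : (0 : ℤ) < alternatingFixed F (∀ i, Fin (ν i) → F) (fun j => ∑ i, a i j) 1 := by
        exact_mod_cast hpos
      rw [h] at hdim'
      simp only [Units.val_neg, Units.val_one] at hdim'
      omega
  simp only [hε, Units.val_one, one_mul] at hchar hdim'
  have hdimR : (finrank ℂ W : ℝ) =
      alternatingFixed F (∀ i, Fin (ν i) → F) (fun j => ∑ i, a i j) 1 := by
    exact_mod_cast congrArg (Int.cast : ℤ → ℝ) hdim'
  have hx := pow_le_two_mul_alternatingFixed hμ (g := glEquivPi F (fun i => Fin (ν i)) g)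
    (glEquivPi_apply_of_eq_diagonal hg) (by simp [hsum]) hm (by omega) (by omega)
    (fun i => (ha i).trans (hrank i).symm) hmono' fun b hb =>
      hopt b fun i => (hb i).trans (hrank i)
  refine ⟨W, _, _, hW, τ.comp (glEquivPi F fun i => Fin (ν i)).toMonoidHom, hnt,
    fun S hS => hirr S fun y w hw => ?_,
    alternatingFixed F (∀ i, Fin (ν i) → F) (fun j => ∑ i, a i j)
      (glEquivPi F (fun i => Fin (ν i)) g), ?_, ?_⟩
  · obtain ⟨z, rfl⟩ := (glEquivPi F fun i => Fin (ν i)).surjective y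
    exact hS z w hw
  · exact_mod_cast hchar (glEquivPi F (fun i => Fin (ν i)) g)
  · refine quarter_mul_rpow_le (q := (Fintype.card F : ℝ)) (by exact_mod_cast Fintype.card_pos)
      (Nat.cast_nonneg _) (hdimR.trans_le hle) hβ0 hβ1 hβ hx

end GeneralLinear

/-- the `GL_n` case of Theorem 1.3: sharpness of Theorem 1.1.
For every `n ≥ 2` there is a constant `C_n > 0` such that for every finite field
`𝔽_q` with `q ≥ C_n` and all positive `n_1, …, n_m` with `n_1 + ⋯ + n_m = n`,
there are pairwise distinct `μ_1, …, μ_m ∈ 𝔽_q^×`, the block-scalar element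
`g = diag(μ_1·I_{n_1}, …, μ_m·I_{n_m}) ∈ GL_n(𝔽_q)`, and an irreducible complex
representation of `GL_n(𝔽_q)` with character `χ` such that `χ(g)` is real and
`χ(g) ≥ (1/4)·χ(1)^{β(n_1,…,n_m)}`. -/
theorem exists_character_attaining_beta_bound (n : ℕ) (hn : 2 ≤ n) :
    ∃ C : ℝ, 0 < C ∧
      ∀ (F : Type) [Field F] [Fintype F] [DecidableEq F],
        C ≤ (Fintype.card F : ℝ) →
        ∀ (m : ℕ) (ν : Fin m → ℕ), (∀ i, 1 ≤ ν i) → (∑ i, ν i) = n →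
          ∃ μ : Fin m → Fˣ, Function.Injective μ ∧
            ∃ (V : Type) (_ : AddCommGroup V) (_ : Module ℂ V),
              ∃ (_ : FiniteDimensional ℂ V)
                (ρ : Representation ℂ (GL ((i : Fin m) × Fin (ν i)) F) V),
                Nontrivial V ∧
                (∀ W : Submodule ℂ V, (∀ x v, v ∈ W → ρ x v ∈ W) → W = ⊥ ∨ W = ⊤) ∧
                ∃ g : GL ((i : Fin m) × Fin (ν i)) F,
                  (g : Matrix ((i : Fin m) × Fin (ν i)) ((i : Fin m) × Fin (ν i)) F) =
                    Matrix.diagonal (fun p => (μ p.1 : F)) ∧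
                  ∃ x : ℝ, LinearMap.trace ℂ V (ρ g) = (x : ℂ) ∧
                    (1 / 4) * (Module.finrank ℂ V : ℝ) ^ (betaGL m ν) ≤ x := by
  refine ⟨(8 * (n.factorial * (n + 1) ^ (n * n) * 2 ^ n) : ℕ), by positivity, ?_⟩
  intro F _ _ _ hC m ν hν hsum
  rw [Nat.cast_le] at hC
  have hm : m ≤ n := by
    rw [← hsum]
    simpa using Finset.sum_le_sum fun i (_ : i ∈ Finset.univ) => hν i
  have hmC : n < Fintype.card F := by
    have h1 : n < (n + 1) ^ (n * n) :=
      n.lt_succ_self.trans_le (Nat.le_self_pow (by positivity) _)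
    have h2 : (n + 1) ^ (n * n) ≤ n.factorial * (n + 1) ^ (n * n) * 2 ^ n := by
      rw [mul_right_comm]
      exact Nat.le_mul_of_pos_left _ (mul_pos n.factorial_pos (Nat.two_pow_pos n))
    omega
  obtain ⟨μ, hμ⟩ := exists_injective_units (hm.trans_lt hmC)
  let g : GL ((i : Fin m) × Fin (ν i)) F := Matrix.GeneralLinearGroup.mkOfDetNeZero
    (Matrix.diagonal fun p => (μ p.1 : F)) (by
      rw [Matrix.det_diagonal]
      exact Finset.prod_ne_zero_iff.2 fun p _ => (μ p.1).ne_zero)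
  refine ⟨μ, hμ, ?_⟩
  by_cases h1 : ∀ i, ν i ≤ 1
  · refine ⟨ℂ, _, _, inferInstance, 1, inferInstance, fun W _ => eq_bot_or_eq_top W, g, rfl,
      1, ?_, ?_⟩
    · rw [MonoidHom.one_apply, LinearMap.trace_one, Module.finrank_self]
      simp
    · rw [betaGL, if_pos h1, Real.rpow_zero]
      norm_num
  · obtain ⟨V, i₁, i₂, i₃, ρ, hnt, hirr, hx⟩ :=
      exists_irreducible_of_not_forall_le_one hn hC hm hsum h1 hμ (g := g) rfl
    exact ⟨V, i₁, i₂, i₃, ρ, hnt, hirr, g, rfl, hx⟩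
end

section
/- Let N ≥ 1 and let a_1, …, a_N and b_1, …, b_N be non-negative integers such that not all a_i are zero and not all b_i are zero. Then 4·∑_{i=1}^N (i² − i)·a_i·b_i + 4·∑_{1≤i<j≤N} i·(j−1)·(a_i·b_j + a_j·b_i) + ∑_{i odd} (a_i + b_i) ≥ ∑_{i=1}^N i·a_i + ∑_{j=1}^N j·b_j. -/
open Finset in
/-- A sum over a square splits into its diagonal and the pairs of off-diagonal entries. -/
theorem sum_Icc_sum_Icc_eq_diag_add_offDiag (F : ℕ → ℕ → ℕ) (N : ℕ) :
    ∑ i ∈ Icc 1 N, ∑ j ∈ Icc 1 N, F i j =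
      ∑ i ∈ Icc 1 N, F i i + ∑ i ∈ Icc 1 N, ∑ j ∈ Ioc i N, (F i j + F j i) := by
  induction N with
  | zero => simp
  | succ N ih =>
    have h : ∑ i ∈ Icc 1 N, ∑ j ∈ Ioc i (N + 1), (F i j + F j i) =
        ∑ i ∈ Icc 1 N, (∑ j ∈ Ioc i N, (F i j + F j i) + (F i (N + 1) + F (N + 1) i)) :=
      sum_congr rfl fun i hi => sum_Ioc_succ_top (mem_Icc.1 hi).2 _
    simp only [sum_Icc_succ_top (Nat.le_add_left 1 N), Ioc_self, sum_empty, h]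
    rw [sum_add_distrib, sum_add_distrib, sum_add_distrib, ih]
    ring

/-- The kernel `min i j * (max i j - 1)` dominates `i - 1`. -/
theorem sub_one_le_min_mul_max_sub_one {i j : ℕ} (hi : 1 ≤ i) (hj : 1 ≤ j) :
    i - 1 ≤ min i j * (max i j - 1) :=
  calc i - 1 ≤ max i j - 1 := Nat.sub_le_sub_right (le_max_left i j) 1
    _ ≤ min i j * (max i j - 1) := Nat.le_mul_of_pos_left _ (lt_min hi hj)

/-- Rounding `i ≥ 1` down to an even number gives at most `2 * (i - 1)`. -/
theorem two_mul_div_two_le {i : ℕ} (hi : 1 ≤ i) : 2 * (i / 2) ≤ 2 * (i - 1) := by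
  omega

open Finset in
/-- The weighted sum of `a` splits into its even part and the sum of `a` over odd indices. -/
theorem sum_mul_eq_sum_two_mul_div_two_add_sum_odd (s : Finset ℕ) (a : ℕ → ℕ) :
    ∑ i ∈ s, i * a i = ∑ i ∈ s, 2 * (i / 2) * a i + ∑ i ∈ s with Odd i, a i := by
  rw [sum_filter, ← sum_add_distrib]
  refine sum_congr rfl fun i _ => ?_
  split_ifs with h
  · nth_rewrite 1 [← Nat.two_mul_div_two_add_one_of_odd h]
    ring
  · rw [Nat.two_mul_div_two_of_even (Nat.not_odd_iff_even.1 h), add_zero]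

open Finset in
theorem one_le_sum_of_exists_ne_zero {s : Finset ℕ} {a : ℕ → ℕ} (h : ∃ i ∈ s, a i ≠ 0) :
    1 ≤ ∑ i ∈ s, a i := by
  obtain ⟨i, hi, h⟩ := h
  exact (Nat.one_le_iff_ne_zero.2 h).trans (single_le_sum (fun _ _ => Nat.zero_le _) hi)


/-- inequality (ineqz) of Lemma 4.7. For non-negative integers
`a_1, …, a_N` and `b_1, …, b_N`, not all `a_i` zero and not all `b_i` zero:
`4·∑ (i²−i)·a_i·b_i + 4·∑_{i<j} i·(j−1)·(a_i·b_j + a_j·b_i) + ∑_{i odd} (a_i + b_i)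
  ≥ ∑ i·a_i + ∑ j·b_j`. -/
theorem jordan_block_inequality_Dn (N : ℕ) (hN : 1 ≤ N) (a b : ℕ → ℕ)
    (ha : ∃ i ∈ Finset.Icc 1 N, a i ≠ 0) (hb : ∃ i ∈ Finset.Icc 1 N, b i ≠ 0) :
    (∑ i ∈ Finset.Icc 1 N, i * a i) + ∑ j ∈ Finset.Icc 1 N, j * b j ≤
      4 * (∑ i ∈ Finset.Icc 1 N, (i ^ 2 - i) * (a i * b i)) +
        4 * (∑ i ∈ Finset.Icc 1 N, ∑ j ∈ Finset.Ioc i N,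
          i * (j - 1) * (a i * b j + a j * b i)) +
        ∑ i ∈ (Finset.Icc 1 N).filter (fun i => Odd i), (a i + b i) := by
  have hc : 4 * (∑ i ∈ Finset.Icc 1 N, (i ^ 2 - i) * (a i * b i)) +
      4 * (∑ i ∈ Finset.Icc 1 N, ∑ j ∈ Finset.Ioc i N,
        i * (j - 1) * (a i * b j + a j * b i)) =
      4 * ∑ i ∈ Finset.Icc 1 N, ∑ j ∈ Finset.Icc 1 N,
        min i j * (max i j - 1) * (a i * b j) := by
    rw [sum_Icc_sum_Icc_eq_diag_add_offDiag, ← mul_add]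
    congr 2
    · refine Finset.sum_congr rfl fun i _ => ?_
      rw [min_self, max_self, Nat.mul_sub_one, sq]
    · refine Finset.sum_congr rfl fun i _ => Finset.sum_congr rfl fun j hj => ?_
      have hij := (Finset.mem_Ioc.1 hj).1.le
      rw [min_eq_left hij, max_eq_right hij, min_eq_right hij, max_eq_left hij, mul_add]
  have hA : ∑ i ∈ Finset.Icc 1 N, 2 * (i / 2) * a i ≤
      ∑ i ∈ Finset.Icc 1 N, ∑ j ∈ Finset.Icc 1 N, 2 * (i / 2) * (a i * b j) := by
    refine Finset.sum_le_sum fun i _ => ?_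
    simp only [← mul_assoc]
    rw [← Finset.mul_sum]
    exact Nat.le_mul_of_pos_right _ (one_le_sum_of_exists_ne_zero hb)
  have hB : ∑ j ∈ Finset.Icc 1 N, 2 * (j / 2) * b j ≤
      ∑ i ∈ Finset.Icc 1 N, ∑ j ∈ Finset.Icc 1 N, 2 * (j / 2) * (a i * b j) := by
    rw [Finset.sum_comm]
    refine Finset.sum_le_sum fun j _ => ?_
    simp only [mul_comm (a _), ← mul_assoc]
    rw [← Finset.mul_sum]
    exact Nat.le_mul_of_pos_right _ (one_le_sum_of_exists_ne_zero ha)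
  have hAB : (∑ i ∈ Finset.Icc 1 N, ∑ j ∈ Finset.Icc 1 N, 2 * (i / 2) * (a i * b j)) +
      ∑ i ∈ Finset.Icc 1 N, ∑ j ∈ Finset.Icc 1 N, 2 * (j / 2) * (a i * b j) ≤
      4 * ∑ i ∈ Finset.Icc 1 N, ∑ j ∈ Finset.Icc 1 N,
        min i j * (max i j - 1) * (a i * b j) := by
    simp only [← Finset.sum_add_distrib, Finset.mul_sum]
    refine Finset.sum_le_sum fun i hi => Finset.sum_le_sum fun j hj => ?_
    rw [← add_mul, ← mul_assoc 4]
    refine Nat.mul_le_mul_right _ ?_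
    have hi := (Finset.mem_Icc.1 hi).1
    have hj := (Finset.mem_Icc.1 hj).1
    have h₁ := sub_one_le_min_mul_max_sub_one hi hj
    have h₂ := sub_one_le_min_mul_max_sub_one hj hi
    rw [min_comm, max_comm] at h₂
    linarith [two_mul_div_two_le hi, two_mul_div_two_le hj]
  rw [hc, sum_mul_eq_sum_two_mul_div_two_add_sum_odd _ a,
    sum_mul_eq_sum_two_mul_div_two_add_sum_odd _ b, Finset.sum_add_distrib]
  linarith
end
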